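/- Let p ∈ (0,1) be fixed with p > 1 − 1/∛7. With high probability, G(n,p) contains a spanning r-flower A with r = ⌈(5/24)·log_{1/(1−p)} n⌉ whose associated sets satisfy |V^2| + … + |V^{r+1}| = n·((1−p)³ + o(1))/(1 − (1−p)³) and |V^{r+1}| = o(√n). -/

import Mathlib

open MeasureTheory Filter Real

/-- The index type of potential edges of a graph on `Fin n`. -/
abbrev EdgeType (n : ℕ) := {e : Sym2 (Fin n) // ¬ e.IsDiag}

/-- The product Bernoulli measure on edge-indicator functions: the binomial
random graph `G(n,p)`. -/
noncomputable def erMeasure (n : ℕ) (p : ℝ) : Measure (EdgeType n → Bool) :=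
  Measure.pi fun _ => (PMF.bernoulli (min (Real.toNNReal p) 1) (min_le_right _ _)).toMeasure

/-- The simple graph determined by an edge-indicator function. -/
def graphOf {n : ℕ} (ω : EdgeType n → Bool) : SimpleGraph (Fin n) :=
  SimpleGraph.fromEdgeSet {e | ∃ h : ¬ e.IsDiag, ω ⟨e, h⟩ = true}

/-- `H` contains a (not necessarily induced) copy of `F`. -/
def ContainsCopy {α β : Type*} (F : SimpleGraph α) (H : SimpleGraph β) : Prop :=
  ∃ f : α → β, Function.Injective f ∧ ∀ ⦃a b⦄, F.Adj a b → H.Adj (f a) (f b)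

/-- `H` is `F`-saturated in `G`: `H` is a spanning subgraph of `G` that is `F`-free,
and adding any edge of `G` missing from `H` creates a copy of `F`. -/
def IsSaturatedIn {V : Type*} {α : Type*} (G H : SimpleGraph V) (F : SimpleGraph α) : Prop :=
  H ≤ G ∧ ¬ ContainsCopy F H ∧
    ∀ v w : V, G.Adj v w → ¬ H.Adj v w →
      ContainsCopy F (H ⊔ SimpleGraph.fromEdgeSet {s(v, w)})

/-- The saturation number `sat(G,F)`: the minimum number of edges of an
`F`-saturated spanning subgraph of `G`. -/
noncomputable def satNum {V α : Type*} (G : SimpleGraph V) (F : SimpleGraph α) : ℕ :=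
  sInf {k | ∃ H : SimpleGraph V, IsSaturatedIn G H F ∧ H.edgeSet.ncard = k}

/-- The cycle `C_m`, as a graph on `ZMod m`. -/
def cycGraph (m : ℕ) : SimpleGraph (ZMod m) :=
  SimpleGraph.fromRel (fun a b => a = b + 1)

/-- The edges of `A` with one endpoint in `S` and the other in `T` form a perfect
matching between `S` and `T`. -/
def MatchingBetween {α : Type*} (A : SimpleGraph α) (S T : Set α) : Prop :=
  (∀ x ∈ S, ∃! y, y ∈ T ∧ A.Adj x y) ∧ (∀ y ∈ T, ∃! x, x ∈ S ∧ A.Adj x y)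

/-- The edges of `A` inside `S` form a perfect matching on `S`. -/
def MatchingOn {α : Type*} (A : SimpleGraph α) (S : Set α) : Prop :=
  ∀ x ∈ S, ∃! y, y ∈ S ∧ A.Adj x y

/-- The number of edges of `A` with both endpoints in `S`. -/
noncomputable def edgeCountIn {α : Type*} (A : SimpleGraph α) (S : Set α) : ℕ :=
  {e ∈ A.edgeSet | ∀ x ∈ e, x ∈ S}.ncard

/-- `A[S]` is an inclusion-maximal `C₄`-free graph. -/
def MaxC4FreeOn {α : Type*} (A : SimpleGraph α) (S : Set α) : Prop :=
  ¬ ContainsCopy (cycGraph 4) (A.induce S) ∧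
  ∀ x y : S, x ≠ y → ¬ (A.induce S).Adj x y →
    ContainsCopy (cycGraph 4) ((A.induce S) ⊔ SimpleGraph.fromEdgeSet {s(x, y)})

/-- `A` is an `r`-flower with associated sets `V 1 ⊇ … ⊇ V (r+1)`: there are
vertices `v i j`, triangles `R i = {v i 0, v i 1, v i 2}`, sets
`VP i j = N_{A[Vⁱ]}(v i j) ∖ R i` partitioned as `W i j ⊔ U i j ⊔ Y i j`, so that
each `Vⁱ` (for `i ∈ [r]`) is the disjoint union of `V (i+1)`, `R i` and the
`VP i j`, `V 1 = [n]`, the matching conditions (4.1)–(4.3) hold, `A[V^{r+1}]` is a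
maximal `C₄`-free graph, and `A` has no other edges. -/
def IsRFlower {n : ℕ} (A : SimpleGraph (Fin n)) (r : ℕ) (V : ℕ → Set (Fin n)) : Prop :=
  ∃ (v : ℕ → Fin 3 → Fin n) (R : ℕ → Set (Fin n))
    (VP W U Y : ℕ → Fin 3 → Set (Fin n)),
    -- (1) the decomposition
    V 1 = Set.univ ∧
    (∀ i, 1 ≤ i → i ≤ r →
      V i = V (i + 1) ∪ R i ∪ VP i 0 ∪ VP i 1 ∪ VP i 2 ∧
      (Set.univ : Set (Fin 5)).PairwiseDisjoint
        ![V (i + 1), R i, VP i 0, VP i 1, VP i 2]) ∧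
    -- (2) the triangles
    (∀ i, 1 ≤ i → i ≤ r →
      R i = {v i 0, v i 1, v i 2} ∧
      ∀ j k : Fin 3, j ≠ k → A.Adj (v i j) (v i k)) ∧
    -- (3) the petals
    (∀ i, 1 ≤ i → i ≤ r → ∀ j : Fin 3,
      VP i j = {x ∈ V i | A.Adj (v i j) x} \ R i) ∧
    -- (4) the partitions and matchings
    (∀ i, 1 ≤ i → i ≤ r → ∀ j : Fin 3,
      VP i j = W i j ∪ U i j ∪ Y i j ∧
      Disjoint (W i j) (U i j) ∧ Disjoint (W i j) (Y i j) ∧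
      Disjoint (U i j) (Y i j) ∧
      MatchingBetween A (W i j) (V (i + 1)) ∧
      MatchingBetween A (W i j) (U i j) ∧
      MatchingOn A (Y i j)) ∧
    -- (5) the core
    MaxC4FreeOn A (V (r + 1)) ∧
    -- (6) no other edges
    (∀ x y : Fin n, A.Adj x y →
      (x ∈ V (r + 1) ∧ y ∈ V (r + 1)) ∨
      ∃ i, 1 ≤ i ∧ i ≤ r ∧
        ((x ∈ R i ∧ y ∈ R i) ∨
         ∃ j : Fin 3,
           (x = v i j ∧ y ∈ VP i j) ∨ (y = v i j ∧ x ∈ VP i j) ∨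
           (x ∈ W i j ∧ y ∈ V (i + 1)) ∨ (y ∈ W i j ∧ x ∈ V (i + 1)) ∨
           (x ∈ W i j ∧ y ∈ U i j) ∨ (y ∈ W i j ∧ x ∈ U i j) ∨
           (x ∈ Y i j ∧ y ∈ Y i j)))

instance erMeasure_prob (n : ℕ) (p : ℝ) : IsProbabilityMeasure (erMeasure n p) := by
  unfold erMeasure; infer_instance

/-- weight of an edge value -/
noncomputable def bw (p : ℝ) (b : Bool) : ℝ := if b then p else 1 - p

lemma bern_apply (p : ℝ) (hp0 : 0 < p) (hp1 : p < 1) (b : Bool) :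
    (PMF.bernoulli (min (Real.toNNReal p) 1) (min_le_right _ _)).toMeasure {b}
      = ENNReal.ofReal (bw p b) := by
  rw [PMF.toMeasure_apply_singleton _ _ (by measurability), PMF.bernoulli_apply]
  have h1 : min (Real.toNNReal p) 1 = Real.toNNReal p := by
    apply min_eq_left
    exact Real.toNNReal_le_one.2 hp1.le
  cases b
  · simp only [bw, h1, cond_false, Bool.false_eq_true, if_false]
    rw [ENNReal.ofReal_sub _ hp0.le]; simp [ENNReal.ofReal]
  · simp only [bw, h1, cond_true, if_true]
    rfl

lemma bw_nonneg (p : ℝ) (hp0 : 0 < p) (hp1 : p < 1) (b : Bool) : 0 ≤ bw p b := by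
  unfold bw; split_ifs <;> linarith

lemma cyl (n : ℕ) (p : ℝ) (hp0 : 0 < p) (hp1 : p < 1) (E : Finset (EdgeType n))
    (b : EdgeType n → Bool) :
    erMeasure n p {ω | ∀ e ∈ E, ω e = b e} = ∏ e ∈ E, ENNReal.ofReal (bw p (b e)) := by
  classical
  have : {ω : EdgeType n → Bool | ∀ e ∈ E, ω e = b e}
      = Set.pi Set.univ (fun e => if e ∈ E then {b e} else Set.univ) := by
    ext ω
    simp only [Set.mem_ofPred_eq, Set.mem_pi, Set.mem_univ, true_implies]
    refine forall_congr' fun e => ?_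
    by_cases h : e ∈ E <;> simp [h]
  rw [this, erMeasure, Measure.pi_pi]
  rw [← Finset.prod_subset (Finset.subset_univ E)]
  · refine Finset.prod_congr rfl fun e he => ?_
    simp only [he, if_true]
    exact bern_apply p hp0 hp1 (b e)
  · intro e _ he
    simp only [he, if_false]
    exact measure_univ

lemma graphOf_adj {n : ℕ} (ω : EdgeType n → Bool) (a b : Fin n) :
    (graphOf ω).Adj a b ↔ ∃ h : a ≠ b, ω ⟨s(a, b), by simpa using h⟩ = true := by
  unfold graphOf
  rw [SimpleGraph.fromEdgeSet_adj]
  constructor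
  · rintro ⟨⟨h, h2⟩, h3⟩
    exact ⟨h3, h2⟩
  · rintro ⟨h, h2⟩
    exact ⟨⟨_, h2⟩, h⟩

open Classical in
/-- number of vertices outside `T` whose neighbourhood in `T` is `P` -/
noncomputable def cnt {n : ℕ} (G : SimpleGraph (Fin n)) (T P : Finset (Fin n)) : ℕ :=
  (Finset.univ.filter (fun z => z ∉ T ∧ ∀ t ∈ T, (G.Adj t z ↔ t ∈ P))).card

/-- uniform pattern property -/
def UProp {n : ℕ} (G : SimpleGraph (Fin n)) (p : ℝ) (k : ℕ) (δ : ℝ) : Prop :=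
  ∀ T P : Finset (Fin n), T.card ≤ k → P ⊆ T →
    |(cnt G T P : ℝ) - p ^ P.card * (1 - p) ^ (T.card - P.card) * n| ≤ δ * n

/-- no large bipartite holes -/
def HProp {n : ℕ} (G : SimpleGraph (Fin n)) (γ : ℝ) : Prop :=
  ∀ A B : Finset (Fin n), Disjoint A B → γ * n ≤ A.card → γ * n ≤ B.card →
    ∃ a ∈ A, ∃ b ∈ B, G.Adj a b

open Classical in
noncomputable def EZ {n : ℕ} (T : Finset (Fin n)) (z : Fin n) : Finset (EdgeType n) :=
  Finset.univ.filter (fun e => z ∈ e.1 ∧ ∃ t ∈ T, t ∈ e.1)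

open Classical in
noncomputable def bP {n : ℕ} (P : Finset (Fin n)) (e : EdgeType n) : Bool :=
  decide (∃ t ∈ P, t ∈ e.1)

/-- pattern event -/
def PE {n : ℕ} (T P : Finset (Fin n)) (z : Fin n) : Set (EdgeType n → Bool) :=
  {ω | ∀ t ∈ T, ((graphOf ω).Adj t z ↔ t ∈ P)}

lemma PE_eq {n : ℕ} (T P : Finset (Fin n)) (hP : P ⊆ T) (z : Fin n) (hz : z ∉ T) :
    PE T P z = {ω | ∀ e ∈ EZ T z, ω e = bP P e} := by
  classical
  ext ω
  simp only [PE, Set.mem_ofPred_eq, EZ, Finset.mem_filter, Finset.mem_univ, true_and]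
  have key : ∀ t ∈ T, ∀ h : t ≠ z,
      (bP P ⟨s(t, z), by simpa using h⟩ = true ↔ t ∈ P) := by
    intro t ht h
    simp only [bP, decide_eq_true_eq]
    constructor
    · rintro ⟨t', ht', h'⟩
      rcases Sym2.mem_iff.1 h' with h' | h'
      · rwa [← h']
      · exact absurd (h' ▸ hP ht') hz
    · intro h; exact ⟨t, h, Sym2.mem_mk_left _ _⟩
  constructor
  · rintro h ⟨e, he⟩ ⟨hze, t, ht, hte⟩
    have htz : t ≠ z := by rintro rfl; exact hz ht
    have : e = s(t, z) := ((Sym2.mem_and_mem_iff htz).1 ⟨hte, hze⟩)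
    subst this
    have h1 := h t ht
    rw [graphOf_adj] at h1
    have h2 := key t ht htz
    rw [Bool.eq_iff_iff, h2, ← h1]
    exact ⟨fun h => ⟨htz, h⟩, fun ⟨_, h⟩ => h⟩
  · intro h t ht
    have htz : t ≠ z := by rintro rfl; exact hz ht
    have h1 := h ⟨s(t, z), by simpa using htz⟩ ⟨Sym2.mem_mk_right _ _, t, ht, Sym2.mem_mk_left _ _⟩
    rw [graphOf_adj, ← key t ht htz, ← h1]
    exact ⟨fun ⟨_, h⟩ => h, fun h => ⟨htz, h⟩⟩

lemma EZ_disj {n : ℕ} (T : Finset (Fin n)) (z z' : Fin n) (hz : z ∉ T) (hz' : z' ∉ T) (h : z ≠ z') :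
    Disjoint (EZ T z) (EZ T z') := by
  classical
  rw [Finset.disjoint_left]
  rintro e he he'
  simp only [EZ, Finset.mem_filter, Finset.mem_univ, true_and] at he he'
  obtain ⟨h1, t, ht, hte⟩ := he
  have := (Sym2.mem_and_mem_iff h).1 ⟨h1, he'.1⟩
  rw [this] at hte
  rcases Sym2.mem_iff.1 hte with h | h
  · exact hz (h ▸ ht)
  · exact hz' (h ▸ ht)

lemma prod_EZ {n : ℕ} (p : ℝ) (T P : Finset (Fin n)) (hP : P ⊆ T) (z : Fin n) (hz : z ∉ T) :
    ∏ e ∈ EZ T z, bw p (bP P e) = p ^ P.card * (1 - p) ^ (T.card - P.card) := by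
  classical
  have h1 : ∏ t ∈ T, (if t ∈ P then p else 1 - p) = ∏ e ∈ EZ T z, bw p (bP P e) := by
    have hne : ∀ t ∈ T, t ≠ z := by rintro t ht rfl; exact hz ht
    refine Finset.prod_bij (fun t ht => ⟨s(t, z), by simpa using hne t ht⟩) ?_ ?_ ?_ ?_
    · intro t ht
      simp only [EZ, Finset.mem_filter, Finset.mem_univ, true_and]
      exact ⟨Sym2.mem_mk_right _ _, t, ht, Sym2.mem_mk_left _ _⟩
    · intro a ha b hb hab
      simp only [Subtype.mk.injEq] at hab
      exact Sym2.congr_left.1 hab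
    · rintro ⟨e, he⟩ hm
      simp only [EZ, Finset.mem_filter, Finset.mem_univ, true_and] at hm
      obtain ⟨h1, t, ht, hte⟩ := hm
      exact ⟨t, ht, by simp only [Subtype.mk.injEq]; exact ((Sym2.mem_and_mem_iff (hne t ht)).1 ⟨hte, h1⟩).symm⟩
    · intro t ht
      have : (∃ t' ∈ P, t' ∈ s(t, z)) ↔ t ∈ P := by
        constructor
        · rintro ⟨t', ht', h'⟩
          rcases Sym2.mem_iff.1 h' with h' | h'
          · rwa [← h']
          · exact absurd (h' ▸ hP ht') hz
        · intro h; exact ⟨t, h, Sym2.mem_mk_left _ _⟩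
      simp only [bw, bP, this, decide_eq_true_eq]
  rw [← h1, Finset.prod_ite, Finset.prod_const, Finset.prod_const, Finset.filter_mem_eq_inter,
    Finset.inter_eq_right.2 hP, Finset.filter_notMem_eq_sdiff, Finset.card_sdiff_of_subset hP]

lemma PE_inter (n : ℕ) (p : ℝ) (hp0 : 0 < p) (hp1 : p < 1) (T P : Finset (Fin n)) (hP : P ⊆ T)
    (Zs : Finset (Fin n)) (hZ : ∀ z ∈ Zs, z ∉ T) :
    erMeasure n p (⋂ z ∈ Zs, PE T P z)
      = ∏ z ∈ Zs, ENNReal.ofReal (p ^ P.card * (1 - p) ^ (T.card - P.card)) := by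
  classical
  have : (⋂ z ∈ Zs, PE T P z) = {ω | ∀ e ∈ Zs.biUnion (EZ T), ω e = bP P e} := by
    ext ω
    simp only [Set.mem_iInter, Set.mem_ofPred_eq, Finset.mem_biUnion]
    constructor
    · rintro h e ⟨z, hz, he⟩
      have := h z hz
      rw [PE_eq T P hP z (hZ z hz)] at this
      exact this e he
    · intro h z hz
      rw [PE_eq T P hP z (hZ z hz)]
      exact fun e he => h e ⟨z, hz, he⟩
  rw [this, cyl n p hp0 hp1, Finset.prod_biUnion]
  · refine Finset.prod_congr rfl fun z hz => ?_
    rw [← ENNReal.ofReal_prod_of_nonneg (fun _ _ => bw_nonneg p hp0 hp1 _),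
      prod_EZ p T P hP z (hZ z hz)]
  · intro z hz z' hz' h
    exact EZ_disj T z z' (hZ z hz) (hZ z' hz') h

lemma er_meas {n : ℕ} (S : Set (EdgeType n → Bool)) : MeasurableSet S :=
  (Set.toFinite S).measurableSet

lemma PE_indep (n : ℕ) (p : ℝ) (hp0 : 0 < p) (hp1 : p < 1) (T P : Finset (Fin n)) (hP : P ⊆ T) :
    ProbabilityTheory.iIndepSet (fun z : {z : Fin n // z ∉ T} => PE T P z.1) (erMeasure n p) := by
  classical
  rw [ProbabilityTheory.iIndepSet_iff_meas_biInter (fun _ => er_meas _)]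
  intro s
  have h1 := PE_inter n p hp0 hp1 T P hP (s.map (Function.Embedding.subtype _))
    (by simp only [Finset.mem_map]; rintro z ⟨a, _, rfl⟩; exact a.2)
  have h2 : (⋂ z ∈ s.map (Function.Embedding.subtype _), PE T P z) = ⋂ i ∈ s, PE T P i.1 := by
    ext ω; simp
  rw [h2] at h1
  rw [h1, Finset.prod_map]
  refine Finset.prod_congr rfl fun z hz => ?_
  have h3 := PE_inter n p hp0 hp1 T P hP {z.1} (by simpa using z.2)
  simp only [Finset.mem_singleton, Set.iInter_iInter_eq_left, Finset.prod_singleton] at h3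
  rw [h3]

lemma tail_one {Ω ι : Type*} [MeasurableSpace Ω] [Fintype ι] (μ : Measure Ω) [IsProbabilityMeasure μ]
    (S : ι → Set Ω) (hS : ∀ i, MeasurableSet (S i)) (hi : ProbabilityTheory.iIndepSet S μ) (c a : ℝ)
    (hc : ∀ i, μ.real (S i) = c) (m : ℝ) (hm : (Fintype.card ι : ℝ) ≤ m) (hm0 : 0 < m) (t : ℝ) (ht : 0 ≤ t)
    (ha : a = 1 ∨ a = -1) (h0 : 0 < Fintype.card ι) :
    μ.real {ω | t ≤ ∑ i, a * ((S i).indicator (fun _ => (1:ℝ)) ω - c)} ≤ Real.exp (-2 * t ^ 2 / m) := by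
  have h1 : ProbabilityTheory.iIndepFun (fun i => (S i).indicator fun _ => (1:ℝ)) μ :=
    hi.iIndepFun_indicator
  have h2 : ProbabilityTheory.iIndepFun
      (fun i ω => a * ((S i).indicator (fun _ => (1:ℝ)) ω - c)) μ :=
    h1.comp (fun _ x => a * (x - c)) (fun _ => by fun_prop)
  have hsub : ∀ i, ProbabilityTheory.HasSubgaussianMGF
      (fun ω => (S i).indicator (fun _ => (1:ℝ)) ω - c) ((‖(1:ℝ) - 0‖₊ / 2) ^ 2) μ := by
    intro i
    have := ProbabilityTheory.hasSubgaussianMGF_of_mem_Icc (μ := μ) (a := 0) (b := 1)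
      (X := (S i).indicator (fun _ => (1:ℝ))) ((measurable_const.indicator (hS i)).aemeasurable)
      (Filter.Eventually.of_forall fun ω => by
        by_cases h : ω ∈ S i <;> simp [h])
    rw [integral_indicator_const _ (hS i), hc i] at this
    simpa using this
  have hsub2 : ∀ i ∈ (Finset.univ : Finset ι), ProbabilityTheory.HasSubgaussianMGF
      (fun ω => a * ((S i).indicator (fun _ => (1:ℝ)) ω - c)) ((1 / 2) ^ 2) μ := by
    intro i _
    have h := hsub i
    have e : ((‖(1:ℝ) - 0‖₊ / 2) ^ 2) = ((1 / 2) ^ 2 : NNReal) := by simp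
    rw [e] at h
    rcases ha with rfl | rfl
    · simpa using h
    · have := h.neg
      convert this using 1
      ext ω; simp
  have h3 := ProbabilityTheory.HasSubgaussianMGF.measure_sum_ge_le_of_iIndepFun h2 hsub2 ht
  refine h3.trans (Real.exp_le_exp.2 ?_)
  simp only [Finset.sum_const, Finset.card_univ, nsmul_eq_mul]
  push_cast
  have h0' : (0:ℝ) < Fintype.card ι := by exact_mod_cast h0
  rw [div_le_div_iff₀ (by positivity) hm0]
  nlinarith [sq_nonneg t, mul_nonneg (sq_nonneg t) (sub_nonneg.2 hm)]


lemma PE_real (n : ℕ) (p : ℝ) (hp0 : 0 < p) (hp1 : p < 1) (T P : Finset (Fin n)) (hP : P ⊆ T)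
    (z : Fin n) (hz : z ∉ T) :
    (erMeasure n p).real (PE T P z) = p ^ P.card * (1 - p) ^ (T.card - P.card) := by
  have h3 := PE_inter n p hp0 hp1 T P hP {z} (by simpa using hz)
  simp only [Finset.mem_singleton, Set.iInter_iInter_eq_left, Finset.prod_singleton] at h3
  have hq : 0 ≤ 1 - p := by linarith
  rw [Measure.real, h3, ENNReal.toReal_ofReal (by positivity)]

lemma cnt_sum {n : ℕ} (T P : Finset (Fin n)) (ω : EdgeType n → Bool) :
    (cnt (graphOf ω) T P : ℝ) = ∑ z : {z : Fin n // z ∉ T}, (PE T P z.1).indicator (fun _ => (1:ℝ)) ω := by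
  classical
  unfold cnt
  rw [Finset.card_filter]
  push_cast
  rw [← Finset.sum_subtype (Finset.univ.filter (fun z => z ∉ T)) (by simp)
    (f := fun z => (PE T P z).indicator (fun _ => (1:ℝ)) ω), Finset.sum_filter]
  refine Finset.sum_congr rfl fun z _ => ?_
  by_cases hz : z ∈ T
  · simp [hz]
  · simp only [hz, Set.indicator, PE, not_false_eq_true, true_and, if_true, Set.mem_ofPred_eq]
    congr

lemma tail_two (n : ℕ) (p : ℝ) (hp0 : 0 < p) (hp1 : p < 1) (T P : Finset (Fin n)) (hP : P ⊆ T)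
    (k : ℕ) (hk : T.card ≤ k) (δ : ℝ) (hδ : 0 < δ) (hn : (k:ℝ) < n) (hn2 : k ≤ δ / 2 * n) :
    (erMeasure n p).real {ω | ¬ |(cnt (graphOf ω) T P : ℝ) - p ^ P.card * (1 - p) ^ (T.card - P.card) * n| ≤ δ * n}
      ≤ 2 * Real.exp (- (δ ^ 2 / 2) * n) := by
  classical
  set c := p ^ P.card * (1 - p) ^ (T.card - P.card) with hc
  have hq : 0 ≤ 1 - p := by linarith
  have hc0 : 0 ≤ c := by positivity
  have hc1 : c ≤ 1 := mul_le_one₀ (pow_le_one₀ hp0.le hp1.le) (by positivity) (pow_le_one₀ hq (by linarith))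
  have hk' : (T.card : ℝ) ≤ k := by exact_mod_cast hk
  have hcard : (Fintype.card {z : Fin n // z ∉ T} : ℝ) = n - T.card := by
    rw [Fintype.card_subtype_compl]
    simp only [Fintype.card_fin, Fintype.card_coe]
    rw [Nat.cast_sub (by exact_mod_cast (hk'.trans hn.le))]
  have hpos : 0 < Fintype.card {z : Fin n // z ∉ T} := by
    have : (0:ℝ) < Fintype.card {z : Fin n // z ∉ T} := by rw [hcard]; linarith
    exact_mod_cast this
  have hn0 : (0:ℝ) < n := lt_of_le_of_lt (by positivity) hn
  have ht := fun a (ha : a = 1 ∨ a = -1) => tail_one (erMeasure n p) (fun z : {z : Fin n // z ∉ T} => PE T P z.1)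
    (fun _ => er_meas _) (PE_indep n p hp0 hp1 T P hP) c a (fun z => PE_real n p hp0 hp1 T P hP z.1 z.2)
    n (by rw [hcard]; linarith [(Nat.cast_nonneg T.card : (0:ℝ) ≤ T.card)]) hn0 (δ / 2 * n) (by positivity) ha hpos
  have he : -2 * (δ / 2 * n) ^ 2 / n = - (δ ^ 2 / 2) * n := by field_simp
  rw [he] at ht
  have hsum : ∀ (ω : EdgeType n → Bool) (a : ℝ), ∑ z : {z : Fin n // z ∉ T},
      a * ((PE T P z.1).indicator (fun _ => (1:ℝ)) ω - c)
      = a * ((cnt (graphOf ω) T P : ℝ) - c * (n - T.card)) := by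
    intro ω a
    rw [← Finset.mul_sum, Finset.sum_sub_distrib, ← cnt_sum]
    simp only [Finset.sum_const, Finset.card_univ, nsmul_eq_mul, hcard]
    ring
  have hT0 : (0:ℝ) ≤ T.card := Nat.cast_nonneg _
  calc _ ≤ (erMeasure n p).real ({ω | δ / 2 * n ≤ ∑ z : {z : Fin n // z ∉ T},
              1 * ((PE T P z.1).indicator (fun _ => (1:ℝ)) ω - c)} ∪
            {ω | δ / 2 * n ≤ ∑ z : {z : Fin n // z ∉ T},
              (-1) * ((PE T P z.1).indicator (fun _ => (1:ℝ)) ω - c)}) := by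
        refine measureReal_mono ?_
        intro ω hω
        simp only [Set.mem_union, Set.mem_ofPred_eq, hsum] at hω ⊢
        by_contra hcon
        push Not at hcon
        apply hω
        rw [abs_le]
        have : c * T.card ≤ k := by nlinarith
        have : 0 ≤ c * T.card := by positivity
        constructor <;> nlinarith [hcon.1, hcon.2]
    _ ≤ _ := (measureReal_union_le _ _).trans (by
        have h1 := ht 1 (Or.inl rfl)
        have h2 := ht (-1) (Or.inr rfl)
        linarith)

lemma card_small (n k : ℕ) (hn : 1 ≤ n) :
    ((Finset.univ : Finset (Finset (Fin n))).filter (fun T => T.card ≤ k)).card ≤ (k + 1) * n ^ k := by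
  classical
  have : ((Finset.univ : Finset (Finset (Fin n))).filter (fun T => T.card ≤ k))
      ⊆ (Finset.range (k + 1)).biUnion (fun j => Finset.powersetCard j Finset.univ) := by
    intro T hT
    simp only [Finset.mem_filter, Finset.mem_univ, true_and] at hT
    simp only [Finset.mem_biUnion, Finset.mem_range, Finset.mem_powersetCard]
    exact ⟨T.card, by omega, Finset.subset_univ _, rfl⟩
  refine (Finset.card_le_card this).trans (Finset.card_biUnion_le.trans ?_)
  calc _ ≤ ∑ j ∈ Finset.range (k + 1), n ^ k := by
        refine Finset.sum_le_sum fun j hj => ?_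
        rw [Finset.card_powersetCard, Finset.card_univ, Fintype.card_fin]
        exact (Nat.choose_le_pow n j).trans (Nat.pow_le_pow_right hn (by
          have := Finset.mem_range.1 hj; omega))
    _ = _ := by simp

lemma UProp_whp (p : ℝ) (hp0 : 0 < p) (hp1 : p < 1) (k : ℕ) (δ : ℝ) (hδ : 0 < δ) :
    Tendsto (fun n : ℕ => (erMeasure n p).real {ω | ¬ UProp (graphOf ω) p k δ}) atTop (nhds 0) := by
  classical
  have hlim : Tendsto (fun n : ℕ => 2 * ((k:ℝ) + 1) ^ 2 * ((n:ℝ) ^ (2 * k) * Real.exp (- (δ ^ 2 / 2) * n)))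
      atTop (nhds 0) := by
    have h1 : Tendsto (fun x : ℝ => x ^ (2 * k) * Real.exp (- (δ ^ 2 / 2) * x)) atTop (nhds 0) := by
      have := tendsto_rpow_mul_exp_neg_mul_atTop_nhds_zero (2 * k : ℕ) (δ ^ 2 / 2) (by positivity)
      simpa only [Real.rpow_natCast] using this
    have := (h1.comp tendsto_natCast_atTop_atTop).const_mul (2 * ((k:ℝ) + 1) ^ 2)
    simpa using this
  have hb : ∀ᶠ n : ℕ in atTop, (k:ℝ) < n ∧ k ≤ δ / 2 * n := by
    have h1 : Tendsto (fun n : ℕ => δ / 2 * (n:ℝ)) atTop atTop :=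
      tendsto_natCast_atTop_atTop.const_mul_atTop (by positivity)
    exact (tendsto_natCast_atTop_atTop.eventually_gt_atTop (k:ℝ)).and (h1.eventually_ge_atTop (k:ℝ))
  refine tendsto_of_tendsto_of_tendsto_of_le_of_le' tendsto_const_nhds hlim
    (Eventually.of_forall fun n => measureReal_nonneg) ?_
  filter_upwards [hb] with n hn
  have hn1 : 1 ≤ n := by
    have : (0:ℝ) < n := lt_of_le_of_lt (Nat.cast_nonneg k) hn.1
    have : 0 < n := by exact_mod_cast this
    omega
  set F := ((Finset.univ : Finset (Finset (Fin n))).filter (fun T => T.card ≤ k)) with hF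
  set B : Finset (Fin n) × Finset (Fin n) → Set (EdgeType n → Bool) := fun TP =>
    if TP.2 ⊆ TP.1 then {ω | ¬ |(cnt (graphOf ω) TP.1 TP.2 : ℝ) - p ^ TP.2.card *
      (1 - p) ^ (TP.1.card - TP.2.card) * n| ≤ δ * n} else ∅ with hB
  have hsub : {ω | ¬ UProp (graphOf ω) p k δ} ⊆ ⋃ TP ∈ F ×ˢ F, B TP := by
    intro ω hω
    simp only [Set.mem_ofPred_eq, UProp] at hω
    push Not at hω
    obtain ⟨T, P, hT, hP, h⟩ := hω
    simp only [Set.mem_iUnion]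
    refine ⟨(T, P), ?_, ?_⟩
    · simp only [hF, Finset.mem_product, Finset.mem_filter, Finset.mem_univ, true_and]
      exact ⟨hT, (Finset.card_le_card hP).trans hT⟩
    · simp only [hB, hP, if_true, Set.mem_ofPred_eq, not_le]
      exact h
  calc _ ≤ (erMeasure n p).real (⋃ TP ∈ F ×ˢ F, B TP) := measureReal_mono hsub (measure_ne_top _ _)
    _ ≤ ∑ TP ∈ F ×ˢ F, (erMeasure n p).real (B TP) := measureReal_biUnion_finset_le _ _
    _ ≤ ∑ TP ∈ F ×ˢ F, 2 * Real.exp (- (δ ^ 2 / 2) * n) := by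
        refine Finset.sum_le_sum fun TP hTP => ?_
        simp only [hF, Finset.mem_product, Finset.mem_filter, Finset.mem_univ, true_and] at hTP
        by_cases h : TP.2 ⊆ TP.1
        · simp only [hB, h, if_true]
          exact tail_two n p hp0 hp1 TP.1 TP.2 h k hTP.1 δ hδ hn.1 hn.2
        · simp only [hB, h, if_false, measureReal_empty]
          positivity
    _ = (F.card : ℝ) ^ 2 * (2 * Real.exp (- (δ ^ 2 / 2) * n)) := by
        rw [Finset.sum_const, Finset.card_product, nsmul_eq_mul]; push_cast; ring
    _ ≤ (((k:ℝ) + 1) * n ^ k) ^ 2 * (2 * Real.exp (- (δ ^ 2 / 2) * n)) := by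
        have : (F.card : ℝ) ≤ ((k:ℝ) + 1) * n ^ k := by exact_mod_cast card_small n k hn1
        gcongr
    _ = _ := by ring

lemma HProp_whp (p : ℝ) (hp0 : 0 < p) (hp1 : p < 1) (γ : ℝ) (hγ : 0 < γ) :
    Tendsto (fun n : ℕ => (erMeasure n p).real {ω | ¬ HProp (graphOf ω) γ}) atTop (nhds 0) := by
  classical
  have hq : 0 < 1 - p := by linarith
  have hone : ∀ (n : ℕ) (A B : Finset (Fin n)), Disjoint A B → γ * n ≤ A.card → γ * n ≤ B.card →
      (erMeasure n p).real {ω | ∀ a ∈ A, ∀ b ∈ B, ¬ (graphOf ω).Adj a b} ≤ Real.exp (Real.log (1 - p) * (γ * n) ^ 2) := by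
    intro n A B hAB hA hB
    set E : Finset (EdgeType n) := Finset.univ.filter (fun e => ∃ a ∈ A, ∃ b ∈ B, e.1 = s(a, b)) with hE
    have hEc : E.card = A.card * B.card := by
      rw [← Finset.card_product]
      symm
      refine Finset.card_bij (fun x hx => ⟨s(x.1, x.2), ?_⟩) ?_ ?_ ?_
      · rw [Finset.mem_product] at hx
        simp only [Sym2.mk_isDiag_iff]
        exact fun h => Finset.disjoint_left.1 hAB hx.1 (h ▸ hx.2)
      · intro x hx
        rw [Finset.mem_product] at hx
        simp only [hE, Finset.mem_filter, Finset.mem_univ, true_and]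
        exact ⟨x.1, hx.1, x.2, hx.2, rfl⟩
      · rintro ⟨a, b⟩ hx ⟨a', b'⟩ hx' h
        rw [Finset.mem_product] at hx hx'
        simp only [Subtype.mk.injEq, Sym2.eq_iff] at h
        rcases h with ⟨rfl, rfl⟩ | ⟨rfl, rfl⟩
        · rfl
        · exact absurd hx'.2 (Finset.disjoint_left.1 hAB hx.1)
      · rintro ⟨e, he⟩ hm
        simp only [hE, Finset.mem_filter, Finset.mem_univ, true_and] at hm
        obtain ⟨a, ha, b, hb, rfl⟩ := hm
        exact ⟨(a, b), by simp [ha, hb], rfl⟩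
    have hset : {ω : EdgeType n → Bool | ∀ a ∈ A, ∀ b ∈ B, ¬ (graphOf ω).Adj a b} ⊆ {ω | ∀ e ∈ E, ω e = (fun _ => false) e} := by
      intro ω hω
      simp only [Set.mem_ofPred_eq] at hω ⊢
      rintro ⟨e, he⟩ hm
      simp only [hE, Finset.mem_filter, Finset.mem_univ, true_and] at hm
      obtain ⟨a, ha, b, hb, rfl⟩ := hm
      have h := hω a ha b hb
      rw [graphOf_adj] at h
      push Not at h
      simpa using h (by simpa using he)
    refine (measureReal_mono hset).trans ?_
    rw [Measure.real, cyl n p hp0 hp1 E]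
    simp only [bw, Bool.false_eq_true, if_false, Finset.prod_const, hEc, ENNReal.toReal_pow]
    rw [ENNReal.toReal_ofReal hq.le]
    have : Real.exp (Real.log (1 - p) * ((A.card * B.card : ℕ) : ℝ)) = (1 - p) ^ (A.card * B.card) := by
      rw [mul_comm, Real.exp_nat_mul, Real.exp_log hq]
    rw [← this, Real.exp_le_exp]
    have hl : Real.log (1 - p) ≤ 0 := Real.log_nonpos hq.le (by linarith)
    apply mul_le_mul_of_nonpos_left _ hl
    push_cast
    rw [sq]
    exact mul_le_mul hA hB (by positivity) (by positivity)
  have hlog : Real.log (1 - p) < 0 := Real.log_neg hq (by linarith)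
  have hlim : Tendsto (fun n : ℕ => Real.exp (-(n:ℝ))) atTop (nhds 0) :=
    Real.tendsto_exp_neg_atTop_nhds_zero.comp tendsto_natCast_atTop_atTop
  have hb : ∀ᶠ n : ℕ in atTop, 3 ≤ -Real.log (1 - p) * γ ^ 2 * (n:ℝ) := by
    have h1 : Tendsto (fun n : ℕ => -Real.log (1 - p) * γ ^ 2 * (n:ℝ)) atTop atTop :=
      tendsto_natCast_atTop_atTop.const_mul_atTop (mul_pos (by linarith) (by positivity))
    exact h1.eventually_ge_atTop 3
  refine tendsto_of_tendsto_of_tendsto_of_le_of_le' tendsto_const_nhds hlim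
    (Eventually.of_forall fun n => measureReal_nonneg) ?_
  filter_upwards [hb] with n hn
  set B : Finset (Fin n) × Finset (Fin n) → Set (EdgeType n → Bool) := fun AB =>
    if Disjoint AB.1 AB.2 ∧ γ * n ≤ AB.1.card ∧ γ * n ≤ AB.2.card then
      {ω | ∀ a ∈ AB.1, ∀ b ∈ AB.2, ¬ (graphOf ω).Adj a b} else ∅ with hB
  have hsub : {ω | ¬ HProp (graphOf ω) γ} ⊆ ⋃ AB ∈ (Finset.univ : Finset (Finset (Fin n) × Finset (Fin n))), B AB := by
    intro ω hω
    simp only [Set.mem_ofPred_eq, HProp] at hω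
    push Not at hω
    obtain ⟨S, T, h1, h2, h3, h⟩ := hω
    simp only [Set.mem_iUnion]
    refine ⟨(S, T), Finset.mem_univ _, ?_⟩
    simp only [hB]
    rw [if_pos ⟨h1, h2, h3⟩]
    exact h
  have hn0 : (0:ℝ) ≤ n := Nat.cast_nonneg n
  calc _ ≤ (erMeasure n p).real (⋃ AB ∈ (Finset.univ : Finset (Finset (Fin n) × Finset (Fin n))), B AB) :=
        measureReal_mono hsub (measure_ne_top _ _)
    _ ≤ ∑ AB : Finset (Fin n) × Finset (Fin n), (erMeasure n p).real (B AB) := measureReal_biUnion_finset_le _ _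
    _ ≤ ∑ AB : Finset (Fin n) × Finset (Fin n), Real.exp (-3 * n) := by
        refine Finset.sum_le_sum fun AB _ => ?_
        simp only [hB]
        split_ifs with h
        · refine (hone n AB.1 AB.2 h.1 h.2.1 h.2.2).trans (Real.exp_le_exp.2 ?_)
          nlinarith
        · simp only [measureReal_empty]; positivity
    _ = (4:ℝ) ^ n * Real.exp (-3 * n) := by
        rw [Finset.sum_const, Finset.card_univ, Fintype.card_prod, Fintype.card_finset, Fintype.card_fin, nsmul_eq_mul]
        push_cast
        rw [← mul_pow]; norm_num
    _ ≤ Real.exp 2 ^ n * Real.exp (-3 * n) := by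
        have : (4:ℝ) ≤ Real.exp 2 := by
          have := Real.add_one_le_exp (1:ℝ)
          have h2 : Real.exp 2 = Real.exp 1 * Real.exp 1 := by rw [← Real.exp_add]; norm_num
          rw [h2]; nlinarith
        gcongr
    _ = _ := by
        rw [← Real.exp_nat_mul, ← Real.exp_add]; congr 1; ring

/-- The reduction to a deterministic statement. -/
lemma whp_of_det (p : ℝ) (hp0 : 0 < p) (hp1 : p < 1) (k : ℕ) (δ γ : ℝ) (hδ : 0 < δ) (hγ : 0 < γ)
    (C : (n : ℕ) → SimpleGraph (Fin n) → Prop)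
    (h : ∀ᶠ n : ℕ in atTop, ∀ G : SimpleGraph (Fin n), UProp G p k δ → HProp G γ → C n G) :
    Tendsto (fun n : ℕ => erMeasure n p {ω | C n (graphOf ω)}) atTop (nhds 1) := by
  have hbad : Tendsto (fun n : ℕ => (erMeasure n p).real {ω | ¬ C n (graphOf ω)}) atTop (nhds 0) := by
    have := (UProp_whp p hp0 hp1 k δ hδ).add (HProp_whp p hp0 hp1 γ hγ)
    rw [add_zero] at this
    refine tendsto_of_tendsto_of_tendsto_of_le_of_le' tendsto_const_nhds this
      (Eventually.of_forall fun n => measureReal_nonneg) ?_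
    filter_upwards [h] with n hn
    refine (measureReal_mono ?_).trans (measureReal_union_le _ _)
    intro ω hω
    by_contra hcon
    simp only [Set.mem_union, Set.mem_ofPred_eq, not_or, not_not] at hcon
    exact hω (hn _ hcon.1 hcon.2)
  have hgood : ∀ n : ℕ, erMeasure n p {ω | C n (graphOf ω)} =
      ENNReal.ofReal (1 - (erMeasure n p).real {ω | ¬ C n (graphOf ω)}) := by
    intro n
    have h1 : {ω : EdgeType n → Bool | ¬ C n (graphOf ω)} = {ω | C n (graphOf ω)}ᶜ := rfl
    rw [h1, probReal_compl_eq_one_sub (er_meas _)]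
    simp
  simp only [hgood]
  have := (ENNReal.continuous_ofReal.tendsto 1).comp (by simpa using hbad.const_sub 1 :
    Tendsto (fun n : ℕ => 1 - (erMeasure n p).real {ω | ¬ C n (graphOf ω)}) atTop (nhds 1))
  simpa [Function.comp_def] using this

/-- one layer of a flower -/
structure FStepD {α : Type*} (A : SimpleGraph α) (S X : Set α) (v : Fin 3 → α)
    (VP W U Y : Fin 3 → Set α) : Prop where
  cover : S = X ∪ {v 0, v 1, v 2} ∪ VP 0 ∪ VP 1 ∪ VP 2
  vX : ∀ j, v j ∉ X
  vVP : ∀ j k, v j ∉ VP k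
  XVP : ∀ j, Disjoint X (VP j)
  VPVP : ∀ j k, j ≠ k → Disjoint (VP j) (VP k)
  tri : ∀ j k, j ≠ k → A.Adj (v j) (v k)
  vadj : ∀ j, ∀ x ∈ VP j, A.Adj (v j) x
  part : ∀ j, VP j = W j ∪ U j ∪ Y j
  WU : ∀ j, Disjoint (W j) (U j)
  WY : ∀ j, Disjoint (W j) (Y j)
  UY : ∀ j, Disjoint (U j) (Y j)
  mWX : ∀ j, MatchingBetween A (W j) X
  mWU : ∀ j, MatchingBetween A (W j) (U j)
  mY : ∀ j, MatchingOn A (Y j)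
  edges : ∀ x ∈ S, ∀ y ∈ S, A.Adj x y → (x ∈ X ∧ y ∈ X) ∨
    (x ∈ ({v 0, v 1, v 2} : Set α) ∧ y ∈ ({v 0, v 1, v 2} : Set α)) ∨
    ∃ j : Fin 3,
           (x = v j ∧ y ∈ VP j) ∨ (y = v j ∧ x ∈ VP j) ∨
           (x ∈ W j ∧ y ∈ X) ∨ (y ∈ W j ∧ x ∈ X) ∨
           (x ∈ W j ∧ y ∈ U j) ∨ (y ∈ W j ∧ x ∈ U j) ∨
           (x ∈ Y j ∧ y ∈ Y j)

def FStep {α : Type*} (A : SimpleGraph α) (S X : Set α) : Prop :=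
  ∃ v VP W U Y, FStepD A S X v VP W U Y

def Good {α : Type*} (A : SimpleGraph α) (S : Set α) : Prop :=
  (∀ a ∈ S, ∀ b ∈ S, ∀ c ∈ S, ∀ d ∈ S, a ≠ c → b ≠ d → A.Adj a b → A.Adj b c → A.Adj c d →
    A.Adj d a → False) ∧
  (∀ x ∈ S, ∀ y ∈ S, x ≠ y → ¬ A.Adj x y → ∃ a ∈ S, ∃ b ∈ S, A.Adj x a ∧ A.Adj a b ∧ A.Adj b y)

lemma Good_empty {α : Type*} (A : SimpleGraph α) : Good A ∅ := by
  constructor <;> simp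

namespace FStepD
variable {α : Type*} {A : SimpleGraph α} {S X : Set α} {v : Fin 3 → α} {VP W U Y : Fin 3 → Set α}

lemma memR {x : α} (h : x ∈ ({v 0, v 1, v 2} : Set α)) : ∃ j, x = v j := by
  simp only [Set.mem_insert_iff, Set.mem_singleton_iff] at h
  rcases h with h | h | h
  exacts [⟨0, h⟩, ⟨1, h⟩, ⟨2, h⟩]

lemma Rmem (v : Fin 3 → α) (j : Fin 3) : v j ∈ ({v 0, v 1, v 2} : Set α) := by
  fin_cases j <;> simp

lemma cases (h : FStepD A S X v VP W U Y) {x : α} (hx : x ∈ S) :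
    x ∈ X ∨ (∃ j, x = v j) ∨ ∃ j, x ∈ VP j := by
  rw [h.cover] at hx
  simp only [Set.mem_union] at hx
  rcases hx with (((hx | hx) | hx) | hx) | hx
  · exact Or.inl hx
  · exact Or.inr (Or.inl (memR hx))
  exacts [Or.inr (Or.inr ⟨0, hx⟩), Or.inr (Or.inr ⟨1, hx⟩), Or.inr (Or.inr ⟨2, hx⟩)]

lemma XS (h : FStepD A S X v VP W U Y) : X ⊆ S := by
  rw [h.cover]; intro x hx; simp [hx]

lemma vS (h : FStepD A S X v VP W U Y) (j : Fin 3) : v j ∈ S := by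
  rw [h.cover]; left; left; left; right; exact Rmem v j

lemma VPS (h : FStepD A S X v VP W U Y) (j : Fin 3) : VP j ⊆ S := by
  rw [h.cover]; intro x hx
  fin_cases j <;> simp_all

lemma WVP (h : FStepD A S X v VP W U Y) (j : Fin 3) : W j ⊆ VP j := by
  rw [h.part j]; intro x hx; simp [hx]
lemma UVP (h : FStepD A S X v VP W U Y) (j : Fin 3) : U j ⊆ VP j := by
  rw [h.part j]; intro x hx; simp [hx]
lemma YVP (h : FStepD A S X v VP W U Y) (j : Fin 3) : Y j ⊆ VP j := by
  rw [h.part j]; intro x hx; simp [hx]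

lemma vinj (h : FStepD A S X v VP W U Y) {j k : Fin 3} (hv : v j = v k) : j = k := by
  by_contra hjk
  exact (h.tri j k hjk).ne hv

lemma VPuniq (h : FStepD A S X v VP W U Y) {j k : Fin 3} {x : α} (hj : x ∈ VP j) (hk : x ∈ VP k) :
    j = k := by
  by_contra hjk
  exact Set.disjoint_left.1 (h.VPVP j k hjk) hj hk

lemma XnVP (h : FStepD A S X v VP W U Y) {j : Fin 3} {x : α} (hj : x ∈ VP j) : x ∉ X :=
  fun hx => Set.disjoint_left.1 (h.XVP j) hx hj

/-- edges at a vertex of X -/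
lemma eX (h : FStepD A S X v VP W U Y) {x y : α} (hx : x ∈ X) (hy : y ∈ S) (hxy : A.Adj x y) :
    y ∈ X ∨ ∃ j, y ∈ W j := by
  rcases h.edges x (h.XS hx) y hy hxy with h1 | h1 | ⟨j, h1⟩
  · exact Or.inl h1.2
  · obtain ⟨j, rfl⟩ := memR h1.1; exact absurd hx (h.vX j)
  · rcases h1 with h1 | h1 | h1 | h1 | h1 | h1 | h1
    · exact absurd (h1.1 ▸ hx) (h.vX j)
    · exact absurd hx (h.XnVP h1.2)
    · exact absurd hx (h.XnVP (h.WVP j h1.1))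
    · exact Or.inr ⟨j, h1.1⟩
    · exact absurd hx (h.XnVP (h.WVP j h1.1))
    · exact absurd hx (h.XnVP (h.UVP j h1.2))
    · exact absurd hx (h.XnVP (h.YVP j h1.1))

/-- edges at a triangle vertex -/
lemma eV (h : FStepD A S X v VP W U Y) {j : Fin 3} {y : α} (hy : y ∈ S) (hxy : A.Adj (v j) y) :
    (∃ k, k ≠ j ∧ y = v k) ∨ y ∈ VP j := by
  rcases h.edges _ (h.vS j) y hy hxy with h1 | h1 | ⟨k, h1⟩
  · exact absurd h1.1 (h.vX j)
  · obtain ⟨k, rfl⟩ := memR h1.2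
    exact Or.inl ⟨k, by rintro rfl; exact hxy.ne rfl, rfl⟩
  · rcases h1 with h1 | h1 | h1 | h1 | h1 | h1 | h1
    · rw [h.vinj h1.1]; exact Or.inr h1.2
    · exact absurd h1.2 (h.vVP j k)
    · exact absurd (h.WVP k h1.1) (h.vVP j k)
    · exact absurd h1.2 (h.vX j)
    · exact absurd (h.WVP k h1.1) (h.vVP j k)
    · exact absurd (h.UVP k h1.2) (h.vVP j k)
    · exact absurd (h.YVP k h1.1) (h.vVP j k)

/-- edges at a petal vertex -/
lemma eP (h : FStepD A S X v VP W U Y) {j : Fin 3} {x y : α} (hx : x ∈ VP j) (hy : y ∈ S)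
    (hxy : A.Adj x y) :
    y = v j ∨ (x ∈ W j ∧ y ∈ X) ∨ (x ∈ W j ∧ y ∈ U j) ∨ (x ∈ U j ∧ y ∈ W j) ∨ (x ∈ Y j ∧ y ∈ Y j) := by
  rcases h.edges x (h.VPS j hx) y hy hxy with h1 | h1 | ⟨k, h1⟩
  · exact absurd h1.1 (h.XnVP hx)
  · obtain ⟨k, rfl⟩ := memR h1.1; exact absurd hx (h.vVP k j)
  · rcases h1 with h1 | h1 | h1 | h1 | h1 | h1 | h1
    · exact absurd (h1.1 ▸ hx) (h.vVP k j)
    · rw [h.VPuniq hx h1.2]; exact Or.inl h1.1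
    · rw [h.VPuniq hx (h.WVP k h1.1)]; exact Or.inr (Or.inl h1)
    · exact absurd h1.2 (h.XnVP hx)
    · rw [h.VPuniq hx (h.WVP k h1.1)]; exact Or.inr (Or.inr (Or.inl h1))
    · rw [h.VPuniq hx (h.UVP k h1.2)]; exact Or.inr (Or.inr (Or.inr (Or.inl h1.symm)))
    · rw [h.VPuniq hx (h.YVP k h1.1)]; exact Or.inr (Or.inr (Or.inr (Or.inr h1)))

lemma F2d (h : FStepD A S X v VP W U Y) {j k : Fin 3} {x : α} (hx : x ∈ VP j) (hxy : A.Adj x (v k)) :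
    k = j := by
  rcases h.eV (h.VPS j hx) hxy.symm with ⟨m, _, rfl⟩ | h1
  · exact absurd hx (h.vVP m j)
  · exact h.VPuniq h1 hx

lemma F2c (h : FStepD A S X v VP W U Y) {j k : Fin 3} {x y : α} (hx : x ∈ VP j) (hy : y ∈ VP k)
    (hxy : A.Adj x y) : j = k := by
  rcases h.eP hx (h.VPS k hy) hxy with rfl | h1 | h1 | h1 | h1
  · exact absurd hy (h.vVP j k)
  · exact absurd h1.2 (h.XnVP hy)
  · exact h.VPuniq (h.UVP j h1.2) hy
  · exact h.VPuniq (h.WVP j h1.2) hy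
  · exact h.VPuniq (h.YVP j h1.2) hy

lemma F2a (h : FStepD A S X v VP W U Y) {j : Fin 3} {x y z : α} (hx : x ∈ VP j) (hy : y ∈ VP j)
    (hz : z ∈ VP j) (hxy : A.Adj x y) (hxz : A.Adj x z) : y = z := by
  have key : ∀ y ∈ VP j, A.Adj x y → (x ∈ W j ∧ y ∈ U j) ∨ (x ∈ U j ∧ y ∈ W j) ∨ (x ∈ Y j ∧ y ∈ Y j) := by
    intro y hy hxy
    rcases h.eP hx (h.VPS j hy) hxy with rfl | h1 | h1
    · exact absurd hy (h.vVP j j)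
    · exact absurd h1.2 (h.XnVP hy)
    · exact h1
  have h1 := key y hy hxy
  have h2 := key z hz hxz
  have d1 : x ∈ W j → x ∉ U j := fun e => Set.disjoint_left.1 (h.WU j) e
  have d2 : x ∈ W j → x ∉ Y j := fun e => Set.disjoint_left.1 (h.WY j) e
  have d3 : x ∈ U j → x ∉ Y j := fun e => Set.disjoint_left.1 (h.UY j) e
  rcases h1 with h1 | h1 | h1 <;> rcases h2 with h2 | h2 | h2 <;> try tauto
  · exact ((h.mWU j).1 x h1.1).unique ⟨h1.2, hxy⟩ ⟨h2.2, hxz⟩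
  · exact ((h.mWU j).2 x h1.1).unique ⟨h1.2, hxy.symm⟩ ⟨h2.2, hxz.symm⟩
  · exact (h.mY j x h1.1).unique ⟨h1.2, hxy⟩ ⟨h2.2, hxz⟩

lemma PXW (h : FStepD A S X v VP W U Y) {j : Fin 3} {x y : α} (hx : x ∈ VP j) (hy : y ∈ X)
    (hxy : A.Adj x y) : x ∈ W j := by
  rcases h.eP hx (h.XS hy) hxy with rfl | h1 | h1 | h1 | h1
  · exact absurd hy (h.vX j)
  · exact h1.1
  · exact h1.1
  · exact absurd hy (h.XnVP (h.WVP j h1.2))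
  · exact absurd hy (h.XnVP (h.YVP j h1.2))

lemma F2b (h : FStepD A S X v VP W U Y) {j : Fin 3} {x y z : α} (hx : x ∈ VP j) (hy : y ∈ X)
    (hz : z ∈ X) (hxy : A.Adj x y) (hxz : A.Adj x z) : y = z :=
  ((h.mWX j).1 x (h.PXW hx hy hxy)).unique ⟨hy, hxy⟩ ⟨hz, hxz⟩

lemma F4 (h : FStepD A S X v VP W U Y) {j : Fin 3} {x y z : α} (hx : x ∈ X) (hy : y ∈ VP j)
    (hz : z ∈ VP j) (hxy : A.Adj x y) (hxz : A.Adj x z) : y = z :=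
  ((h.mWX j).2 x hx).unique ⟨h.PXW hy hx hxy.symm, hxy.symm⟩ ⟨h.PXW hz hx hxz.symm, hxz.symm⟩

lemma F5 (h : FStepD A S X v VP W U Y) {j : Fin 3} {w y x x' : α} (hw : w ∈ VP j) (hy : y ∈ VP j)
    (hwy : A.Adj w y) (hx : x ∈ X) (hx' : x' ∈ X) (hwx : A.Adj w x) (hyx : A.Adj y x') : False := by
  have h1 := h.PXW hw hx hwx
  have h2 := h.PXW hy hx' hyx
  rcases h.eP hw (h.VPS j hy) hwy with rfl | h3 | h3 | h3 | h3
  · exact h.vVP j j hy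
  · exact h.XnVP hy h3.2
  · exact Set.disjoint_left.1 (h.WU j) h2 h3.2
  · exact Set.disjoint_left.1 (h.WU j) h1 h3.1
  · exact Set.disjoint_left.1 (h.WY j) h1 h3.1

lemma c4R (h : FStepD A S X v VP W U Y) {j : Fin 3} {b c d : α} (hb : b ∈ S) (hc : c ∈ S) (hd : d ∈ S)
    (hac : v j ≠ c) (hbd : b ≠ d) (h1 : A.Adj (v j) b) (h2 : A.Adj b c) (h3 : A.Adj c d)
    (h4 : A.Adj d (v j)) : False := by
  have mixed : ∀ k, k ≠ j → ∀ d ∈ VP j, ∀ c ∈ S, v j ≠ c → A.Adj (v k) c → A.Adj c d → False := by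
    intro k hk d hd c hc hac h2 h3
    rcases h.eV hc h2 with ⟨m, hm, rfl⟩ | hc'
    · have := h.F2d hd h3.symm
      exact hac (by rw [this])
    · exact hk (h.F2c hc' hd h3)
  rcases h.eV hb h1 with ⟨k, hk, rfl⟩ | hb' <;> rcases h.eV hd h4.symm with ⟨l, hl, rfl⟩ | hd'
  · rcases h.eV hc h2 with ⟨m, hm, rfl⟩ | hc'
    · have h5 : m ≠ j := by rintro rfl; exact hac rfl
      have h6 : m ≠ l := by rintro rfl; exact h3.ne rfl
      have h7 : k ≠ l := by rintro rfl; exact hbd rfl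
      omega
    · have := h.F2d hc' h3
      exact hbd (by rw [this])
  · exact mixed k hk d hd' c hc hac h2 h3
  · exact mixed l hl b hb' c hc hac h3.symm h2.symm
  · rcases h.cases hc with hc' | ⟨m, rfl⟩ | ⟨m, hc'⟩
    · exact hbd (h.F4 hc' hb' hd' h2.symm h3)
    · exact hac (by rw [h.F2d hb' h2])
    · have := h.F2c hb' hc' h2
      subst this
      exact hbd (h.F2a hc' hb' hd' h2.symm h3)

lemma c4P (h : FStepD A S X v VP W U Y) {j : Fin 3} {a b c d : α} (ha : a ∈ VP j)
    (hb : b ∈ S) (hc : c ∈ S) (hd : d ∈ S)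
    (hbR : ∀ k, b ≠ v k) (hcR : ∀ k, c ≠ v k) (hdR : ∀ k, d ≠ v k)
    (hac : a ≠ c) (hbd : b ≠ d) (h1 : A.Adj a b) (h2 : A.Adj b c) (h3 : A.Adj c d)
    (h4 : A.Adj d a) : False := by
  have nb : ∀ a ∈ VP j, ∀ b ∈ S, (∀ k, b ≠ v k) → A.Adj a b → b ∈ VP j ∨ b ∈ X := by
    intro a ha b hb hbR hab
    rcases h.cases hb with h1 | ⟨k, rfl⟩ | ⟨k, h1⟩
    · exact Or.inr h1
    · exact absurd rfl (hbR k)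
    · rw [h.F2c ha h1 hab]; exact Or.inl h1
  have mixed : ∀ b c d, c ∈ S → (∀ k, c ≠ v k) → a ≠ c → A.Adj a b → A.Adj b c → A.Adj d a →
      b ∈ VP j → d ∈ X → False := by
    intro b c d hc hcR hac h1 h2 h4 hb hd
    rcases nb b hb c hc hcR h2 with hc' | hc'
    · exact hac (h.F2a hb ha hc' h1.symm h2)
    · exact h.F5 ha hb h1 hd hc' h4.symm h2
  rcases nb a ha b hb hbR h1 with hb' | hb' <;> rcases nb a ha d hd hdR h4.symm with hd' | hd'
  · exact hbd (h.F2a ha hb' hd' h1 h4.symm)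
  · exact mixed b c d hc hcR hac h1 h2 h4 hb' hd'
  · exact mixed d c b hc hcR hac h4.symm h3.symm h1.symm hd' hb'
  · exact hbd (h.F2b ha hb' hd' h1 h4.symm)

lemma partner (h : FStepD A S X v VP W U Y) {j : Fin 3} {x : α} (hx : x ∈ VP j) :
    ∃ y ∈ VP j, A.Adj x y := by
  rw [h.part j] at hx
  rcases hx with (hx | hx) | hx
  · obtain ⟨y, hy, _⟩ := (h.mWU j).1 x hx
    exact ⟨y, h.UVP j hy.1, hy.2⟩
  · obtain ⟨y, hy, _⟩ := (h.mWU j).2 x hx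
    exact ⟨y, h.WVP j hy.1, hy.2.symm⟩
  · obtain ⟨y, hy, _⟩ := h.mY j x hx
    exact ⟨y, h.YVP j hy.1, hy.2⟩

lemma good (h : FStepD A S X v VP W U Y) (hX : Good A X) : Good A S := by
  constructor
  · intro a ha b hb c hc d hd hac hbd h1 h2 h3 h4
    by_cases hR : ∃ k, a = v k ∨ b = v k ∨ c = v k ∨ d = v k
    · obtain ⟨k, rfl | rfl | rfl | rfl⟩ := hR
      · exact h.c4R hb hc hd hac hbd h1 h2 h3 h4
      · exact h.c4R hc hd ha hbd hac.symm h2 h3 h4 h1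
      · exact h.c4R hd ha hb hac.symm hbd.symm h3 h4 h1 h2
      · exact h.c4R ha hb hc hbd.symm hac h4 h1 h2 h3
    · push Not at hR
      have a0 := fun k => (hR k).1
      have b0 := fun k => (hR k).2.1
      have c0 := fun k => (hR k).2.2.1
      have d0 := fun k => (hR k).2.2.2
      rcases h.cases ha with a1 | ⟨k, hk⟩ | ⟨k, a1⟩
      · rcases h.cases hb with b1 | ⟨k, hk⟩ | ⟨k, b1⟩
        · rcases h.cases hc with c1 | ⟨k, hk⟩ | ⟨k, c1⟩
          · rcases h.cases hd with d1 | ⟨k, hk⟩ | ⟨k, d1⟩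
            · exact hX.1 a a1 b b1 c c1 d d1 hac hbd h1 h2 h3 h4
            · exact d0 k hk
            · exact h.c4P d1 ha hb hc a0 b0 c0 hbd.symm hac h4 h1 h2 h3
          · exact c0 k hk
          · exact h.c4P c1 hd ha hb d0 a0 b0 hac.symm hbd.symm h3 h4 h1 h2
        · exact b0 k hk
        · exact h.c4P b1 hc hd ha c0 d0 a0 hbd hac.symm h2 h3 h4 h1
      · exact a0 k hk
      · exact h.c4P a1 hb hc hd b0 c0 d0 hac hbd h1 h2 h3 h4
  · have toW : ∀ x ∈ X, ∀ j, ∃ w ∈ VP j, A.Adj x w := by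
      intro x hx j
      obtain ⟨w, hw, _⟩ := (h.mWX j).2 x hx
      exact ⟨w, h.WVP j hw.1, hw.2.symm⟩
    have symmP : ∀ x y, (∃ a ∈ S, ∃ b ∈ S, A.Adj x a ∧ A.Adj a b ∧ A.Adj b y) →
        ∃ a ∈ S, ∃ b ∈ S, A.Adj y a ∧ A.Adj a b ∧ A.Adj b x := by
      rintro x y ⟨a, ha, b, hb, h1, h2, h3⟩
      exact ⟨b, hb, a, ha, h3.symm, h2.symm, h1.symm⟩
    have xv : ∀ x ∈ X, ∀ j, ∃ a ∈ S, ∃ b ∈ S, A.Adj x a ∧ A.Adj a b ∧ A.Adj b (v j) := by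
      intro x hx j
      obtain ⟨k, hk⟩ : ∃ k : Fin 3, k ≠ j := exists_ne j
      obtain ⟨w, hw, hxw⟩ := toW x hx k
      exact ⟨w, h.VPS k hw, v k, h.vS k, hxw, (h.vadj k w hw).symm, h.tri k j hk⟩
    have xp : ∀ x ∈ X, ∀ j, ∀ y ∈ VP j, ∃ a ∈ S, ∃ b ∈ S, A.Adj x a ∧ A.Adj a b ∧ A.Adj b y := by
      intro x hx j y hy
      obtain ⟨w, hw, hxw⟩ := toW x hx j
      exact ⟨w, h.VPS j hw, v j, h.vS j, hxw, (h.vadj j w hw).symm, h.vadj j y hy⟩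
    have vp : ∀ k, ∀ j, k ≠ j → ∀ y ∈ VP j, ∃ a ∈ S, ∃ b ∈ S, A.Adj (v k) a ∧ A.Adj a b ∧ A.Adj b y := by
      intro k j hkj y hy
      obtain ⟨l, hl1, hl2⟩ : ∃ l : Fin 3, l ≠ k ∧ l ≠ j := by
        clear hy; revert k j; decide
      exact ⟨v l, h.vS l, v j, h.vS j, h.tri k l hl1.symm, h.tri l j hl2, h.vadj j y hy⟩
    intro x hx y hy hne hnadj
    rcases h.cases hx with hx | ⟨j, rfl⟩ | ⟨j, hx⟩ <;> rcases h.cases hy with hy | ⟨k, rfl⟩ | ⟨k, hy⟩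
    · obtain ⟨a, ha, b, hb, h1⟩ := hX.2 x hx y hy hne hnadj
      exact ⟨a, h.XS ha, b, h.XS hb, h1⟩
    · exact xv x hx k
    · exact xp x hx k y hy
    · exact symmP _ _ (xv y hy j)
    · exact absurd (h.tri j k (by rintro rfl; exact hne rfl)) hnadj
    · refine vp j k ?_ y hy
      rintro rfl
      exact hnadj (h.vadj j y hy)
    · exact symmP _ _ (xp y hy j x hx)
    · refine symmP _ _ (vp k j ?_ x hx)
      rintro rfl
      exact hnadj (h.vadj k x hx).symm
    · by_cases hjk : j = k
      · subst hjk
        obtain ⟨z, hz, hxz⟩ := h.partner hx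
        exact ⟨z, h.VPS j hz, v j, h.vS j, hxz, (h.vadj j z hz).symm, h.vadj j y hy⟩
      · exact ⟨v j, h.vS j, v k, h.vS k, (h.vadj j x hx).symm, h.tri j k hjk, h.vadj k y hy⟩

end FStepD

lemma Good.maxC4 {α : Type*} {A : SimpleGraph α} {S : Set α} (h : Good A S) : MaxC4FreeOn A S := by
  constructor
  · rintro ⟨f, hf, hadj⟩
    have e : ∀ i : ZMod 4, A.Adj (f i) (f (i + 1)) := by
      intro i
      have : (cycGraph 4).Adj i (i + 1) := by
        simp only [cycGraph, SimpleGraph.fromRel_adj]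
        revert i; decide
      exact hadj this
    refine h.1 (f 0) (f 0).2 (f 1) (f 1).2 (f 2) (f 2).2 (f 3) (f 3).2 ?_ ?_ (e 0) (e 1) (e 2) (e 3)
    · intro hh; exact absurd (hf (Subtype.ext hh)) (by decide)
    · intro hh; exact absurd (hf (Subtype.ext hh)) (by decide)
  · rintro ⟨x, hx⟩ ⟨y, hy⟩ hne hnadj
    have hne' : x ≠ y := fun hh => hne (Subtype.ext hh)
    have hn' : ¬ A.Adj x y := hnadj
    obtain ⟨a, ha, b, hb, h1, h2, h3⟩ := h.2 x hx y hy hne' hn'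
    have hxb : x ≠ b := by rintro rfl; exact hn' h3
    have hay : a ≠ y := by rintro rfl; exact hn' h1
    have e1 := h1.ne
    have e2 := h2.ne
    have e3 := h3.ne
    let f : Fin 4 → S := ![⟨x, hx⟩, ⟨a, ha⟩, ⟨b, hb⟩, ⟨y, hy⟩]
    refine ⟨f, ?_, ?_⟩
    · intro i j hij
      have : ∀ i j : Fin 4, f i = f j → i = j := by
        intro i j
        fin_cases i <;> fin_cases j <;> simp [f, hne', hxb, hay, e1, e2, e3, hne'.symm, hxb.symm, hay.symm, e1.symm, e2.symm, e3.symm]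
      exact this i j hij
    · have adj : ∀ i : Fin 4, (A.induce S ⊔ SimpleGraph.fromEdgeSet {s((⟨x, hx⟩ : S), ⟨y, hy⟩)}).Adj (f i) (f (i+1)) := by
        intro i
        rw [SimpleGraph.sup_adj, SimpleGraph.fromEdgeSet_adj]
        fin_cases i
        · left; exact h1
        · left; exact h2
        · left; exact h3
        · right
          refine ⟨?_, ?_⟩
          · exact Sym2.eq_swap
          · exact hne.symm
      intro i j hij
      simp only [cycGraph, SimpleGraph.fromRel_adj] at hij
      have hij' : (j : Fin 4) = (i : Fin 4) + 1 ∨ (i : Fin 4) = (j : Fin 4) + 1 := by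
        obtain ⟨_, h | h⟩ := hij
        · right; exact h
        · left; exact h
      rcases hij' with h | h
      · rw [h]; exact adj i
      · rw [h]; exact (adj j).symm

lemma isRFlower_of {n : ℕ} [Nonempty (Fin n)] (A : SimpleGraph (Fin n)) (r : ℕ) (V : ℕ → Set (Fin n))
    (h1 : V 1 = Set.univ) (hs : ∀ i, 1 ≤ i → i ≤ r → FStep A (V i) (V (i + 1)))
    (hc : MaxC4FreeOn A (V (r + 1))) : IsRFlower A r V := by
  have hs' : ∀ i, ∃ v VP W U Y, 1 ≤ i → i ≤ r → FStepD A (V i) (V (i + 1)) v VP W U Y := by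
    intro i
    by_cases hi : 1 ≤ i ∧ i ≤ r
    · obtain ⟨v, VP, W, U, Y, h⟩ := hs i hi.1 hi.2
      exact ⟨v, VP, W, U, Y, fun _ _ => h⟩
    · exact ⟨fun _ => Classical.arbitrary _, fun _ => ∅, fun _ => ∅, fun _ => ∅, fun _ => ∅,
        fun a b => absurd ⟨a, b⟩ hi⟩
  choose v VP W U Y h using hs'
  refine ⟨v, fun i => {v i 0, v i 1, v i 2}, VP, W, U, Y, h1, ?_, ?_, ?_, ?_, hc, ?_⟩
  · intro i hi hir
    have H := h i hi hir
    refine ⟨H.cover, ?_⟩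
    have a1 : Disjoint (V (i+1)) ({v i 0, v i 1, v i 2} : Set (Fin n)) := by
      rw [Set.disjoint_left]
      intro x hx hx'
      obtain ⟨j, rfl⟩ := FStepD.memR hx'
      exact H.vX j hx
    have a2 : ∀ j, Disjoint ({v i 0, v i 1, v i 2} : Set (Fin n)) (VP i j) := by
      intro j
      rw [Set.disjoint_left]
      intro x hx hx'
      obtain ⟨k, rfl⟩ := FStepD.memR hx
      exact H.vVP k j hx'
    have a3 := H.XVP
    have b1 := H.VPVP 0 1 (by decide)
    have b2 := H.VPVP 0 2 (by decide)
    have b3 := H.VPVP 1 2 (by decide)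
    intro j _ k _ hjk
    fin_cases j <;> fin_cases k <;> first
      | exact absurd rfl hjk
      | exact a1
      | exact a1.symm
      | exact a2 _
      | exact (a2 _).symm
      | exact a3 _
      | exact (a3 _).symm
      | exact b1
      | exact b2
      | exact b3
      | exact b1.symm
      | exact b2.symm
      | exact b3.symm
  · intro i hi hir
    exact ⟨rfl, (h i hi hir).tri⟩
  · intro i hi hir j
    have H := h i hi hir
    ext x
    constructor
    · intro hx
      refine ⟨⟨H.VPS j hx, H.vadj j x hx⟩, fun hx' => ?_⟩
      obtain ⟨k, rfl⟩ := FStepD.memR hx'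
      exact H.vVP k j hx
    · rintro ⟨⟨hx, hadj⟩, hR⟩
      rcases H.eV hx hadj with ⟨k, _, rfl⟩ | h'
      · exact absurd (FStepD.Rmem _ k) hR
      · exact h'
  · intro i hi hir j
    have H := h i hi hir
    exact ⟨H.part j, H.WU j, H.WY j, H.UY j, H.mWX j, H.mWU j, H.mY j⟩
  · have key : ∀ m i, i + m = r + 1 → 1 ≤ i → ∀ x ∈ V i, ∀ y ∈ V i, A.Adj x y →
      (x ∈ V (r + 1) ∧ y ∈ V (r + 1)) ∨
      ∃ i, 1 ≤ i ∧ i ≤ r ∧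
        ((x ∈ ({v i 0, v i 1, v i 2} : Set (Fin n)) ∧ y ∈ ({v i 0, v i 1, v i 2} : Set (Fin n))) ∨
         ∃ j : Fin 3,
           (x = v i j ∧ y ∈ VP i j) ∨ (y = v i j ∧ x ∈ VP i j) ∨
           (x ∈ W i j ∧ y ∈ V (i + 1)) ∨ (y ∈ W i j ∧ x ∈ V (i + 1)) ∨
           (x ∈ W i j ∧ y ∈ U i j) ∨ (y ∈ W i j ∧ x ∈ U i j) ∨
           (x ∈ Y i j ∧ y ∈ Y i j)) := by
      intro m
      induction m with
      | zero =>
        intro i hi _ x hx y hy _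
        have : i = r + 1 := by omega
        subst this
        exact Or.inl ⟨hx, hy⟩
      | succ m ih =>
        intro i hi hi1 x hx y hy hxy
        rcases (h i hi1 (by omega)).edges x hx y hy hxy with h' | h' | h'
        · exact ih (i + 1) (by omega) (by omega) x h'.1 y h'.2 hxy
        · exact Or.inr ⟨i, hi1, by omega, Or.inl h'⟩
        · exact Or.inr ⟨i, hi1, by omega, Or.inr h'⟩
    intro x y hxy
    exact key r 1 (by omega) le_rfl x (h1 ▸ Set.mem_univ x) y (h1 ▸ Set.mem_univ y) hxy

lemma good_chain {α : Type*} (A : SimpleGraph α) (K : ℕ) (V : ℕ → Set α) (hK : V (K + 1) = ∅)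
    (i0 : ℕ) (hs : ∀ i, i0 ≤ i → i ≤ K → FStep A (V i) (V (i + 1))) :
    ∀ m i, i + m = K + 1 → i0 ≤ i → Good A (V i) := by
  intro m
  induction m with
  | zero =>
    intro i hi _
    have : i = K + 1 := by omega
    subst this; rw [hK]; exact Good_empty A
  | succ m ih =>
    intro i hi hi0
    obtain ⟨v, VP, W, U, Y, h⟩ := hs i hi0 (by omega)
    exact h.good (ih (i + 1) (by omega) (by omega))

lemma MatchingBetween.congr {α : Type*} {A B : SimpleGraph α} {S T : Set α}
    (h : MatchingBetween A S T) (hAB : ∀ x ∈ S, ∀ y ∈ T, (A.Adj x y ↔ B.Adj x y)) :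
    MatchingBetween B S T := by
  constructor
  · intro x hx
    obtain ⟨y, hy, hu⟩ := h.1 x hx
    exact ⟨y, ⟨hy.1, (hAB x hx y hy.1).1 hy.2⟩, fun z hz => hu z ⟨hz.1, (hAB x hx z hz.1).2 hz.2⟩⟩
  · intro x hx
    obtain ⟨y, hy, hu⟩ := h.2 x hx
    exact ⟨y, ⟨hy.1, (hAB y hy.1 x hx).1 hy.2⟩, fun z hz => hu z ⟨hz.1, (hAB z hz.1 x hx).2 hz.2⟩⟩

lemma MatchingOn.congr {α : Type*} {A B : SimpleGraph α} {S : Set α}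
    (h : MatchingOn A S) (hAB : ∀ x ∈ S, ∀ y ∈ S, (A.Adj x y ↔ B.Adj x y)) :
    MatchingOn B S := by
  intro x hx
  obtain ⟨y, hy, hu⟩ := h x hx
  exact ⟨y, ⟨hy.1, (hAB x hx y hy.1).1 hy.2⟩, fun z hz => hu z ⟨hz.1, (hAB x hx z hz.1).2 hz.2⟩⟩

lemma FStep.congr {α : Type*} {A B : SimpleGraph α} {S X : Set α} (h : FStep A S X)
    (hAB : ∀ x ∈ S, ∀ y ∈ S, (A.Adj x y ↔ B.Adj x y)) : FStep B S X := by
  obtain ⟨v, VP, W, U, Y, h⟩ := h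
  refine ⟨v, VP, W, U, Y, ?_⟩
  refine { cover := h.cover, vX := h.vX, vVP := h.vVP, XVP := h.XVP, VPVP := h.VPVP, part := h.part,
           WU := h.WU, WY := h.WY, UY := h.UY, tri := ?_, vadj := ?_, mWX := ?_, mWU := ?_, mY := ?_, edges := ?_ }
  · intro j k hjk; exact (hAB _ (h.vS j) _ (h.vS k)).1 (h.tri j k hjk)
  · intro j x hx; exact (hAB _ (h.vS j) _ (h.VPS j hx)).1 (h.vadj j x hx)
  · intro j; exact (h.mWX j).congr fun x hx y hy => hAB x (h.VPS j (h.WVP j hx)) y (h.XS hy)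
  · intro j; exact (h.mWU j).congr fun x hx y hy => hAB x (h.VPS j (h.WVP j hx)) y (h.VPS j (h.UVP j hy))
  · intro j; exact (h.mY j).congr fun x hx y hy => hAB x (h.VPS j (h.YVP j hx)) y (h.VPS j (h.YVP j hy))
  · intro x hx y hy hxy
    exact h.edges x hx y hy ((hAB x hx y hy).2 hxy)

/-- a petal -/
structure PetalD {α : Type*} (G : SimpleGraph α) (X P : Set α) (v : α) (B : SimpleGraph α)
    (W U Y : Set α) : Prop where
  le : B ≤ G
  part : P = W ∪ U ∪ Y
  WU : Disjoint W U
  WY : Disjoint W Y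
  UY : Disjoint U Y
  vadj : ∀ x ∈ P, G.Adj v x
  mWX : MatchingBetween B W X
  mWU : MatchingBetween B W U
  mY : MatchingOn B Y
  edges : ∀ x y, B.Adj x y → (x ∈ W ∧ y ∈ X) ∨ (y ∈ W ∧ x ∈ X) ∨
           (x ∈ W ∧ y ∈ U) ∨ (y ∈ W ∧ x ∈ U) ∨ (x ∈ Y ∧ y ∈ Y)

def Petal {α : Type*} (G : SimpleGraph α) (X P : Set α) (v : α) : Prop :=
  ∃ B W U Y, PetalD G X P v B W U Y

/-- Assemble a layer from three petals. -/
lemma assemble {α : Type*} (G A : SimpleGraph α) (hA : A ≤ G) (S X : Set α) (v : Fin 3 → α) (P : Fin 3 → Set α)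
    (hS : S = X ∪ {v 0, v 1, v 2} ∪ P 0 ∪ P 1 ∪ P 2)
    (tri : ∀ j k, j ≠ k → G.Adj (v j) (v k)) (vX : ∀ j, v j ∉ X) (vP : ∀ j k, v j ∉ P k)
    (XP : ∀ j, Disjoint X (P j)) (PP : ∀ j k, j ≠ k → Disjoint (P j) (P k))
    (hP : ∀ j, Petal G X (P j) (v j)) :
    ∃ A' : SimpleGraph α, A' ≤ G ∧ (∀ x ∈ X, ∀ y ∈ X, (A.Adj x y ↔ A'.Adj x y)) ∧ FStep A' S X := by
  choose B W U Y h using hP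
  have WP : ∀ j, W j ⊆ P j := fun j x hx => by rw [(h j).part]; simp [hx]
  have UP : ∀ j, U j ⊆ P j := fun j x hx => by rw [(h j).part]; simp [hx]
  have YP : ∀ j, Y j ⊆ P j := fun j x hx => by rw [(h j).part]; simp [hx]
  have XP' : ∀ j x, x ∈ P j → x ∉ X := fun j x hx hX => Set.disjoint_left.1 (XP j) hX hx
  have PP' : ∀ j k x, x ∈ P j → x ∈ P k → j = k := fun j k x hx hk => by
    by_contra hjk; exact Set.disjoint_left.1 (PP j k hjk) hx hk
  let rel : α → α → Prop := fun x y => (x ∈ X ∧ y ∈ X ∧ A.Adj x y) ∨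
    ((∃ j, x = v j) ∧ (∃ j, y = v j) ∧ x ≠ y) ∨
    (∃ j, (x = v j ∧ y ∈ P j) ∨ (y = v j ∧ x ∈ P j)) ∨ ∃ j, (B j).Adj x y
  have relsymm : ∀ x y, rel x y → rel y x := by
    rintro x y (h1 | h1 | ⟨j, h1⟩ | ⟨j, h1⟩)
    · exact Or.inl ⟨h1.2.1, h1.1, h1.2.2.symm⟩
    · exact Or.inr (Or.inl ⟨h1.2.1, h1.1, h1.2.2.symm⟩)
    · exact Or.inr (Or.inr (Or.inl ⟨j, h1.symm⟩))
    · exact Or.inr (Or.inr (Or.inr ⟨j, h1.symm⟩))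
  let A' : SimpleGraph α := {
    Adj := rel
    symm := ⟨relsymm⟩
    loopless := ⟨by
      rintro x (h1 | h1 | ⟨j, h1⟩ | ⟨j, h1⟩)
      · exact h1.2.2.ne rfl
      · exact h1.2.2 rfl
      · rcases h1 with ⟨rfl, h1⟩ | ⟨rfl, h1⟩ <;> exact vP j j h1
      · exact h1.ne rfl⟩ }
  have adj' : ∀ x y, A'.Adj x y ↔ rel x y := fun x y => Iff.rfl
  -- edges of B j have an endpoint in P j, the other in P j or X
  have Bend : ∀ j x y, (B j).Adj x y → (x ∈ P j ∧ (y ∈ P j ∨ y ∈ X)) ∨ (y ∈ P j ∧ x ∈ X) := by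
    intro j x y hxy
    have h1 := (h j).edges x y hxy
    have a1 := @(WP j); have a2 := @(UP j); have a3 := @(YP j)
    rcases h1 with h1 | h1 | h1 | h1 | h1
    · exact Or.inl ⟨WP j h1.1, Or.inr h1.2⟩
    · exact Or.inr ⟨WP j h1.1, h1.2⟩
    · exact Or.inl ⟨WP j h1.1, Or.inl (UP j h1.2)⟩
    · exact Or.inl ⟨UP j h1.2, Or.inl (WP j h1.1)⟩
    · exact Or.inl ⟨YP j h1.1, Or.inl (YP j h1.2)⟩
  have toB : ∀ j x, x ∈ P j → ∀ y, (y ∈ P j ∨ y ∈ X) → ((B j).Adj x y ↔ A'.Adj x y) := by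
    intro j x hx y hy
    constructor
    · intro h1; exact Or.inr (Or.inr (Or.inr ⟨j, h1⟩))
    · rintro (h1 | h1 | ⟨k, h1⟩ | ⟨k, h1⟩)
      · exact absurd h1.1 (XP' j x hx)
      · obtain ⟨k, rfl⟩ := h1.1; exact absurd hx (vP k j)
      · rcases h1 with ⟨rfl, h1⟩ | ⟨rfl, h1⟩
        · exact absurd hx (vP k j)
        · rcases hy with hy | hy
          · exact absurd hy (vP k j)
          · exact absurd hy (vX k)
      · have : k = j := by
          rcases Bend k x y h1 with h2 | h2
          · exact PP' k j x h2.1 hx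
          · exact absurd h2.2 (XP' j x hx)
        exact this ▸ h1
  refine ⟨A', ?_, ?_, v, P, W, U, Y, ?_⟩
  · rintro x y (h1 | h1 | ⟨j, h1⟩ | ⟨j, h1⟩)
    · exact hA h1.2.2
    · obtain ⟨⟨j, rfl⟩, ⟨k, rfl⟩, hne⟩ := h1
      exact tri j k (by rintro rfl; exact hne rfl)
    · rcases h1 with ⟨rfl, h1⟩ | ⟨rfl, h1⟩
      · exact (h j).vadj _ h1
      · exact ((h j).vadj _ h1).symm
    · exact (h j).le h1
  · intro x hx y hy
    constructor
    · intro hxy; exact Or.inl ⟨hx, hy, hxy⟩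
    · rintro (h1 | h1 | ⟨j, h1⟩ | ⟨j, h1⟩)
      · exact h1.2.2
      · obtain ⟨k, rfl⟩ := h1.1; exact absurd hx (vX k)
      · rcases h1 with ⟨rfl, h1⟩ | ⟨rfl, h1⟩
        · exact absurd hx (vX j)
        · exact absurd hy (vX j)
      · rcases Bend j x y h1 with h2 | h2
        · exact absurd hx (XP' j x h2.1)
        · exact absurd hy (XP' j y h2.1)
  · refine { cover := hS, vX := vX, vVP := vP, XVP := XP, VPVP := PP, part := fun j => (h j).part,
             WU := fun j => (h j).WU, WY := fun j => (h j).WY, UY := fun j => (h j).UY,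
             tri := ?_, vadj := ?_, mWX := ?_, mWU := ?_, mY := ?_, edges := ?_ }
    · intro j k hjk
      exact Or.inr (Or.inl ⟨⟨j, rfl⟩, ⟨k, rfl⟩, (tri j k hjk).ne⟩)
    · intro j x hx
      exact Or.inr (Or.inr (Or.inl ⟨j, Or.inl ⟨rfl, hx⟩⟩))
    · intro j; exact (h j).mWX.congr fun x hx y hy => toB j x (WP j hx) y (Or.inr hy)
    · intro j; exact (h j).mWU.congr fun x hx y hy => toB j x (WP j hx) y (Or.inl (UP j hy))
    · intro j; exact (h j).mY.congr fun x hx y hy => toB j x (YP j hx) y (Or.inl (YP j hy))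
    · rintro x hx y hy (h1 | h1 | ⟨j, h1⟩ | ⟨j, h1⟩)
      · exact Or.inl ⟨h1.1, h1.2.1⟩
      · obtain ⟨⟨j, rfl⟩, ⟨k, rfl⟩, _⟩ := h1
        exact Or.inr (Or.inl ⟨FStepD.Rmem v j, FStepD.Rmem v k⟩)
      · refine Or.inr (Or.inr ⟨j, ?_⟩)
        tauto
      · refine Or.inr (Or.inr ⟨j, ?_⟩)
        have := (h j).edges x y h1
        tauto

lemma petal_of_fun {α : Type*} [DecidableEq α] (G : SimpleGraph α) (v : α) (X W U Y1 Y2 : Finset α)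
    (f g h : α → α)
    (hf : Set.InjOn f X) (hW : W = X.image f) (hfa : ∀ x ∈ X, G.Adj x (f x))
    (hg : Set.InjOn g W) (hU : U = W.image g) (hga : ∀ x ∈ W, G.Adj x (g x))
    (hh : Set.InjOn h Y1) (hY2 : Y2 = Y1.image h) (hha : ∀ x ∈ Y1, G.Adj x (h x))
    (hXW : Disjoint X W) (hXU : Disjoint X U) (hXY1 : Disjoint X Y1) (hXY2 : Disjoint X Y2)
    (hWU : Disjoint W U) (hWY1 : Disjoint W Y1) (hWY2 : Disjoint W Y2)
    (hUY1 : Disjoint U Y1) (hUY2 : Disjoint U Y2) (hY : Disjoint Y1 Y2)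
    (hv : ∀ x ∈ W ∪ U ∪ (Y1 ∪ Y2), G.Adj v x) :
    Petal G (X : Set α) ((W ∪ U ∪ (Y1 ∪ Y2) : Finset α) : Set α) v := by
  let r : α → α → Prop := fun a b => (a ∈ X ∧ b = f a) ∨ (a ∈ W ∧ b = g a) ∨ (a ∈ Y1 ∧ b = h a)
  have rG : ∀ a b, r a b → G.Adj a b := by
    rintro a b (⟨h1, rfl⟩ | ⟨h1, rfl⟩ | ⟨h1, rfl⟩)
    exacts [hfa a h1, hga a h1, hha a h1]
  have fW : ∀ x ∈ X, f x ∈ W := fun x hx => by rw [hW]; exact Finset.mem_image_of_mem f hx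
  have gU : ∀ x ∈ W, g x ∈ U := fun x hx => by rw [hU]; exact Finset.mem_image_of_mem g hx
  have hY2' : ∀ x ∈ Y1, h x ∈ Y2 := fun x hx => by rw [hY2]; exact Finset.mem_image_of_mem h hx
  have rWX : ∀ w ∈ W, ∀ x ∈ X, (r w x ∨ r x w) → w = f x := by
    intro w hw x hx hr
    rcases hr with (⟨h1, rfl⟩ | ⟨h1, rfl⟩ | ⟨h1, rfl⟩) | (⟨h1, rfl⟩ | ⟨h1, rfl⟩ | ⟨h1, rfl⟩)
    · exact absurd hw (Finset.disjoint_left.1 hXW h1)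
    · exact absurd (gU w hw) (Finset.disjoint_left.1 hXU hx)
    · exact absurd h1 (Finset.disjoint_left.1 hWY1 hw)
    · rfl
    · exact absurd h1 (Finset.disjoint_left.1 hXW hx)
    · exact absurd h1 (Finset.disjoint_left.1 hXY1 hx)
  have rWU : ∀ w ∈ W, ∀ x ∈ U, (r w x ∨ r x w) → x = g w := by
    intro w hw x hx hr
    rcases hr with (⟨h1, rfl⟩ | ⟨h1, rfl⟩ | ⟨h1, rfl⟩) | (⟨h1, rfl⟩ | ⟨h1, rfl⟩ | ⟨h1, rfl⟩)
    · exact absurd hw (Finset.disjoint_left.1 hXW h1)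
    · rfl
    · exact absurd h1 (Finset.disjoint_left.1 hWY1 hw)
    · exact absurd hx (Finset.disjoint_left.1 hXU h1)
    · exact absurd hx (Finset.disjoint_left.1 hWU h1)
    · exact absurd h1 (Finset.disjoint_left.1 hUY1 hx)
  have rYY : ∀ a ∈ Y1 ∪ Y2, ∀ b ∈ Y1 ∪ Y2, r a b → a ∈ Y1 ∧ b = h a := by
    intro a ha b hb hr
    rcases hr with h1 | h1 | h1
    · exfalso
      rcases Finset.mem_union.1 ha with h2 | h2
      exacts [Finset.disjoint_left.1 hXY1 h1.1 h2, Finset.disjoint_left.1 hXY2 h1.1 h2]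
    · exfalso
      rcases Finset.mem_union.1 ha with h2 | h2
      exacts [Finset.disjoint_left.1 hWY1 h1.1 h2, Finset.disjoint_left.1 hWY2 h1.1 h2]
    · exact h1
  let B : SimpleGraph α := {
    Adj := fun a b => r a b ∨ r b a
    symm := ⟨fun a b hab => hab.symm⟩
    loopless := ⟨by
      rintro a (h1 | h1) <;> exact (rG a a h1).ne rfl⟩ }
  refine ⟨B, W, U, ((Y1 ∪ Y2 : Finset α) : Set α), ?_⟩
  refine { le := ?_, part := ?_, WU := ?_, WY := ?_, UY := ?_, vadj := ?_, mWX := ?_, mWU := ?_, mY := ?_, edges := ?_ }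
  · rintro a b (h1 | h1)
    exacts [rG a b h1, (rG b a h1).symm]
  · push_cast; rfl
  · exact_mod_cast hWU
  · rw [Finset.disjoint_coe, Finset.disjoint_union_right]; exact ⟨hWY1, hWY2⟩
  · rw [Finset.disjoint_coe, Finset.disjoint_union_right]; exact ⟨hUY1, hUY2⟩
  · intro x hx; exact hv x hx
  · constructor
    · intro w hw
      have hw' : w ∈ X.image f := hW ▸ hw
      obtain ⟨x, hx, rfl⟩ := Finset.mem_image.1 hw'
      refine ⟨x, ⟨hx, Or.inr (Or.inl ⟨hx, rfl⟩)⟩, ?_⟩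
      rintro y ⟨hy, hadj⟩
      exact (hf hx hy (rWX _ hw y hy hadj)).symm
    · intro x hx
      refine ⟨f x, ⟨fW x hx, Or.inr (Or.inl ⟨hx, rfl⟩)⟩, ?_⟩
      rintro y ⟨hy, hadj⟩
      exact rWX y hy x hx hadj
  · constructor
    · intro w hw
      refine ⟨g w, ⟨gU w hw, Or.inl (Or.inr (Or.inl ⟨hw, rfl⟩))⟩, ?_⟩
      rintro y ⟨hy, hadj⟩
      exact rWU w hw y hy hadj
    · intro u hu
      have hu' : u ∈ W.image g := hU ▸ hu
      obtain ⟨w, hw, rfl⟩ := Finset.mem_image.1 hu'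
      refine ⟨w, ⟨hw, Or.inl (Or.inr (Or.inl ⟨hw, rfl⟩))⟩, ?_⟩
      rintro y ⟨hy, hadj⟩
      exact (hg hw hy (rWU y hy _ hu hadj)).symm
  · intro y hy
    have hy' : y ∈ Y1 ∪ Y2 := hy
    rcases Finset.mem_union.1 hy' with h1 | h1
    · refine ⟨h y, ⟨Finset.mem_coe.2 (Finset.mem_union_right _ (hY2' y h1)), Or.inl (Or.inr (Or.inr ⟨h1, rfl⟩))⟩, ?_⟩
      rintro z ⟨hz, hadj | hadj⟩
      · exact (rYY y hy z hz hadj).2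
      · have := rYY z hz y hy hadj
        exfalso
        rw [this.2] at h1
        exact Finset.disjoint_left.1 hY h1 (hY2' z this.1)
    · obtain ⟨x, hx, rfl⟩ := Finset.mem_image.1 (hY2 ▸ h1)
      refine ⟨x, ⟨Finset.mem_coe.2 (Finset.mem_union_left _ hx), Or.inr (Or.inr (Or.inr ⟨hx, rfl⟩))⟩, ?_⟩
      rintro z ⟨hz, hadj | hadj⟩
      · have := rYY _ hy z hz hadj
        exact absurd h1 (Finset.disjoint_left.1 hY this.1)
      · have := rYY z hz _ hy hadj
        exact (hh hx this.1 this.2).symm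
  · have key : ∀ a b, r a b → (a ∈ (X : Set α) ∧ b ∈ (W : Set α)) ∨ (a ∈ (W : Set α) ∧ b ∈ (U : Set α)) ∨
        (a ∈ ((Y1 ∪ Y2 : Finset α) : Set α) ∧ b ∈ ((Y1 ∪ Y2 : Finset α) : Set α)) := by
      rintro a b (⟨h1, rfl⟩ | ⟨h1, rfl⟩ | ⟨h1, rfl⟩)
      · exact Or.inl ⟨h1, fW a h1⟩
      · exact Or.inr (Or.inl ⟨h1, gU a h1⟩)
      · exact Or.inr (Or.inr ⟨Finset.mem_coe.2 (Finset.mem_union_left _ h1), Finset.mem_coe.2 (Finset.mem_union_right _ (hY2' a h1))⟩)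
    rintro a b (h1 | h1)
    · have := key a b h1; tauto
    · have := key b a h1; tauto

lemma hall_fun {α : Type*} [DecidableEq α] (X : Finset α) (s : α → Finset α)
    (h : ∀ S ⊆ X, S.card ≤ (S.biUnion s).card) :
    ∃ f : α → α, Set.InjOn f X ∧ ∀ x ∈ X, f x ∈ s x := by
  have := (Finset.all_card_le_biUnion_card_iff_exists_injective (fun x : {x // x ∈ X} => s x.1)).1 (by
    intro S
    have h1 := h (S.map (Function.Embedding.subtype _)) (by
      intro x hx
      simp only [Finset.mem_map, Function.Embedding.coe_subtype] at hx
      obtain ⟨a, _, rfl⟩ := hx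
      exact a.2)
    rw [Finset.card_map] at h1
    refine h1.trans (Finset.card_le_card ?_)
    intro z hz
    simp only [Finset.mem_biUnion, Finset.mem_map, Function.Embedding.coe_subtype] at hz ⊢
    obtain ⟨_, ⟨a, ha, rfl⟩, hz⟩ := hz
    exact ⟨a, ha, hz⟩)
  obtain ⟨f, hf, hfs⟩ := this
  refine ⟨fun x => if hx : x ∈ X then f ⟨x, hx⟩ else x, ?_, ?_⟩
  · intro x hx y hy hxy
    have hx' : x ∈ X := hx
    have hy' : y ∈ X := hy
    simp only [hx', hy', dif_pos] at hxy
    exact congrArg Subtype.val (hf hxy)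
  · intro x hx
    simp only [hx, dif_pos]
    exact hfs ⟨x, hx⟩

lemma hall_sea {α : Type*} [DecidableEq α] (X : Finset α) (s : α → Finset α)
    (h : ∀ x ∈ X, X.card ≤ (s x).card) :
    ∃ f : α → α, Set.InjOn f X ∧ ∀ x ∈ X, f x ∈ s x := by
  refine hall_fun X s fun S hS => ?_
  rcases S.eq_empty_or_nonempty with rfl | ⟨x, hx⟩
  · simp
  · exact (Finset.card_le_card hS).trans ((h x (hS hx)).trans
      (Finset.card_le_card (Finset.subset_biUnion_of_mem s hx)))

lemma card_swap {α : Type*} [DecidableEq α] (D W : Finset α) : (D \ W).card + W.card = D.card + (W \ D).card := by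
  have e1 := Finset.card_sdiff_add_card_inter D W
  have e2 := Finset.card_sdiff_add_card_inter W D
  rw [Finset.inter_comm] at e2
  omega

lemma lemE {α : Type*} [DecidableEq α] (G : SimpleGraph α) (X D : Finset α) (s : α → Finset α) (h N : ℕ)
    (hole : ∀ A ⊆ X, ∀ B ⊆ D, h ≤ A.card → h ≤ B.card → ∃ a ∈ A, ∃ b ∈ B, G.Adj a b)
    (hs : ∀ x ∈ X, N ≤ (s x).card) (hsD : ∀ x ∈ X, Disjoint (s x) D)
    (hN : X.card ≤ N ∨ X.card - D.card + h ≤ N) :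
    ∃ f : α → α, Set.InjOn f X ∧ (∀ x ∈ X, (f x ∈ D ∧ G.Adj x (f x)) ∨ f x ∈ s x) ∧
      ((X.image f) \ D).card ≤ X.card - D.card + h := by
  classical
  let F : Finset (Finset α) := X.powerset.filter (fun X1 => ∃ f : α → α, Set.InjOn f X1 ∧ ∀ x ∈ X1, f x ∈ D ∧ G.Adj x (f x))
  have hF : F.Nonempty := ⟨∅, by simp [F, isEmpty_or_nonempty]⟩
  obtain ⟨X1, hX1, hmax⟩ := F.exists_max_image Finset.card hF
  simp only [F, Finset.mem_filter, Finset.mem_powerset] at hX1 hmax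
  obtain ⟨hX1X, f, hf, hfD⟩ := hX1
  set D1 := X1.image f with hD1
  have hD1D : D1 ⊆ D := by
    intro z hz; obtain ⟨x, hx, rfl⟩ := Finset.mem_image.1 hz; exact (hfD x hx).1
  have cD1 : D1.card = X1.card := Finset.card_image_of_injOn hf
  have noedge : ∀ x ∈ X \ X1, ∀ d ∈ D \ D1, ¬ G.Adj x d := by
    intro x hx d hd hxd
    rw [Finset.mem_sdiff] at hx hd
    have := hmax (insert x X1) ⟨Finset.insert_subset hx.1 hX1X, Function.update f x d, ?_, ?_⟩
    · rw [Finset.card_insert_of_notMem hx.2] at this; omega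
    · intro a ha b hb hab
      simp only [Finset.coe_insert, Set.mem_insert_iff, Finset.mem_coe] at ha hb
      rcases ha with rfl | ha <;> rcases hb with rfl | hb
      · rfl
      · have hne : b ≠ a := by rintro rfl; exact hx.2 hb
        rw [Function.update_self, Function.update_of_ne hne] at hab
        exact absurd (hab ▸ Finset.mem_image_of_mem f hb) hd.2
      · have hne : a ≠ b := by rintro rfl; exact hx.2 ha
        rw [Function.update_self, Function.update_of_ne hne] at hab
        exact absurd (hab ▸ Finset.mem_image_of_mem f ha) hd.2
      · have hne : b ≠ x := by rintro rfl; exact hx.2 hb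
        have hne' : a ≠ x := by rintro rfl; exact hx.2 ha
        rw [Function.update_of_ne hne', Function.update_of_ne hne] at hab
        exact hf ha hb hab
    · intro a ha
      rcases Finset.mem_insert.1 ha with h0 | h1
      · rw [h0, Function.update_self]; exact ⟨hd.1, hxd⟩
      · have hne' : a ≠ x := fun e => hx.2 (e ▸ h1)
        rw [Function.update_of_ne hne']; exact hfD a h1
  have c2 : (X \ X1).card = X.card - X1.card := Finset.card_sdiff_of_subset hX1X
  have c3 : (D \ D1).card = D.card - D1.card := Finset.card_sdiff_of_subset hD1D
  have l1 := Finset.card_le_card hX1X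
  have l2 := Finset.card_le_card hD1D
  have hX2 : (X \ X1).card ≤ X.card - D.card + h := by
    by_contra hcon
    push Not at hcon
    obtain ⟨a, ha, b, hb, hab⟩ := hole (X \ X1) Finset.sdiff_subset (D \ D1) Finset.sdiff_subset (by omega) (by omega)
    exact noedge a ha b hb hab
  obtain ⟨g, hg, hgs⟩ := hall_sea (X \ X1) s (by
    intro x hx
    have := hs x (Finset.mem_sdiff.1 hx).1
    omega)
  have hk : ∀ x ∈ X, x ∉ X1 → g x ∈ s x := fun x hx hx1 => hgs x (Finset.mem_sdiff.2 ⟨hx, hx1⟩)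
  have hgD : ∀ x ∈ X, x ∉ X1 → g x ∉ D := fun x hx hx1 => Finset.disjoint_left.1 (hsD x hx) (hk x hx hx1)
  refine ⟨fun x => if x ∈ X1 then f x else g x, ?_, ?_, ?_⟩
  · intro a ha b hb hab
    simp only at hab
    split_ifs at hab with h1 h2 h2
    · exact hf h1 h2 hab
    · exact absurd (hab ▸ (hfD a h1).1) (hgD b hb h2)
    · exact absurd (hab ▸ (hfD b h2).1) (hgD a ha h1)
    · exact hg (by simp only [Finset.coe_sdiff]; exact ⟨ha, h1⟩) (by simp only [Finset.coe_sdiff]; exact ⟨hb, h2⟩) hab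
  · intro x hx
    by_cases h1 : x ∈ X1
    · simp only [h1, if_true]; exact Or.inl (hfD x h1)
    · simp only [h1, if_false]; exact Or.inr (hk x hx h1)
  · refine le_trans ?_ hX2
    refine (Finset.card_le_card ?_).trans (Finset.card_image_le (s := X \ X1) (f := g))
    intro z hz
    rw [Finset.mem_sdiff, Finset.mem_image] at hz
    obtain ⟨⟨x, hx, rfl⟩, hz⟩ := hz
    by_cases h1 : x ∈ X1
    · simp only [h1, if_true] at hz; exact absurd (hfD x h1).1 hz
    · simp only [h1, if_false]
      exact Finset.mem_image_of_mem g (Finset.mem_sdiff.2 ⟨hx, h1⟩)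

open Classical in
/-- available new vertices -/
noncomputable def sea {α : Type*} [Fintype α] (G : SimpleGraph α) (v : α) (Q : Finset α) (x : α) : Finset α :=
  Finset.univ.filter (fun z => G.Adj x z ∧ G.Adj v z ∧ z ∉ Q)

lemma mem_sea {α : Type*} [Fintype α] (G : SimpleGraph α) (v : α) (Q : Finset α) (x z : α) :
    z ∈ sea G v Q x ↔ G.Adj x z ∧ G.Adj v z ∧ z ∉ Q := by simp [sea]

lemma sea_sub {α : Type*} [Fintype α] [DecidableEq α] (G : SimpleGraph α) (v : α) (Q Q' : Finset α) (x : α) :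
    (sea G v Q x).card ≤ (sea G v (Q ∪ Q') x).card + Q'.card := by
  rw [← Nat.sub_le_iff_le_add]
  refine (Finset.le_card_sdiff _ _).trans (Finset.card_le_card ?_)
  intro z hz
  rw [Finset.mem_sdiff, mem_sea] at hz
  rw [mem_sea, Finset.mem_union]
  tauto

set_option maxHeartbeats 1000000 in
lemma hybrid {α : Type*} [Fintype α] [DecidableEq α] (G : SimpleGraph α) (v : α) (X D Q R : Finset α) (h M : ℕ)
    (hole : ∀ A B : Finset α, Disjoint A B → h ≤ A.card → h ≤ B.card → ∃ a ∈ A, ∃ b ∈ B, G.Adj a b)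
    (hXQ : X ⊆ Q) (hRQ : R ⊆ Q) (hXD : Disjoint X D) (hXR : Disjoint X R) (hDR : Disjoint D R)
    (hDv : ∀ d ∈ D, G.Adj v d)
    (avail : ∀ x, x ∉ R → M ≤ (sea G v (Q ∪ D) x).card)
    (hM : 2 * X.card + D.card ≤ M ∨ 2 * X.card - D.card + 4 * h + 1 ≤ M) :
    ∃ P : Finset α, D ⊆ P ∧ (∀ z ∈ P, z ∉ D → z ∉ Q) ∧ Even P.card ∧ P.card ≤ 2 * X.card + 2 * D.card ∧
      P.card ≤ D.card + (2 * X.card - D.card) + 4 * h + 1 ∧ Petal G (X : Set α) (P : Set α) v := by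
  classical
  set Q0 := Q ∪ D with hQ0
  -- stage 1
  obtain ⟨f, hf, hfm, hfn⟩ := lemE G X D (sea G v Q0) h M
    (fun A hA B hB => hole A B (Finset.disjoint_of_subset_left hA (Finset.disjoint_of_subset_right hB hXD)))
    (fun x hx => avail x (Finset.disjoint_left.1 hXR hx))
    (fun x hx => by
      rw [Finset.disjoint_left]; intro z hz hzD; rw [mem_sea] at hz
      exact hz.2.2 (Finset.mem_union_right _ hzD))
    (by omega)
  set W := X.image f with hW
  have cW : W.card = X.card := Finset.card_image_of_injOn hf
  set N1 := W \ D with hN1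
  have hWD : ∀ w ∈ W, w ∉ D → G.Adj v w ∧ w ∉ Q0 := by
    intro w hw hwD
    obtain ⟨x, hx, rfl⟩ := Finset.mem_image.1 hw
    rcases hfm x hx with h1 | h1
    · exact absurd h1.1 hwD
    · rw [mem_sea] at h1; exact h1.2
  have hWv : ∀ w ∈ W, G.Adj v w := fun w hw => by
    by_cases hwD : w ∈ D
    exacts [hDv w hwD, (hWD w hw hwD).1]
  have hWR : Disjoint W R := by
    rw [Finset.disjoint_left]; intro w hw hwR
    by_cases hwD : w ∈ D
    · exact Finset.disjoint_left.1 hDR hwD hwR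
    · exact (hWD w hw hwD).2 (Finset.mem_union_left _ (hRQ hwR))
  have hXW : Disjoint X W := by
    rw [Finset.disjoint_right]; intro w hw hwX
    by_cases hwD : w ∈ D
    · exact Finset.disjoint_left.1 hXD hwX hwD
    · exact (hWD w hw hwD).2 (Finset.mem_union_left _ (hXQ hwX))
  have hfa : ∀ x ∈ X, G.Adj x (f x) := by
    intro x hx
    rcases hfm x hx with h1 | h1
    · exact h1.2
    · rw [mem_sea] at h1; exact h1.1
  set D' := D \ W with hD'
  have cD' : D'.card + W.card = D.card + N1.card := card_swap D W
  have lN1 : N1.card ≤ W.card := Finset.card_le_card Finset.sdiff_subset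
  have hWD' : Disjoint W D' := Finset.disjoint_sdiff
  -- stage 2
  set Q1 := Q0 ∪ N1 with hQ1
  have avail1 : ∀ x, x ∉ R → M - N1.card ≤ (sea G v Q1 x).card := by
    intro x hx
    have := avail x hx
    have : (sea G v Q0 x).card ≤ (sea G v Q1 x).card + N1.card := sea_sub G v Q0 N1 x
    omega
  obtain ⟨g, hg, hgm, hgn⟩ := lemE G W D' (sea G v Q1) h (M - N1.card)
    (fun A hA B hB => hole A B (Finset.disjoint_of_subset_left hA (Finset.disjoint_of_subset_right hB hWD')))
    (fun x hx => avail1 x (Finset.disjoint_left.1 hWR hx))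
    (fun x hx => by
      rw [Finset.disjoint_left]; intro z hz hzD; rw [mem_sea] at hz
      exact hz.2.2 (Finset.mem_union_left _ (Finset.mem_union_right _ (Finset.mem_sdiff.1 hzD).1)))
    (by omega)
  set U := W.image g with hU
  have cU : U.card = W.card := Finset.card_image_of_injOn hg
  set N2 := U \ D' with hN2
  have hUD : ∀ w ∈ U, w ∉ D' → G.Adj v w ∧ w ∉ Q1 := by
    intro w hw hwD
    obtain ⟨x, hx, rfl⟩ := Finset.mem_image.1 hw
    rcases hgm x hx with h1 | h1
    · exact absurd h1.1 hwD
    · rw [mem_sea] at h1; exact h1.2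
  have hUv : ∀ w ∈ U, G.Adj v w := fun w hw => by
    by_cases hwD : w ∈ D'
    exacts [hDv w (Finset.mem_sdiff.1 hwD).1, (hUD w hw hwD).1]
  have hXU : Disjoint X U := by
    rw [Finset.disjoint_right]; intro w hw hwX
    by_cases hwD : w ∈ D'
    · exact Finset.disjoint_left.1 hXD hwX (Finset.mem_sdiff.1 hwD).1
    · exact (hUD w hw hwD).2 (Finset.mem_union_left _ (Finset.mem_union_left _ (hXQ hwX)))
  have hWU : Disjoint W U := by
    rw [Finset.disjoint_right]; intro w hw hwW
    by_cases hwD : w ∈ D'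
    · exact (Finset.mem_sdiff.1 hwD).2 hwW
    · refine (hUD w hw hwD).2 ?_
      by_cases hwD2 : w ∈ D
      · exact Finset.mem_union_left _ (Finset.mem_union_right _ hwD2)
      · exact Finset.mem_union_right _ (Finset.mem_sdiff.2 ⟨hwW, hwD2⟩)
  have hga : ∀ x ∈ W, G.Adj x (g x) := by
    intro x hx
    rcases hgm x hx with h1 | h1
    · exact h1.2
    · rw [mem_sea] at h1; exact h1.1
  set D'' := D' \ U with hD''
  have cD'' : D''.card + U.card = D'.card + N2.card := card_swap D' U
  have lN2 : N2.card ≤ U.card := Finset.card_le_card Finset.sdiff_subset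
  have lD'' : D''.card ≤ D'.card := Finset.card_le_card Finset.sdiff_subset
  have lD' : D'.card ≤ D.card := Finset.card_le_card Finset.sdiff_subset
  -- stage 3
  obtain ⟨D1, hD1, cD1⟩ := Finset.exists_subset_card_eq (s := D'') (n := D''.card / 2) (Nat.div_le_self _ _)
  set D2 := D'' \ D1 with hD2
  have cD2 : D2.card = D''.card - D1.card := Finset.card_sdiff_of_subset hD1
  have hD12 : Disjoint D1 D2 := Finset.disjoint_sdiff
  have D''D : D'' ⊆ D := Finset.sdiff_subset.trans Finset.sdiff_subset
  have D1D : D1 ⊆ D := hD1.trans D''D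
  have D2D : D2 ⊆ D := Finset.sdiff_subset.trans D''D
  set Q2 := Q1 ∪ N2 with hQ2
  have avail2 : ∀ x, x ∉ R → M - N1.card - N2.card ≤ (sea G v Q2 x).card := by
    intro x hx
    have := avail1 x hx
    have : (sea G v Q1 x).card ≤ (sea G v Q2 x).card + N2.card := sea_sub G v Q1 N2 x
    omega
  have DQ2 : D ⊆ Q2 := fun z hz => Finset.mem_union_left _ (Finset.mem_union_left _ (Finset.mem_union_right _ hz))
  obtain ⟨k1, hk1, hk1m, hk1n⟩ := lemE G D1 D2 (sea G v Q2) h (M - N1.card - N2.card)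
    (fun A hA B hB => hole A B (Finset.disjoint_of_subset_left hA (Finset.disjoint_of_subset_right hB hD12)))
    (fun x hx => avail2 x (Finset.disjoint_left.1 hDR (D1D hx)))
    (fun x hx => by
      rw [Finset.disjoint_left]; intro z hz hzD; rw [mem_sea] at hz
      exact hz.2.2 (DQ2 (D2D hzD)))
    (by omega)
  set I1 := D1.image k1 with hI1
  have cI1 : I1.card = D1.card := Finset.card_image_of_injOn hk1
  set N3 := I1 \ D2 with hN3
  set D3 := D2 \ I1 with hD3
  have cD3 : D3.card + I1.card = D2.card + N3.card := card_swap D2 I1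
  have lN3 : N3.card ≤ I1.card := Finset.card_le_card Finset.sdiff_subset
  have D3D : D3 ⊆ D := Finset.sdiff_subset.trans D2D
  have lD3 : D3.card ≤ D2.card := Finset.card_le_card Finset.sdiff_subset
  have hI1D : ∀ w ∈ I1, w ∉ D2 → G.Adj v w ∧ w ∉ Q2 := by
    intro w hw hwD
    obtain ⟨x, hx, rfl⟩ := Finset.mem_image.1 hw
    rcases hk1m x hx with h1 | h1
    · exact absurd h1.1 hwD
    · rw [mem_sea] at h1; exact h1.2
  -- stage 4
  set Q3 := Q2 ∪ N3 with hQ3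
  have avail3 : ∀ x, x ∉ R → M - N1.card - N2.card - N3.card ≤ (sea G v Q3 x).card := by
    intro x hx
    have := avail2 x hx
    have : (sea G v Q2 x).card ≤ (sea G v Q3 x).card + N3.card := sea_sub G v Q2 N3 x
    omega
  obtain ⟨k2, hk2, hk2m⟩ := hall_sea D3 (sea G v Q3) (by
    intro x hx
    have := avail3 x (Finset.disjoint_left.1 hDR (D3D hx))
    omega)
  set I2 := D3.image k2 with hI2
  have cI2 : I2.card = D3.card := Finset.card_image_of_injOn hk2
  have hI2m : ∀ w ∈ I2, G.Adj v w ∧ w ∉ Q3 := by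
    intro w hw
    obtain ⟨x, hx, rfl⟩ := Finset.mem_image.1 hw
    have h1 := hk2m x hx
    rw [mem_sea] at h1; exact h1.2
  have hD13 : Disjoint D1 D3 := Finset.disjoint_of_subset_right Finset.sdiff_subset hD12
  -- facts on membership in the four parts
  have I1cases : ∀ w ∈ I1, (w ∈ D2) ∨ (w ∉ D ∧ w ∉ Q2 ∧ w ∈ N3) := by
    intro w hw
    by_cases hwD : w ∈ D2
    · exact Or.inl hwD
    · have := (hI1D w hw hwD).2
      exact Or.inr ⟨fun hd => this (DQ2 hd), this, Finset.mem_sdiff.2 ⟨hw, hwD⟩⟩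
  have QQ2 : Q ⊆ Q2 := fun z hz => Finset.mem_union_left _ (Finset.mem_union_left _ (Finset.mem_union_left _ hz))
  have Q2Q3 : Q2 ⊆ Q3 := Finset.subset_union_left
  have WQ2 : W ⊆ Q2 := by
    intro w hw
    by_cases hwD : w ∈ D
    · exact DQ2 hwD
    · exact Finset.mem_union_left _ (Finset.mem_union_right _ (Finset.mem_sdiff.2 ⟨hw, hwD⟩))
  have UQ2 : U ⊆ Q2 := by
    intro w hw
    by_cases hwD : w ∈ D'
    · exact DQ2 (Finset.mem_sdiff.1 hwD).1
    · exact Finset.mem_union_right _ (Finset.mem_sdiff.2 ⟨hw, hwD⟩)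
  have D''W : ∀ z ∈ D'', z ∉ W ∧ z ∉ U := by
    intro z hz
    rw [hD'', hD', Finset.mem_sdiff, Finset.mem_sdiff] at hz
    exact ⟨hz.1.2, hz.2⟩
  have D2D'' : D2 ⊆ D'' := Finset.sdiff_subset
  have D3D'' : D3 ⊆ D'' := Finset.sdiff_subset.trans D2D''
  set Y1 := D1 ∪ D3 with hY1
  set k : α → α := fun x => if x ∈ D1 then k1 x else k2 x with hk
  have kI : Y1.image k = I1 ∪ I2 := by
    ext z
    simp only [hY1, Finset.mem_image, Finset.mem_union, hI1, hI2]
    constructor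
    · rintro ⟨x, hx, rfl⟩
      by_cases h1 : x ∈ D1
      · left; exact ⟨x, h1, by simp [hk, h1]⟩
      · right; exact ⟨x, by tauto, by simp [hk, h1]⟩
    · rintro (⟨x, hx, rfl⟩ | ⟨x, hx, rfl⟩)
      · exact ⟨x, Or.inl hx, by simp [hk, hx]⟩
      · exact ⟨x, Or.inr hx, by simp [hk, Finset.disjoint_right.1 hD13 hx]⟩
  have I12 : Disjoint I1 I2 := by
    rw [Finset.disjoint_left]
    intro z h1 h2
    have := (hI2m z h2).2
    rcases I1cases z h1 with h3 | h3
    · exact this (Q2Q3 (DQ2 (D2D h3)))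
    · exact this (Finset.mem_union_right _ h3.2.2)
  have hYD'' : Y1 ⊆ D'' := by
    intro z hz
    rcases Finset.mem_union.1 hz with h1 | h1
    exacts [hD1 h1, D3D'' h1]
  have outI : ∀ z ∈ I1 ∪ I2, z ∉ X ∧ z ∉ W ∧ z ∉ U ∧ z ∉ Y1 := by
    intro z hz
    have out : z ∉ Q2 → z ∉ X ∧ z ∉ W ∧ z ∉ U ∧ z ∉ Y1 := fun h1 =>
      ⟨fun h2 => h1 (QQ2 (hXQ h2)), fun h2 => h1 (WQ2 h2), fun h2 => h1 (UQ2 h2),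
        fun h2 => h1 (DQ2 (D''D (hYD'' h2)))⟩
    rcases Finset.mem_union.1 hz with h1 | h1
    · rcases I1cases z h1 with h3 | h3
      · refine ⟨fun h2 => Finset.disjoint_left.1 hXD h2 (D2D h3), (D''W z (D2D'' h3)).1, (D''W z (D2D'' h3)).2, fun h2 => ?_⟩
        rcases Finset.mem_union.1 h2 with h2 | h2
        · exact Finset.disjoint_left.1 hD12 h2 h3
        · exact (Finset.mem_sdiff.1 h2).2 h1
      · exact out h3.2.1
    · exact out fun h2 => (hI2m z h1).2 (Q2Q3 h2)
  have hXY1 : Disjoint X Y1 := Finset.disjoint_of_subset_right (hYD''.trans D''D) hXD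
  have hWY1 : Disjoint W Y1 := by
    rw [Finset.disjoint_right]; exact fun z hz => (D''W z (hYD'' hz)).1
  have hUY1 : Disjoint U Y1 := by
    rw [Finset.disjoint_right]; exact fun z hz => (D''W z (hYD'' hz)).2
  have d1 : Disjoint X (I1 ∪ I2) := by rw [Finset.disjoint_right]; exact fun z hz => (outI z hz).1
  have d2 : Disjoint W (I1 ∪ I2) := by rw [Finset.disjoint_right]; exact fun z hz => (outI z hz).2.1
  have d3 : Disjoint U (I1 ∪ I2) := by rw [Finset.disjoint_right]; exact fun z hz => (outI z hz).2.2.1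
  have d4 : Disjoint Y1 (I1 ∪ I2) := by rw [Finset.disjoint_right]; exact fun z hz => (outI z hz).2.2.2
  have d5 : Disjoint (W ∪ U) (Y1 ∪ (I1 ∪ I2)) := by
    simp only [Finset.disjoint_union_left, Finset.disjoint_union_right]
    simp only [Finset.disjoint_union_right] at d2 d3
    tauto
  have cP : (W ∪ U ∪ (Y1 ∪ (I1 ∪ I2))).card = 2 * X.card + 2 * (D1.card + D3.card) := by
    rw [Finset.card_union_of_disjoint d5, Finset.card_union_of_disjoint hWU, Finset.card_union_of_disjoint d4,
      Finset.card_union_of_disjoint I12, hY1, Finset.card_union_of_disjoint hD13]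
    omega
  refine ⟨W ∪ U ∪ (Y1 ∪ (I1 ∪ I2)), ?_, ?_, ?_, ?_, ?_, ?_⟩
  · intro z hz
    simp only [Finset.mem_union, hY1]
    by_cases h1 : z ∈ W
    · tauto
    by_cases h2 : z ∈ U
    · tauto
    have h3 : z ∈ D'' := Finset.mem_sdiff.2 ⟨Finset.mem_sdiff.2 ⟨hz, h1⟩, h2⟩
    by_cases h4 : z ∈ D1
    · tauto
    have h5 : z ∈ D2 := Finset.mem_sdiff.2 ⟨h3, h4⟩
    by_cases h6 : z ∈ I1
    · tauto
    have h7 : z ∈ D3 := Finset.mem_sdiff.2 ⟨h5, h6⟩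
    tauto
  · intro z hz hzD
    simp only [Finset.mem_union, hY1] at hz
    rcases hz with (h1 | h1) | ((h1 | h1) | (h1 | h1))
    · exact fun h2 => (hWD z h1 hzD).2 (Finset.mem_union_left _ h2)
    · exact fun h2 => (hUD z h1 (fun h3 => hzD (Finset.mem_sdiff.1 h3).1)).2
        (Finset.mem_union_left _ (Finset.mem_union_left _ h2))
    · exact absurd (D1D h1) hzD
    · exact absurd (D3D h1) hzD
    · exact fun h2 => (hI1D z h1 (fun h3 => hzD (D2D h3))).2 (QQ2 h2)
    · exact fun h2 => (hI2m z h1).2 (Q2Q3 (QQ2 h2))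
  · rw [cP]; exact ⟨X.card + (D1.card + D3.card), by ring⟩
  · rw [cP]; omega
  · rw [cP]; omega
  · refine petal_of_fun G v X W U Y1 (I1 ∪ I2) f g k hf hW hfa hg hU hga ?_ kI.symm ?_ hXW hXU hXY1 d1
      hWU hWY1 d2 hUY1 d3 d4 ?_
    · apply Finset.injOn_of_card_image_eq
      rw [kI, Finset.card_union_of_disjoint I12, hY1, Finset.card_union_of_disjoint hD13, cI1, cI2]
    · intro x hx
      by_cases h1 : x ∈ D1
      · simp only [hk, h1, if_true]
        rcases hk1m x h1 with h2 | h2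
        · exact h2.2
        · rw [mem_sea] at h2; exact h2.1
      · simp only [hk, h1, if_false]
        have h2 : x ∈ D3 := by
          rcases Finset.mem_union.1 hx with h2 | h2
          exacts [absurd h2 h1, h2]
        have h2 := hk2m x h2
        rw [mem_sea] at h2; exact h2.1
    · intro z hz
      simp only [Finset.mem_union] at hz
      rcases hz with (h1 | h1) | (h1 | (h1 | h1))
      · exact hWv z h1
      · exact hUv z h1
      · exact hDv z (D''D (hYD'' h1))
      · rcases I1cases z h1 with h2 | h2
        · exact hDv z (D2D h2)
        · exact (hI1D z h1 (fun h3 => h2.1 (D2D h3))).1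
      · exact (hI2m z h1).1

set_option maxHeartbeats 1000000 in
lemma step {α : Type*} [Fintype α] [DecidableEq α] (G A : SimpleGraph α) (hA : A ≤ G) (v : Fin 3 → α)
    (D : Fin 3 → Finset α) (X Q R : Finset α) (h M : ℕ)
    (hole : ∀ A B : Finset α, Disjoint A B → h ≤ A.card → h ≤ B.card → ∃ a ∈ A, ∃ b ∈ B, G.Adj a b)
    (tri : ∀ j k, j ≠ k → G.Adj (v j) (v k)) (hvR : ∀ j, v j ∈ R)
    (hXQ : X ⊆ Q) (hRQ : R ⊆ Q) (hDQ : ∀ j, D j ⊆ Q) (hXD : ∀ j, Disjoint X (D j)) (hXR : Disjoint X R)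
    (hDR : ∀ j, Disjoint (D j) R)
    (hDD : ∀ j k, j ≠ k → Disjoint (D j) (D k))
    (hDv : ∀ j, ∀ d ∈ D j, G.Adj (v j) d)
    (avail : ∀ j, ∀ x, x ∉ R → M ≤ (sea G (v j) Q x).card)
    (hM : 6 * X.card + (D 0).card + (D 1).card + (D 2).card ≤ M ∨
      (2 * X.card - (D 0).card) + (2 * X.card - (D 1).card) + (2 * X.card - (D 2).card) + 12 * h + 3 ≤ M) :
    ∃ (S : Finset α) (A' : SimpleGraph α), A' ≤ G ∧ (∀ x ∈ X, ∀ y ∈ X, (A.Adj x y ↔ A'.Adj x y)) ∧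
      FStep A' (S : Set α) (X : Set α) ∧ X ⊆ S ∧ (∀ j, D j ⊆ S) ∧ (∀ j, v j ∈ S) ∧
      (∀ z ∈ S, z ∈ X ∨ (∃ j, z = v j) ∨ (∃ j, z ∈ D j) ∨ z ∉ Q) ∧
      Even (S.card + X.card + 1) ∧
      S.card ≤ 7 * X.card + 3 + 2 * ((D 0).card + (D 1).card + (D 2).card) ∧
      S.card ≤ X.card + 3 + ((D 0).card + (2 * X.card - (D 0).card)) + ((D 1).card + (2 * X.card - (D 1).card))
        + ((D 2).card + (2 * X.card - (D 2).card)) + 12 * h + 3 := by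
  have un : ∀ (Q' D' : Finset α), D' ⊆ Q' → Q' ∪ D' = Q' := fun Q' D' => Finset.union_eq_left.2
  obtain ⟨P0, i0, o0, e0, c0, c0', p0⟩ := hybrid G (v 0) X (D 0) Q R h M hole hXQ hRQ (hXD 0) hXR (hDR 0) (hDv 0)
    (fun x hx => by rw [un _ _ (hDQ 0)]; exact avail 0 x hx) (by omega)
  have k0 : (P0 \ D 0).card = P0.card - (D 0).card := Finset.card_sdiff_of_subset i0
  have g0 := Finset.card_le_card i0
  set Q1 := Q ∪ (P0 \ D 0) with hQ1
  have QQ1 : Q ⊆ Q1 := Finset.subset_union_left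
  obtain ⟨P1, i1, o1, e1, c1, c1', p1⟩ := hybrid G (v 1) X (D 1) Q1 R h (M - (P0 \ D 0).card) hole
    (hXQ.trans QQ1) (hRQ.trans QQ1) (hXD 1) hXR (hDR 1) (hDv 1)
    (fun x hx => by
      rw [un _ _ ((hDQ 1).trans QQ1)]
      have a1 := avail 1 x hx
      have a2 : (sea G (v 1) Q x).card ≤ (sea G (v 1) Q1 x).card + (P0 \ D 0).card := sea_sub G (v 1) Q _ x
      omega) (by omega)
  have k1 : (P1 \ D 1).card = P1.card - (D 1).card := Finset.card_sdiff_of_subset i1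
  have g1 := Finset.card_le_card i1
  set Q2 := Q1 ∪ (P1 \ D 1) with hQ2
  have QQ2 : Q1 ⊆ Q2 := Finset.subset_union_left
  obtain ⟨P2, i2, o2, e2, c2, c2', p2⟩ := hybrid G (v 2) X (D 2) Q2 R h (M - (P0 \ D 0).card - (P1 \ D 1).card) hole
    (hXQ.trans (QQ1.trans QQ2)) (hRQ.trans (QQ1.trans QQ2)) (hXD 2) hXR (hDR 2) (hDv 2)
    (fun x hx => by
      rw [un _ _ ((hDQ 2).trans (QQ1.trans QQ2))]
      have a1 := avail 2 x hx
      have a2 : (sea G (v 2) Q x).card ≤ (sea G (v 2) Q1 x).card + (P0 \ D 0).card := sea_sub G (v 2) Q _ x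
      have a3 : (sea G (v 2) Q1 x).card ≤ (sea G (v 2) Q2 x).card + (P1 \ D 1).card := sea_sub G (v 2) Q1 _ x
      omega) (by omega)
  let P : Fin 3 → Finset α := ![P0, P1, P2]
  have PQ : ∀ j, ∀ z ∈ P j, z ∉ D j → z ∉ Q := by
    intro j z hz hzD
    fin_cases j
    · exact o0 z hz hzD
    · exact fun hh => o1 z hz hzD (QQ1 hh)
    · exact fun hh => o2 z hz hzD (QQ2 (QQ1 hh))
  have vP : ∀ j k, v j ∉ P k := by
    intro j k hjk
    by_cases hd : v j ∈ D k
    · exact Finset.disjoint_left.1 (hDR k) hd (hvR j)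
    · exact PQ k _ hjk hd (hRQ (hvR j))
  have XP : ∀ j, Disjoint X (P j) := by
    intro j; rw [Finset.disjoint_left]; intro z hz hzP
    by_cases hd : z ∈ D j
    · exact Finset.disjoint_left.1 (hXD j) hz hd
    · exact PQ j _ hzP hd (hXQ hz)
  have d01 : Disjoint P0 P1 := by
    rw [Finset.disjoint_left]; intro z hz hz1
    by_cases hd : z ∈ D 1
    · by_cases hd0 : z ∈ D 0
      · exact Finset.disjoint_left.1 (hDD 0 1 (by decide)) hd0 hd
      · exact o0 z hz hd0 (hDQ 1 hd)
    · refine o1 z hz1 hd ?_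
      by_cases hd0 : z ∈ D 0
      · exact QQ1 (hDQ 0 hd0)
      · exact Finset.mem_union_right _ (Finset.mem_sdiff.2 ⟨hz, hd0⟩)
  have d02 : Disjoint P0 P2 := by
    rw [Finset.disjoint_left]; intro z hz hz1
    by_cases hd : z ∈ D 2
    · by_cases hd0 : z ∈ D 0
      · exact Finset.disjoint_left.1 (hDD 0 2 (by decide)) hd0 hd
      · exact o0 z hz hd0 (hDQ 2 hd)
    · refine o2 z hz1 hd (QQ2 ?_)
      by_cases hd0 : z ∈ D 0
      · exact QQ1 (hDQ 0 hd0)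
      · exact Finset.mem_union_right _ (Finset.mem_sdiff.2 ⟨hz, hd0⟩)
  have d12 : Disjoint P1 P2 := by
    rw [Finset.disjoint_left]; intro z hz hz1
    by_cases hd : z ∈ D 2
    · by_cases hd0 : z ∈ D 1
      · exact Finset.disjoint_left.1 (hDD 1 2 (by decide)) hd0 hd
      · exact o1 z hz hd0 (QQ1 (hDQ 2 hd))
    · refine o2 z hz1 hd ?_
      by_cases hd0 : z ∈ D 1
      · exact QQ2 (QQ1 (hDQ 1 hd0))
      · exact Finset.mem_union_right _ (Finset.mem_sdiff.2 ⟨hz, hd0⟩)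
  have PP : ∀ j k, j ≠ k → Disjoint (P j) (P k) := by
    intro j k hjk
    fin_cases j <;> fin_cases k
    · exact absurd rfl hjk
    · exact d01
    · exact d02
    · exact d01.symm
    · exact absurd rfl hjk
    · exact d12
    · exact d02.symm
    · exact d12.symm
    · exact absurd rfl hjk
  set T : Finset α := {v 0, v 1, v 2} with hT
  have cT : T.card = 3 := by
    rw [hT, Finset.card_eq_three]
    exact ⟨_, _, _, (tri 0 1 (by decide)).ne, (tri 0 2 (by decide)).ne, (tri 1 2 (by decide)).ne, rfl⟩
  have memT : ∀ z ∈ T, ∃ j, z = v j := by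
    intro z hz
    simp only [hT, Finset.mem_insert, Finset.mem_singleton] at hz
    rcases hz with h1 | h1 | h1
    exacts [⟨0, h1⟩, ⟨1, h1⟩, ⟨2, h1⟩]
  have TX : Disjoint X T := by
    rw [Finset.disjoint_right]; intro z hz hzX
    obtain ⟨j, rfl⟩ := memT z hz
    exact Finset.disjoint_left.1 hXR hzX (hvR j)
  have TP : ∀ k, Disjoint T (P k) := by
    intro k
    rw [Finset.disjoint_left]; intro z hz hzX
    obtain ⟨j, rfl⟩ := memT z hz
    exact vP j k hzX
  set S := X ∪ T ∪ P 0 ∪ P 1 ∪ P 2 with hS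
  have cS : S.card = X.card + 3 + P0.card + P1.card + P2.card := by
    have := XP 0; have := XP 1; have := XP 2; have := TP 0; have := TP 1; have := TP 2
    have := PP 0 1 (by decide); have := PP 0 2 (by decide); have := PP 1 2 (by decide)
    rw [hS, Finset.card_union_of_disjoint, Finset.card_union_of_disjoint, Finset.card_union_of_disjoint,
      Finset.card_union_of_disjoint TX, cT]
    · rfl
    all_goals simp only [Finset.disjoint_union_left]; tauto
  obtain ⟨A', hA', hag, hst⟩ := assemble G A hA (S : Set α) (X : Set α) v (fun j => (P j : Set α))
    (by rw [hS, hT]; push_cast; rfl) tri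
    (fun j hj => Finset.disjoint_left.1 hXR hj (hvR j)) vP
    (fun j => Finset.disjoint_coe.2 (XP j)) (fun j k hjk => Finset.disjoint_coe.2 (PP j k hjk))
    (by intro j; fin_cases j; exacts [p0, p1, p2])
  have PS : ∀ j, P j ⊆ S := by
    intro j z hz
    simp only [hS, Finset.mem_union]
    fin_cases j
    · exact Or.inl (Or.inl (Or.inr hz))
    · exact Or.inl (Or.inr hz)
    · exact Or.inr hz
  have DP : ∀ j, D j ⊆ P j := by
    intro j; fin_cases j; exacts [i0, i1, i2]
  refine ⟨S, A', hA', fun x hx y hy => hag x hx y hy, hst, ?_, fun j => (DP j).trans (PS j), ?_, ?_, ?_, ?_, ?_⟩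
  · intro z hz; simp only [hS, Finset.mem_union]; tauto
  · intro j
    have : v j ∈ T := by rw [hT]; fin_cases j <;> simp
    simp only [hS, Finset.mem_union]; tauto
  · intro z hz
    have key : ∀ j, z ∈ P j → (∃ j, z ∈ D j) ∨ z ∉ Q := by
      intro j hj
      by_cases hd : z ∈ D j
      · exact Or.inl ⟨j, hd⟩
      · exact Or.inr (PQ j z hj hd)
    simp only [hS, Finset.mem_union] at hz
    rcases hz with (((h1 | h1) | h1) | h1) | h1
    · exact Or.inl h1
    · exact Or.inr (Or.inl (memT z h1))
    all_goals exact Or.inr (Or.inr (key _ h1))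
  · rw [cS]
    obtain ⟨a, ha⟩ := e0; obtain ⟨b, hb⟩ := e1; obtain ⟨c, hc⟩ := e2
    exact ⟨X.card + 2 + a + b + c, by omega⟩
  · rw [cS]; omega
  · rw [cS]; omega

open Classical in
/-- neighbours of `x` within `Y` -/
noncomputable def nbr {α : Type*} (G : SimpleGraph α) (Y : Finset α) (x : α) : Finset α :=
  Y.filter (fun z => G.Adj x z)

lemma mem_nbr {α : Type*} (G : SimpleGraph α) (Y : Finset α) (x z : α) :
    z ∈ nbr G Y x ↔ z ∈ Y ∧ G.Adj x z := by simp [nbr]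

lemma nbr_mono {α : Type*} (G : SimpleGraph α) {Y Y' : Finset α} (h : Y ⊆ Y') (x : α) :
    (nbr G Y x).card ≤ (nbr G Y' x).card := by
  refine Finset.card_le_card fun z hz => ?_
  rw [mem_nbr] at hz ⊢
  exact ⟨h hz.1, hz.2⟩

lemma hall_one {α : Type*} [DecidableEq α] (G : SimpleGraph α) (X Y : Finset α) (h : ℕ)
    (hole : ∀ A B : Finset α, Disjoint A B → h ≤ A.card → h ≤ B.card → ∃ a ∈ A, ∃ b ∈ B, G.Adj a b)
    (hXY : Disjoint X Y) (hd : ∀ x ∈ X, h ≤ (nbr G Y x).card) (hc : X.card + h ≤ Y.card) :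
    ∃ f : α → α, Set.InjOn f X ∧ ∀ x ∈ X, f x ∈ Y ∧ G.Adj x (f x) := by
  obtain ⟨f, hf, hfs⟩ := hall_fun X (nbr G Y) (by
    intro S hS
    rcases S.eq_empty_or_nonempty with rfl | ⟨x, hx⟩
    · simp
    · have h1 := hd x (hS hx)
      have h2 := Finset.card_le_card (Finset.subset_biUnion_of_mem (nbr G Y) hx)
      by_cases h3 : S.card ≤ h
      · omega
      · by_contra hcon
        have h4 := Finset.le_card_sdiff (S.biUnion (nbr G Y)) Y
        have h5 := Finset.card_le_card hS
        obtain ⟨a, ha, b, hb, hab⟩ := hole S (Y \ S.biUnion (nbr G Y))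
          (Finset.disjoint_of_subset_left hS (Finset.disjoint_of_subset_right Finset.sdiff_subset hXY))
          (by omega) (by omega)
        rw [Finset.mem_sdiff] at hb
        exact hb.2 (Finset.mem_biUnion.2 ⟨a, ha, (mem_nbr _ _ _ _).2 ⟨hb.1, hab⟩⟩))
  exact ⟨f, hf, fun x hx => (mem_nbr _ _ _ _).1 (hfs x hx)⟩

lemma hall_two {α : Type*} [DecidableEq α] (G : SimpleGraph α) (X Y : Finset α) (h : ℕ)
    (hole : ∀ A B : Finset α, Disjoint A B → h ≤ A.card → h ≤ B.card → ∃ a ∈ A, ∃ b ∈ B, G.Adj a b)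
    (hXY : Disjoint X Y) (hd : ∀ x ∈ X, h ≤ (nbr G Y x).card) (hd' : ∀ y ∈ Y, h ≤ (nbr G X y).card)
    (hc : X.card = Y.card) :
    ∃ f : α → α, Set.InjOn f X ∧ ∀ x ∈ X, f x ∈ Y ∧ G.Adj x (f x) := by
  obtain ⟨f, hf, hfs⟩ := hall_fun X (nbr G Y) (by
    intro S hS
    rcases S.eq_empty_or_nonempty with rfl | ⟨x, hx⟩
    · simp
    · have h1 := hd x (hS hx)
      have h2 := Finset.card_le_card (Finset.subset_biUnion_of_mem (nbr G Y) hx)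
      by_cases h3 : S.card ≤ h
      · omega
      · by_contra hcon
        have h4 := Finset.le_card_sdiff (S.biUnion (nbr G Y)) Y
        have h5 := Finset.card_le_card hS
        by_cases h6 : h ≤ (Y \ S.biUnion (nbr G Y)).card
        · obtain ⟨a, ha, b, hb, hab⟩ := hole S (Y \ S.biUnion (nbr G Y))
            (Finset.disjoint_of_subset_left hS (Finset.disjoint_of_subset_right Finset.sdiff_subset hXY))
            (by omega) h6
          rw [Finset.mem_sdiff] at hb
          exact hb.2 (Finset.mem_biUnion.2 ⟨a, ha, (mem_nbr _ _ _ _).2 ⟨hb.1, hab⟩⟩)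
        · have hT : (Y \ S.biUnion (nbr G Y)).Nonempty := by
            rw [← Finset.card_pos]; omega
          obtain ⟨t, ht⟩ := hT
          rw [Finset.mem_sdiff] at ht
          have h7 := hd' t ht.1
          have h8 : (nbr G X t) ⊆ X \ S := by
            intro a ha
            rw [mem_nbr] at ha
            rw [Finset.mem_sdiff]
            exact ⟨ha.1, fun haS => ht.2 (Finset.mem_biUnion.2 ⟨a, haS, (mem_nbr _ _ _ _).2 ⟨ht.1, ha.2.symm⟩⟩)⟩
          have h9 := Finset.card_le_card h8
          rw [Finset.card_sdiff_of_subset hS] at h9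
          omega)
  exact ⟨f, hf, fun x hx => (mem_nbr _ _ _ _).1 (hfs x hx)⟩

lemma exactPetal {α : Type*} [DecidableEq α] (G : SimpleGraph α) (v : α) (X V B C1 C2 : Finset α) (h : ℕ)
    (hole : ∀ A B : Finset α, Disjoint A B → h ≤ A.card → h ≤ B.card → ∃ a ∈ A, ∃ b ∈ B, G.Adj a b)
    (hXV : Disjoint X V) (hv : ∀ z ∈ V, G.Adj v z) (hev : Even V.card)
    (hB : B ⊆ V) (hC1 : C1 ⊆ V) (hC2 : C2 ⊆ V) (hBC1 : Disjoint B C1) (hBC2 : Disjoint B C2)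
    (hCC : Disjoint C1 C2)
    (dX : ∀ x ∈ X, h ≤ (nbr G (V \ (B ∪ C1 ∪ C2)) x).card)
    (dB : ∀ x ∈ V, h ≤ (nbr G B x).card)
    (dC1 : ∀ x ∈ V, h ≤ (nbr G C1 x).card)
    (dC2 : ∀ x ∈ V, h ≤ (nbr G C2 x).card)
    (s0 : X.card + h + B.card + C1.card + C2.card ≤ V.card)
    (s1 : 2 * X.card + h + C1.card + C2.card ≤ V.card)
    (s2 : 2 * X.card + 2 * C1.card ≤ V.card) (s3 : 2 * X.card + 2 * C2.card ≤ V.card) :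
    Petal G (X : Set α) (V : Set α) v := by
  set Bs := B ∪ C1 ∪ C2 with hBs
  have cBs : Bs.card ≤ B.card + C1.card + C2.card :=
    (Finset.card_union_le _ _).trans (Nat.add_le_add_right (Finset.card_union_le _ _) _)
  obtain ⟨f, hf, hfm⟩ := hall_one G X (V \ Bs) h hole
    (Finset.disjoint_of_subset_right Finset.sdiff_subset hXV) dX (by
      have := Finset.le_card_sdiff Bs V
      omega)
  set W := X.image f with hW
  have cW : W.card = X.card := Finset.card_image_of_injOn hf
  have hWm : ∀ w ∈ W, w ∈ V ∧ w ∉ Bs := by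
    intro w hw
    obtain ⟨x, hx, rfl⟩ := Finset.mem_image.1 hw
    exact Finset.mem_sdiff.1 (hfm x hx).1
  set YU := V \ (W ∪ C1 ∪ C2) with hYU
  have cYU : V.card - (W.card + C1.card + C2.card) ≤ YU.card := by
    have h1 := Finset.le_card_sdiff (W ∪ C1 ∪ C2) V
    have h2 : (W ∪ C1 ∪ C2).card ≤ W.card + C1.card + C2.card :=
      (Finset.card_union_le _ _).trans (Nat.add_le_add_right (Finset.card_union_le _ _) _)
    have h3 : YU.card = (V \ (W ∪ C1 ∪ C2)).card := rfl
    omega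
  have BYU : B ⊆ YU := by
    intro z hz
    rw [hYU, Finset.mem_sdiff]
    refine ⟨hB hz, ?_⟩
    simp only [Finset.mem_union, not_or]
    refine ⟨⟨fun hw => (hWm z hw).2 ?_, Finset.disjoint_left.1 hBC1 hz⟩, Finset.disjoint_left.1 hBC2 hz⟩
    simp only [hBs, Finset.mem_union]; tauto
  have WYU : Disjoint W YU := by
    rw [Finset.disjoint_left]; intro z hz hz'
    rw [hYU, Finset.mem_sdiff] at hz'
    exact hz'.2 (by simp only [Finset.mem_union]; tauto)
  obtain ⟨g, hg, hgm⟩ := hall_one G W YU h hole WYU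
    (fun w hw => (dB w (hWm w hw).1).trans (nbr_mono G BYU w)) (by omega)
  set U := W.image g with hU
  have cU : U.card = W.card := Finset.card_image_of_injOn hg
  have hUm : ∀ w ∈ U, w ∈ V ∧ w ∉ W ∧ w ∉ C1 ∧ w ∉ C2 := by
    intro w hw
    obtain ⟨x, hx, rfl⟩ := Finset.mem_image.1 hw
    have := (hgm x hx).1
    rw [hYU, Finset.mem_sdiff] at this
    simp only [Finset.mem_union, not_or] at this
    tauto
  have hWU : Disjoint W U := by
    rw [Finset.disjoint_right]; exact fun z hz => (hUm z hz).2.1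
  have WUV : W ∪ U ⊆ V := by
    intro z hz
    rcases Finset.mem_union.1 hz with h1 | h1
    exacts [(hWm z h1).1, (hUm z h1).1]
  set Yr := V \ (W ∪ U) with hYr
  have cYr : Yr.card = V.card - 2 * X.card := by
    rw [hYr, Finset.card_sdiff_of_subset WUV, Finset.card_union_of_disjoint hWU]; omega
  obtain ⟨m, hm⟩ := hev
  have C1Y : C1 ⊆ Yr := by
    intro z hz
    rw [hYr, Finset.mem_sdiff, Finset.mem_union]
    refine ⟨hC1 hz, ?_⟩
    rintro (h1 | h1)
    · exact (hWm z h1).2 (by simp only [hBs, Finset.mem_union]; tauto)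
    · exact (hUm z h1).2.2.1 hz
  have C2Y : C2 ⊆ Yr := by
    intro z hz
    rw [hYr, Finset.mem_sdiff, Finset.mem_union]
    refine ⟨hC2 hz, ?_⟩
    rintro (h1 | h1)
    · exact (hWm z h1).2 (by simp only [hBs, Finset.mem_union]; tauto)
    · exact (hUm z h1).2.2.2 hz
  obtain ⟨Y1, hY1, hY1', cY1⟩ := Finset.exists_subsuperset_card_eq (s := C1) (t := Yr \ C2) (n := m - X.card)
    (by
      intro z hz
      exact Finset.mem_sdiff.2 ⟨C1Y hz, Finset.disjoint_left.1 hCC hz⟩) (by omega)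
    (by rw [Finset.card_sdiff_of_subset C2Y]; omega)
  set Y2 := Yr \ Y1 with hY2
  have Y1Yr : Y1 ⊆ Yr := hY1'.trans Finset.sdiff_subset
  have cY2 : Y2.card = m - X.card := by
    rw [hY2, Finset.card_sdiff_of_subset Y1Yr]; omega
  have C2Y2 : C2 ⊆ Y2 := by
    intro z hz
    rw [hY2, Finset.mem_sdiff]
    exact ⟨C2Y hz, fun h1 => (Finset.mem_sdiff.1 (hY1' h1)).2 hz⟩
  have YrV : Yr ⊆ V := Finset.sdiff_subset
  have Y2Yr : Y2 ⊆ Yr := Finset.sdiff_subset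
  have hY12 : Disjoint Y1 Y2 := Finset.disjoint_sdiff
  obtain ⟨k, hk, hkm⟩ := hall_two G Y1 Y2 h hole hY12
    (fun x hx => (dC2 x (YrV (Y1Yr hx))).trans (nbr_mono G C2Y2 x))
    (fun x hx => (dC1 x (YrV (Y2Yr hx))).trans (nbr_mono G hY1 x)) (by omega)
  have hY2i : Y2 = Y1.image k := by
    symm
    apply Finset.eq_of_subset_of_card_le
    · intro z hz
      obtain ⟨x, hx, rfl⟩ := Finset.mem_image.1 hz
      exact (hkm x hx).1
    · rw [Finset.card_image_of_injOn hk]; omega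
  have Yrd : Disjoint (W ∪ U) Yr := Finset.disjoint_sdiff
  have hWY : Disjoint W Yr := Finset.disjoint_of_subset_left Finset.subset_union_left Yrd
  have hUY : Disjoint U Yr := Finset.disjoint_of_subset_left Finset.subset_union_right Yrd
  have hXs : ∀ Z : Finset α, Z ⊆ V → Disjoint X Z := fun Z hZ => Finset.disjoint_of_subset_right hZ hXV
  have hpart : V = W ∪ U ∪ (Y1 ∪ Y2) := by
    rw [hY2, Finset.union_sdiff_of_subset Y1Yr, hYr, Finset.union_sdiff_of_subset WUV]
  rw [hpart]
  exact petal_of_fun G v X W U Y1 Y2 f g k hf hW (fun x hx => (hfm x hx).2) hg hU (fun x hx => (hgm x hx).2)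
    hk hY2i (fun x hx => (hkm x hx).2) (hXs _ (Finset.subset_union_left.trans WUV))
    (hXs _ (Finset.subset_union_right.trans WUV)) (hXs _ (Y1Yr.trans YrV)) (hXs _ (Y2Yr.trans YrV)) hWU
    (Finset.disjoint_of_subset_right Y1Yr hWY) (Finset.disjoint_of_subset_right Y2Yr hWY)
    (Finset.disjoint_of_subset_right Y1Yr hUY) (Finset.disjoint_of_subset_right Y2Yr hUY) hY12
    (fun x hx => hv x (by rw [hpart]; exact hx))

lemma card_le_cnt {n : ℕ} (G : SimpleGraph (Fin n)) (T P F : Finset (Fin n))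
    (h : ∀ z ∈ F, z ∉ T ∧ ∀ t ∈ T, (G.Adj t z ↔ t ∈ P)) : F.card ≤ cnt G T P := by
  classical
  unfold cnt
  refine Finset.card_le_card fun z hz => ?_
  simp only [Finset.mem_filter, Finset.mem_univ, true_and]
  exact h z hz

lemma cnt_le_card {n : ℕ} (G : SimpleGraph (Fin n)) (T P F E : Finset (Fin n))
    (h : ∀ z, z ∉ T → (∀ t ∈ T, (G.Adj t z ↔ t ∈ P)) → z ∈ F ∨ z ∈ E) : cnt G T P ≤ F.card + E.card := by
  classical
  unfold cnt
  refine (Finset.card_le_card (t := F ∪ E) fun z hz => ?_).trans (Finset.card_union_le _ _)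
  simp only [Finset.mem_filter, Finset.mem_univ, true_and] at hz
  exact Finset.mem_union.2 (h z hz.1 hz.2)

lemma UProp.le {n : ℕ} {G : SimpleGraph (Fin n)} {p : ℝ} {k : ℕ} {δ : ℝ} (h : UProp G p k δ)
    (T P : Finset (Fin n)) (hT : T.card ≤ k) (hP : P ⊆ T) :
    (cnt G T P : ℝ) ≤ (p ^ P.card * (1 - p) ^ (T.card - P.card) + δ) * n := by
  have := (abs_le.1 (h T P hT hP)).2
  linarith

lemma UProp.ge {n : ℕ} {G : SimpleGraph (Fin n)} {p : ℝ} {k : ℕ} {δ : ℝ} (h : UProp G p k δ)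
    (T P : Finset (Fin n)) (hT : T.card ≤ k) (hP : P ⊆ T) :
    (p ^ P.card * (1 - p) ^ (T.card - P.card) - δ) * n ≤ (cnt G T P : ℝ) := by
  have := (abs_le.1 (h T P hT hP)).1
  linarith

lemma UProp.ge' {n : ℕ} {G : SimpleGraph (Fin n)} {p : ℝ} {k : ℕ} {δ : ℝ} (h : UProp G p k δ)
    (hp0 : 0 < p) (hp1 : p < 1) (m : ℕ)
    (T P : Finset (Fin n)) (hT : T.card ≤ k) (hTm : T.card ≤ m) (hP : P ⊆ T) :
    ((p * (1 - p)) ^ m - δ) * n ≤ (cnt G T P : ℝ) := by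
  refine le_trans ?_ (h.ge T P hT hP)
  have h1 : (p * (1 - p)) ^ m ≤ p ^ P.card * (1 - p) ^ (T.card - P.card) := by
    rw [mul_pow]
    have e1 : p ^ m ≤ p ^ P.card := pow_le_pow_of_le_one hp0.le hp1.le ((Finset.card_le_card hP).trans hTm)
    have e2 : (1 - p) ^ m ≤ (1 - p) ^ (T.card - P.card) := pow_le_pow_of_le_one (by linarith) (by linarith) (by omega)
    exact mul_le_mul e1 e2 (pow_nonneg (by linarith) _) (pow_nonneg hp0.le _)
  have : (0:ℝ) ≤ n := Nat.cast_nonneg n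
  nlinarith

open Classical in
lemma dom_one {n : ℕ} {G : SimpleGraph (Fin n)} {p : ℝ} {δ τ : ℝ} (h : UProp G p 3 δ)
    (hp0 : 0 < p) (hp1 : p < 1) (hτ1 : τ ≤ 1) (hqτ : 1 - p < τ)
    (T Q Z : Finset (Fin n)) (hT : T.card ≤ 2)
    (hs : 2 * δ * n + 1 + Q.card ≤ (τ - (1 - p)) * p ^ 2 * n) :
    ∃ u, u ∉ T ∧ u ∉ Q ∧ (∀ t ∈ T, G.Adj t u) ∧
      ((Z.filter (fun z => ¬ G.Adj u z)).card : ℝ) ≤ τ * Z.card := by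
  have hn : (0:ℝ) ≤ n := Nat.cast_nonneg n
  set S : Finset (Fin n) := Finset.univ.filter (fun u => u ∉ T ∧ u ∉ Q ∧ ∀ t ∈ T, G.Adj t u) with hS
  have c1 : cnt G T T ≤ S.card + Q.card := cnt_le_card G T T S Q (by
    intro z hz ha
    by_cases hq : z ∈ Q
    · exact Or.inr hq
    · left; simp only [hS, Finset.mem_filter, Finset.mem_univ, true_and]
      exact ⟨hz, hq, fun t ht => (ha t ht).2 ht⟩)
  have c2 := h.ge T T (by omega) subset_rfl
  rw [Nat.sub_self, pow_zero, mul_one] at c2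
  have c1' : (cnt G T T : ℝ) ≤ S.card + Q.card := by exact_mod_cast c1
  have pt : p ^ 2 ≤ p ^ T.card := pow_le_pow_of_le_one hp0.le hp1.le hT
  have pt0 : 0 < p ^ T.card := pow_pos hp0 _
  -- nonneighbours
  have nb : ∀ z, ((S.filter (fun u => ¬ G.Adj u z)).card : ℝ) ≤ (p ^ T.card * (1 - p) + δ) * n + 1 := by
    intro z
    by_cases hz : z ∈ T
    · have : S.filter (fun u => ¬ G.Adj u z) = ∅ := by
        rw [Finset.filter_eq_empty_iff]
        intro u hu
        simp only [hS, Finset.mem_filter, Finset.mem_univ, true_and] at hu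
        exact not_not.2 (hu.2.2 z hz).symm
      rw [this]
      have h1 := (Nat.cast_nonneg (cnt G T T)).trans (h.le T T (by omega) subset_rfl)
      have h0 : (0:ℝ) ≤ δ * n := by
        have := h T T (by omega) subset_rfl
        exact (abs_nonneg _).trans this
      have : 0 ≤ p ^ T.card * (1 - p) * n := mul_nonneg (mul_nonneg pt0.le (by linarith)) hn
      simp only [Finset.card_empty, Nat.cast_zero]
      linarith
    · have h1 : ((S.filter (fun u => ¬ G.Adj u z)).erase z).card ≤ cnt G (insert z T) T := by
        apply card_le_cnt
        intro u hu
        simp only [hS, Finset.mem_erase, Finset.mem_filter, Finset.mem_univ, true_and] at hu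
        refine ⟨?_, ?_⟩
        · rw [Finset.mem_insert, not_or]; exact ⟨hu.1, hu.2.1.1⟩
        · intro t ht
          rcases Finset.mem_insert.1 ht with rfl | ht
          · simp only [hz, iff_false]; exact fun h => hu.2.2 h.symm
          · simp only [ht, iff_true]; exact hu.2.1.2.2 t ht
      have h2 := h.le (insert z T) T (by rw [Finset.card_insert_of_notMem hz]; omega) (Finset.subset_insert _ _)
      rw [Finset.card_insert_of_notMem hz, Nat.add_sub_cancel_left, pow_one] at h2
      have h3 : (S.filter (fun u => ¬ G.Adj u z)).card ≤ ((S.filter (fun u => ¬ G.Adj u z)).erase z).card + 1 := by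
        have := Finset.pred_card_le_card_erase (s := S.filter (fun u => ¬ G.Adj u z)) (a := z)
        omega
      have h4 : ((S.filter (fun u => ¬ G.Adj u z)).card : ℝ) ≤ cnt G (insert z T) T + 1 := by
        exact_mod_cast h3.trans (Nat.add_le_add_right h1 1)
      linarith
  have h0 : (0:ℝ) ≤ δ * n := by
    have := h T T (by omega) subset_rfl
    exact (abs_nonneg _).trans this
  have a1 : (τ - (1 - p)) * p ^ 2 * n ≤ (τ - (1 - p)) * p ^ T.card * n := by
    have := mul_le_mul_of_nonneg_left pt (by linarith : 0 ≤ τ - (1 - p))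
    exact mul_le_mul_of_nonneg_right this hn
  have hsp : (0:ℝ) < S.card := by
    have : (τ - (1 - p)) * p ^ T.card * n ≤ 1 * p ^ T.card * n :=
      mul_le_mul_of_nonneg_right (mul_le_mul_of_nonneg_right (by linarith) pt0.le) hn
    nlinarith
  have key : (p ^ T.card * (1 - p) + δ) * n + 1 ≤ τ * S.card := by
    have hτ0 : 0 < τ := by linarith
    have e1 : τ * ((p ^ T.card - δ) * n - Q.card) ≤ τ * S.card :=
      mul_le_mul_of_nonneg_left (by linarith) hτ0.le
    have e2 : τ * (δ * n) ≤ 1 * (δ * n) := mul_le_mul_of_nonneg_right hτ1 h0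
    have e3 : τ * Q.card ≤ 1 * Q.card := mul_le_mul_of_nonneg_right hτ1 (Nat.cast_nonneg _)
    nlinarith
  by_contra hcon
  push Not at hcon
  have hsum : ∑ u ∈ S, (τ * Z.card) < ∑ u ∈ S, ((Z.filter (fun z => ¬ G.Adj u z)).card : ℝ) := by
    apply Finset.sum_lt_sum_of_nonempty
    · rw [← Finset.card_pos]; exact_mod_cast hsp
    · intro u hu
      simp only [hS, Finset.mem_filter, Finset.mem_univ, true_and] at hu
      exact hcon u hu.1 hu.2.1 hu.2.2
  have hsw : ∑ u ∈ S, ((Z.filter (fun z => ¬ G.Adj u z)).card : ℝ) = ∑ z ∈ Z, ((S.filter (fun u => ¬ G.Adj u z)).card : ℝ) := by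
    have := Finset.sum_card_bipartiteAbove_eq_sum_card_bipartiteBelow (s := S) (t := Z) (fun u z => ¬ G.Adj u z)
    simp only [Finset.bipartiteAbove, Finset.bipartiteBelow] at this
    exact_mod_cast this
  have hle : ∑ z ∈ Z, ((S.filter (fun u => ¬ G.Adj u z)).card : ℝ) ≤ ∑ z ∈ Z, (τ * S.card) :=
    Finset.sum_le_sum fun z _ => (nb z).trans key
  rw [hsw] at hsum
  have := hsum.trans_le hle
  simp only [Finset.sum_const, nsmul_eq_mul] at this
  nlinarith

open Classical in
lemma dom_tri {n : ℕ} {G : SimpleGraph (Fin n)} {p : ℝ} {δ τ : ℝ} (h : UProp G p 3 δ)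
    (hp0 : 0 < p) (hp1 : p < 1) (hτ1 : τ ≤ 1) (hqτ : 1 - p < τ)
    (Q Z : Finset (Fin n))
    (hs : 2 * δ * n + 1 + Q.card ≤ (τ - (1 - p)) * p ^ 2 * n) :
    ∃ v : Fin 3 → Fin n, (∀ j k, j ≠ k → G.Adj (v j) (v k)) ∧ (∀ j, v j ∉ Q) ∧
      ((Z.filter (fun z => ∀ j, ¬ G.Adj (v j) z)).card : ℝ) ≤ τ ^ 3 * Z.card := by
  have hτ0 : 0 < τ := by linarith
  obtain ⟨u0, -, q0, -, c0⟩ := dom_one h hp0 hp1 hτ1 hqτ ∅ Q Z (by simp) hs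
  obtain ⟨u1, -, q1, e1, c1⟩ := dom_one h hp0 hp1 hτ1 hqτ {u0} Q (Z.filter (fun z => ¬ G.Adj u0 z)) (by simp) hs
  obtain ⟨u2, -, q2, e2, c2⟩ := dom_one h hp0 hp1 hτ1 hqτ {u0, u1} Q
    ((Z.filter (fun z => ¬ G.Adj u0 z)).filter (fun z => ¬ G.Adj u1 z)) Finset.card_le_two hs
  have a01 := e1 u0 (by simp)
  have a02 := e2 u0 (by simp)
  have a12 := e2 u1 (by simp)
  refine ⟨![u0, u1, u2], ?_, ?_, ?_⟩
  · intro j k hjk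
    fin_cases j <;> fin_cases k
    · exact absurd rfl hjk
    · exact a01
    · exact a02
    · exact a01.symm
    · exact absurd rfl hjk
    · exact a12
    · exact a02.symm
    · exact a12.symm
    · exact absurd rfl hjk
  · intro j; fin_cases j; exacts [q0, q1, q2]
  · have : Z.filter (fun z => ∀ j, ¬ G.Adj ((![u0, u1, u2] : Fin 3 → Fin n) j) z) =
        ((Z.filter (fun z => ¬ G.Adj u0 z)).filter (fun z => ¬ G.Adj u1 z)).filter (fun z => ¬ G.Adj u2 z) := by
      ext z
      simp only [Finset.mem_filter, Fin.forall_fin_succ, and_assoc]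
      simp
    rw [this]
    have h1 := mul_le_mul_of_nonneg_left c0 hτ0.le
    have h2 := mul_le_mul_of_nonneg_left c1 hτ0.le
    have h3 := mul_le_mul_of_nonneg_left h1 hτ0.le
    calc _ ≤ _ := c2
      _ ≤ _ := h2
      _ ≤ _ := h3
      _ = _ := by ring

open Classical in
/-- The sequence of dominating triangles. -/
lemma dom_seq {n : ℕ} {G : SimpleGraph (Fin n)} {p : ℝ} {δ τ : ℝ} (h : UProp G p 3 δ)
    (hp0 : 0 < p) (hp1 : p < 1) (hτ1 : τ ≤ 1) (hqτ : 1 - p < τ) (hn : 0 < n) (K : ℕ)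
    (hs : 2 * δ * n + 1 + 3 * K ≤ (τ - (1 - p)) * p ^ 2 * n) :
    ∀ m, m ≤ K → ∃ v : ℕ → Fin 3 → Fin n,
      (∀ i, 1 ≤ i → i ≤ m → ∀ j k, j ≠ k → G.Adj (v i j) (v i k)) ∧
      (∀ i, 1 ≤ i → i ≤ m → ∀ i', 1 ≤ i' → i' ≤ m → i ≠ i' → ∀ j k, v i j ≠ v i' k) ∧
      (∀ i, i ≤ m → ((Finset.univ.filter (fun z => ∀ i', 1 ≤ i' → i' ≤ i → ∀ j, ¬ G.Adj (v i' j) z)).card : ℝ)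
        ≤ (τ ^ 3) ^ i * n) := by
  intro m
  induction m with
  | zero =>
    intro _
    refine ⟨fun _ _ => ⟨0, hn⟩, fun i h1 h2 => by omega, fun i h1 h2 => by omega, ?_⟩
    intro i hi
    obtain rfl : i = 0 := by omega
    rw [pow_zero, one_mul]
    have hcard : ∀ F : Finset (Fin n), (F.card : ℝ) ≤ n := fun F => by
      have := Finset.card_le_univ F
      rw [Fintype.card_fin] at this
      exact_mod_cast this
    exact hcard _
  | succ m ih =>
    intro hm
    obtain ⟨v, t1, t2, t3⟩ := ih (by omega)
    set Q : Finset (Fin n) := (Finset.Icc 1 m ×ˢ (Finset.univ : Finset (Fin 3))).image (fun x => v x.1 x.2) with hQ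
    have cQ : Q.card ≤ 3 * K := by
      refine Finset.card_image_le.trans ?_
      simp; omega
    have cQ' : (Q.card : ℝ) ≤ 3 * K := by exact_mod_cast cQ
    obtain ⟨w, w1, w2, w3⟩ := dom_tri h hp0 hp1 hτ1 hqτ Q
      (Finset.univ.filter (fun z => ∀ i', 1 ≤ i' → i' ≤ m → ∀ j, ¬ G.Adj (v i' j) z)) (by linarith)
    have wQ : ∀ i, 1 ≤ i → i ≤ m → ∀ j k, v i j ≠ w k := by
      intro i h1 h2 j k e
      apply w2 k
      rw [← e, hQ, Finset.mem_image]
      exact ⟨(i, j), by simp [h1, h2], rfl⟩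
    set v' := Function.update v (m + 1) w with hv'
    have vs : v' (m + 1) = w := Function.update_self ..
    have vo : ∀ i, i ≤ m → v' i = v i := fun i hi => Function.update_of_ne (by omega) ..
    refine ⟨v', ?_, ?_, ?_⟩
    · intro i h1 h2 j k hjk
      rcases Nat.lt_or_ge m i with h3 | h3
      · obtain rfl : i = m + 1 := by omega
        rw [vs]; exact w1 j k hjk
      · rw [vo i h3]; exact t1 i h1 h3 j k hjk
    · intro i h1 h2 i' h1' h2' hne j k
      rcases Nat.lt_or_ge m i with h3 | h3
      · obtain rfl : i = m + 1 := by omega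
        rw [vs, vo i' (by omega)]
        exact (wQ i' h1' (by omega) k j).symm
      · rcases Nat.lt_or_ge m i' with h4 | h4
        · obtain rfl : i' = m + 1 := by omega
          rw [vs, vo i h3]
          exact (wQ i h1 h3 j k)
        · rw [vo i h3, vo i' h4]; exact t2 i h1 h3 i' h1' h4 hne j k
    · intro i hi
      rcases Nat.lt_or_ge m i with h3 | h3
      · obtain rfl : i = m + 1 := by omega
        have e : (Finset.univ.filter (fun z => ∀ i', 1 ≤ i' → i' ≤ m + 1 → ∀ j, ¬ G.Adj (v' i' j) z)) =
          (Finset.univ.filter (fun z => ∀ i', 1 ≤ i' → i' ≤ m → ∀ j, ¬ G.Adj (v i' j) z)).filter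
            (fun z => ∀ j, ¬ G.Adj (w j) z) := by
          ext z
          simp only [Finset.mem_filter, Finset.mem_univ, true_and]
          constructor
          · intro hz
            refine ⟨fun i' a b j => ?_, fun j => ?_⟩
            · rw [← vo i' b]; exact hz i' a (by omega) j
            · rw [← vs]; exact hz (m + 1) (by omega) le_rfl j
          · rintro ⟨hz1, hz2⟩ i' a b j
            rcases Nat.lt_or_ge m i' with h4 | h4
            · obtain rfl : i' = m + 1 := by omega
              rw [vs]; exact hz2 j
            · rw [vo i' h4]; exact hz1 i' a h4 j
        rw [e]
        have hτ0 : 0 < τ := by linarith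
        have h5 := t3 m le_rfl
        have h6 := mul_le_mul_of_nonneg_left h5 (by positivity : 0 ≤ τ ^ 3)
        calc _ ≤ _ := w3
          _ ≤ _ := h6
          _ = _ := by ring
      · refine le_trans (le_of_eq ?_) (t3 i h3)
        congr 2
        ext z
        simp only [Finset.mem_filter, Finset.mem_univ, true_and]
        constructor
        · intro hz i' a b j
          rw [← vo i' (by omega)]; exact hz i' a b j
        · intro hz i' a b j
          rw [vo i' (by omega)]; exact hz i' a b j

/-- balanced colouring -/
lemma balanced {α : Type*} [DecidableEq α] (pat : α → Finset (Fin 3)) (D : Finset α)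
    (hpat : ∀ x ∈ D, (pat x).Nonempty) :
    ∃ c : α → Fin 3, (∀ x ∈ D, c x ∈ pat x) ∧
      ∀ P : Finset (Fin 3), ∀ j ∈ P, (D.filter (fun x => pat x = P ∧ c x = j)).card * P.card ≤
        (D.filter (fun x => pat x = P)).card + P.card := by
  induction D using Finset.induction_on with
  | empty => exact ⟨fun _ => 0, by simp, by simp⟩
  | insert x D hx ih =>
    obtain ⟨c, hc, hb⟩ := ih (fun y hy => hpat y (Finset.mem_insert_of_mem hy))
    obtain ⟨j0, hj0, hmin⟩ := (pat x).exists_min_image (fun j => (D.filter (fun y => pat y = pat x ∧ c y = j)).card)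
      (hpat x (Finset.mem_insert_self x D))
    have hsum : ∑ j ∈ pat x, (D.filter (fun y => pat y = pat x ∧ c y = j)).card = (D.filter (fun y => pat y = pat x)).card := by
      rw [Finset.card_eq_sum_card_fiberwise (f := c) (t := pat x)]
      · refine Finset.sum_congr rfl fun j _ => ?_
        rw [Finset.filter_filter]
      · intro y hy
        simp only [Finset.coe_filter, Set.mem_ofPred_eq] at hy
        have := hc y hy.1
        rw [hy.2] at this
        exact this
    have hle : (D.filter (fun y => pat y = pat x ∧ c y = j0)).card * (pat x).card ≤ (D.filter (fun y => pat y = pat x)).card := by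
      rw [← hsum, mul_comm, ← smul_eq_mul]
      exact Finset.card_nsmul_le_sum _ _ _ hmin
    refine ⟨Function.update c x j0, ?_, ?_⟩
    · intro y hy
      rcases Finset.mem_insert.1 hy with rfl | hy
      · rw [Function.update_self]; exact hj0
      · rw [Function.update_of_ne (show y ≠ x from fun e => hx (e ▸ hy))]; exact hc y hy
    · intro P j hj
      have e1 : D.filter (fun y => pat y = P ∧ Function.update c x j0 y = j) = D.filter (fun y => pat y = P ∧ c y = j) := by
        apply Finset.filter_congr
        intro y hy
        rw [Function.update_of_ne (show y ≠ x from fun e => hx (e ▸ hy))]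
      rw [Finset.filter_insert, Finset.filter_insert, e1]
      have hb1 := hb P j hj
      rw [Function.update_self]
      by_cases h1 : pat x = P
      · subst h1
        have nx : x ∉ D.filter (fun y => pat y = pat x) := fun h => hx (Finset.mem_filter.1 h).1
        rw [if_pos rfl, Finset.card_insert_of_notMem nx]
        by_cases h2 : j0 = j
        · subst h2
          rw [if_pos ⟨rfl, rfl⟩, Finset.card_insert_of_notMem (fun h => hx (Finset.mem_filter.1 h).1)]
          nlinarith
        · rw [if_neg (fun h => h2 h.2)]; omega
      · rw [if_neg (fun h => h1 h.1), if_neg h1]; exact hb1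

/-- All triangle vertices up to level `m`. -/
def Rall {n : ℕ} (v : ℕ → Fin 3 → Fin n) (m : ℕ) : Finset (Fin n) :=
  (Finset.Icc 1 m ×ˢ (Finset.univ : Finset (Fin 3))).image (fun x => v x.1 x.2)

lemma mem_Rall {n : ℕ} (v : ℕ → Fin 3 → Fin n) (m : ℕ) (z : Fin n) :
    z ∈ Rall v m ↔ ∃ i, 1 ≤ i ∧ i ≤ m ∧ ∃ j, z = v i j := by
  simp only [Rall, Finset.mem_image, Finset.mem_product, Finset.mem_Icc, Finset.mem_univ, and_true, Prod.exists]
  constructor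
  · rintro ⟨a, b, ⟨h1, h2⟩, rfl⟩; exact ⟨a, h1, h2, b, rfl⟩
  · rintro ⟨a, h1, h2, b, rfl⟩; exact ⟨a, b, ⟨h1, h2⟩, rfl⟩

open Classical in
/-- Vertices outside all triangles, not dominated by the first `i-1` triangles. -/
noncomputable def Zs {n : ℕ} (G : SimpleGraph (Fin n)) (v : ℕ → Fin 3 → Fin n) (K i : ℕ) : Finset (Fin n) :=
  Finset.univ.filter (fun z => z ∉ Rall v K ∧ ∀ i', 1 ≤ i' → i' < i → ∀ j, ¬ G.Adj (v i' j) z)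

lemma mem_Zs {n : ℕ} (G : SimpleGraph (Fin n)) (v : ℕ → Fin 3 → Fin n) (K i : ℕ) (z : Fin n) :
    z ∈ Zs G v K i ↔ z ∉ Rall v K ∧ ∀ i', 1 ≤ i' → i' < i → ∀ j, ¬ G.Adj (v i' j) z := by
  simp [Zs]

structure Setup {n : ℕ} (G : SimpleGraph (Fin n)) (p δ : ℝ) (K k0 h : ℕ) (v : ℕ → Fin 3 → Fin n) : Prop where
  hp0 : 0 < p
  hp1 : p < 1
  hδ : 0 ≤ δ
  tri : ∀ i, 1 ≤ i → i ≤ K → ∀ j k, j ≠ k → G.Adj (v i j) (v i k)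
  dis : ∀ i, 1 ≤ i → i ≤ K → ∀ i', 1 ≤ i' → i' ≤ K → i ≠ i' → ∀ j k, v i j ≠ v i' k
  U : UProp G p k0 δ
  hole : ∀ A B : Finset (Fin n), Disjoint A B → h ≤ A.card → h ≤ B.card → ∃ a ∈ A, ∃ b ∈ B, G.Adj a b

namespace Setup
variable {n : ℕ} {G : SimpleGraph (Fin n)} {p δ : ℝ} {K k0 h : ℕ} {v : ℕ → Fin 3 → Fin n}

lemma inj (S : Setup G p δ K k0 h v) {i i' : ℕ} {j j' : Fin 3} (h1 : 1 ≤ i) (h2 : i ≤ K) (h1' : 1 ≤ i') (h2' : i' ≤ K)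
    (e : v i j = v i' j') : i = i' ∧ j = j' := by
  by_cases hi : i = i'
  · subst hi
    refine ⟨rfl, ?_⟩
    by_contra hj
    exact (S.tri i h1 h2 j j' hj).ne e
  · exact absurd e (S.dis i h1 h2 i' h1' h2' hi j j')

lemma card_Rall (S : Setup G p δ K k0 h v) (m : ℕ) (hm : m ≤ K) : (Rall v m).card = 3 * m := by
  rw [Rall, Finset.card_image_of_injOn]
  · simp; omega
  · rintro ⟨a, b⟩ ha ⟨a', b'⟩ ha' e
    simp only [Finset.coe_product, Set.mem_prod, Finset.coe_Icc, Set.mem_Icc] at ha ha'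
    have := S.inj ha.1.1 (ha.1.2.trans hm) ha'.1.1 (ha'.1.2.trans hm) e
    exact Prod.ext this.1 this.2

lemma Zs_ge (S : Setup G p δ K k0 h v) (i : ℕ) (h1 : 1 ≤ i) (h2 : i ≤ K + 1) (hk : 3 * (i - 1) ≤ k0) :
    (((1 - p) ^ 3) ^ (i - 1) - δ) * n - 3 * K ≤ ((Zs G v K i).card : ℝ) := by
  have c := S.card_Rall (i - 1) (by omega)
  have c' := S.card_Rall K le_rfl
  have a := S.U.ge (Rall v (i - 1)) ∅ (by omega) (by simp)
  have b : cnt G (Rall v (i - 1)) ∅ ≤ (Zs G v K i).card + (Rall v K).card := by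
    apply cnt_le_card
    intro z hz ha
    by_cases hR : z ∈ Rall v K
    · exact Or.inr hR
    · left; rw [mem_Zs]
      refine ⟨hR, fun i' a1 a2 j hj => ?_⟩
      have := (ha (v i' j) ((mem_Rall _ _ _).2 ⟨i', a1, by omega, j, rfl⟩)).1 hj
      simp at this
  rw [c'] at b
  have b' : (cnt G (Rall v (i - 1)) ∅ : ℝ) ≤ (Zs G v K i).card + 3 * K := by exact_mod_cast b
  rw [c] at a
  simp only [Finset.card_empty, pow_zero, one_mul, Nat.sub_zero, pow_mul] at a
  linarith

lemma sum_pat (F : ℕ → ℝ) (j : Fin 3) :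
    ∑ P ∈ (Finset.univ : Finset (Finset (Fin 3))).filter (fun P => j ∈ P), F P.card = F 1 + 2 * F 2 + F 3 := by
  have : ∀ j : Fin 3, ((Finset.univ : Finset (Finset (Fin 3))).filter (fun P => j ∈ P)).val.map Finset.card = {1, 2, 2, 3} := by
    decide
  have e : ∑ P ∈ (Finset.univ : Finset (Finset (Fin 3))).filter (fun P => j ∈ P), F P.card =
      ((((Finset.univ : Finset (Finset (Fin 3))).filter (fun P => j ∈ P)).val.map Finset.card).map F).sum := by
    rw [Multiset.map_map]; rfl
  rw [e, this j]
  simp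
  ring

lemma split (S : Setup G p δ K k0 h v) (i : ℕ) (h1 : 1 ≤ i) (h2 : i ≤ K) (D : Finset (Fin n))
    (hD : D ⊆ Zs G v K i) (hdom : ∀ x ∈ D, ∃ j, G.Adj (v i j) x) :
    ∃ c : Fin n → Fin 3, (∀ x ∈ D, G.Adj (v i (c x)) x) ∧
      (3 * i ≤ k0 → ∀ j, ((D.filter (fun x => c x = j)).card : ℝ) ≤
        ((1 - (1 - p) ^ 3) / 3 * ((1 - p) ^ 3) ^ (i - 1) + 4 * δ) * n + 4) := by
  classical
  let pat : Fin n → Finset (Fin 3) := fun x => Finset.univ.filter (fun j => G.Adj (v i j) x)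
  have mp : ∀ x j, j ∈ pat x ↔ G.Adj (v i j) x := fun x j => by simp [pat]
  obtain ⟨c, hc, hb⟩ := balanced pat D (fun x hx => by
    obtain ⟨j, hj⟩ := hdom x hx
    exact ⟨j, (mp x j).2 hj⟩)
  refine ⟨c, fun x hx => (mp x _).1 (hc x hx), fun hk j => ?_⟩
  have hp0 := S.hp0
  have hp1 := S.hp1
  have hδ := S.hδ
  have hn : (0:ℝ) ≤ n := Nat.cast_nonneg n
  set s := ((1 - p) ^ 3) ^ (i - 1) with hs
  have cR := S.card_Rall i h2
  have patb : ∀ P : Finset (Fin 3), P.Nonempty → ((D.filter (fun x => pat x = P)).card : ℝ) ≤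
      (p ^ P.card * (1 - p) ^ (3 - P.card) * s + δ) * n := by
    intro P hP
    have vinj : Function.Injective (v i) := fun a b e => (S.inj h1 h2 h1 h2 e).2
    have cP : (P.image (v i)).card = P.card := Finset.card_image_of_injective _ vinj
    have P3 : P.card ≤ 3 := by simpa using Finset.card_le_univ P
    have a := S.U.le (Rall v i) (P.image (v i)) (by omega) (by
      intro z hz
      obtain ⟨j, _, rfl⟩ := Finset.mem_image.1 hz
      exact (mem_Rall _ _ _).2 ⟨i, h1, le_rfl, j, rfl⟩)
    have b : (D.filter (fun x => pat x = P)).card ≤ cnt G (Rall v i) (P.image (v i)) := by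
      apply card_le_cnt
      intro z hz
      rw [Finset.mem_filter] at hz
      have hz1 := (mem_Zs _ _ _ _ _).1 (hD hz.1)
      refine ⟨fun hR => hz1.1 ?_, ?_⟩
      · obtain ⟨i', a1, a2, j, rfl⟩ := (mem_Rall _ _ _).1 hR
        exact (mem_Rall _ _ _).2 ⟨i', a1, a2.trans h2, j, rfl⟩
      · intro t ht
        obtain ⟨i', a1, a2, j, rfl⟩ := (mem_Rall _ _ _).1 ht
        rcases Nat.lt_or_ge i' i with h3 | h3
        · constructor
          · exact fun h4 => absurd h4 (hz1.2 i' a1 h3 j)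
          · intro h4
            obtain ⟨j', _, e⟩ := Finset.mem_image.1 h4
            have := (S.inj h1 h2 a1 (a2.trans h2) e).1
            omega
        · obtain rfl : i' = i := by omega
          rw [← mp, hz.2]
          constructor
          · exact fun h4 => Finset.mem_image_of_mem _ h4
          · intro h4
            obtain ⟨j', h5, e⟩ := Finset.mem_image.1 h4
            rwa [← vinj e]
    rw [cP, cR] at a
    have e : 3 * i - P.card = (3 - P.card) + 3 * (i - 1) := by omega
    rw [e, pow_add, pow_mul] at a
    have b' : ((D.filter (fun x => pat x = P)).card : ℝ) ≤ cnt G (Rall v i) (P.image (v i)) := by exact_mod_cast b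
    refine b'.trans (a.trans (le_of_eq ?_))
    rw [hs]; ring
  have fib : (D.filter (fun x => c x = j)).card = ∑ P ∈ (Finset.univ : Finset (Finset (Fin 3))).filter (fun P => j ∈ P),
      (D.filter (fun x => pat x = P ∧ c x = j)).card := by
    rw [Finset.card_eq_sum_card_fiberwise (f := pat) (t := Finset.univ.filter (fun P => j ∈ P))]
    · refine Finset.sum_congr rfl fun P _ => ?_
      rw [Finset.filter_filter]
      congr 1
      apply Finset.filter_congr
      intro x _; tauto
    · intro x hx
      simp only [Finset.coe_filter, Set.mem_ofPred_eq, Finset.mem_univ, true_and] at hx ⊢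
      rw [← hx.2]; exact hc x hx.1
  let F : ℕ → ℝ := fun m => (p ^ m * (1 - p) ^ (3 - m) * s + δ) * n / m + 1
  have bnd : ((D.filter (fun x => c x = j)).card : ℝ) ≤ F 1 + 2 * F 2 + F 3 := by
    rw [← sum_pat F j, fib, Nat.cast_sum]
    refine Finset.sum_le_sum fun P hP => ?_
    simp only [Finset.mem_filter, Finset.mem_univ, true_and] at hP
    have b1 := hb P j hP
    have b2 := patb P ⟨j, hP⟩
    have cp : (0:ℝ) < P.card := by exact_mod_cast Finset.card_pos.2 ⟨j, hP⟩
    have b1' : ((D.filter (fun x => pat x = P ∧ c x = j)).card : ℝ) * P.card ≤ (D.filter (fun x => pat x = P)).card + P.card := by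
      exact_mod_cast b1
    have : (D.filter (fun x => pat x = P ∧ c x = j)).card ≤ ((D.filter (fun x => pat x = P)).card + P.card : ℝ) / P.card := by
      rw [le_div_iff₀ cp]; exact b1'
    refine this.trans ?_
    rw [add_div, div_self cp.ne']
    simp only [F]
    gcongr
  refine bnd.trans ?_
  simp only [F]
  norm_num
  have h0 : 0 ≤ δ * n := mul_nonneg hδ hn
  nlinarith

end Setup

namespace Setup
variable {n : ℕ} {G : SimpleGraph (Fin n)} {p δ : ℝ} {K k0 h : ℕ} {v : ℕ → Fin 3 → Fin n}

lemma levelStep (S : Setup G p δ K k0 h v) (hk : 3 ≤ k0) (i : ℕ) (hi2 : 2 ≤ i) (hiK : i ≤ K)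
    (X : Finset (Fin n)) (A : SimpleGraph (Fin n)) (hA : A ≤ G)
    (hXZ : Zs G v K (i + 1) ⊆ X) (hXR : ∀ m, 1 ≤ m → m < i + 1 → ∀ j, v m j ∉ X)
    (hXR' : ∀ m, i + 1 ≤ m → m ≤ K → ∀ j, v m j ∈ X) :
    ∃ D0 D1 D2 : ℕ, D0 + D1 + D2 ≤ (Zs G v K i).card ∧ (Zs G v K i).card ≤ X.card + D0 + D1 + D2 ∧
      (3 * i ≤ k0 →
        (D0 : ℝ) ≤ ((1 - (1 - p) ^ 3) / 3 * ((1 - p) ^ 3) ^ (i - 1) + 4 * δ) * n + 4 ∧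
        (D1 : ℝ) ≤ ((1 - (1 - p) ^ 3) / 3 * ((1 - p) ^ 3) ^ (i - 1) + 4 * δ) * n + 4 ∧
        (D2 : ℝ) ≤ ((1 - (1 - p) ^ 3) / 3 * ((1 - p) ^ 3) ^ (i - 1) + 4 * δ) * n + 4) ∧
      ∀ M : ℕ, (M : ℝ) ≤ (p ^ 3 - δ) * n - 3 * K - (X.card - (Zs G v K (i + 1)).card) →
        (6 * X.card + D0 + D1 + D2 ≤ M ∨
          (2 * X.card - D0) + (2 * X.card - D1) + (2 * X.card - D2) + 12 * h + 3 ≤ M) →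
        ∃ (S' : Finset (Fin n)) (A' : SimpleGraph (Fin n)), A' ≤ G ∧
          (∀ x ∈ X, ∀ y ∈ X, (A.Adj x y ↔ A'.Adj x y)) ∧
          FStep A' (S' : Set (Fin n)) (X : Set (Fin n)) ∧ X ⊆ S' ∧ Zs G v K i ⊆ S' ∧
          (∀ m, 1 ≤ m → m < i → ∀ j, v m j ∉ S') ∧ (∀ m, i ≤ m → m ≤ K → ∀ j, v m j ∈ S') ∧
          Even (S'.card + X.card + 1) ∧
          S'.card ≤ 7 * X.card + 3 + 2 * (D0 + D1 + D2) ∧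
          S'.card ≤ X.card + 3 + (D0 + (2 * X.card - D0)) + (D1 + (2 * X.card - D1))
            + (D2 + (2 * X.card - D2)) + 12 * h + 3 := by
  classical
  set Z := Zs G v K i with hZ
  set DD := Z \ X with hDD
  have DDZ : DD ⊆ Z := Finset.sdiff_subset
  obtain ⟨c, hc, hcb⟩ := S.split i (by omega) hiK DD DDZ (by
    intro x hx
    by_contra hcon
    push Not at hcon
    rw [hDD, Finset.mem_sdiff] at hx
    apply hx.2
    apply hXZ
    have hz := (mem_Zs _ _ _ _ _).1 hx.1
    rw [mem_Zs]
    refine ⟨hz.1, fun i' a b j => ?_⟩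
    rcases Nat.lt_or_ge i' i with h3 | h3
    · exact hz.2 i' a h3 j
    · obtain rfl : i' = i := by omega
      exact hcon j)
  let D : Fin 3 → Finset (Fin n) := fun j => DD.filter (fun x => c x = j)
  have Dsub : ∀ j, D j ⊆ DD := fun j => Finset.filter_subset _ _
  have Dmem : ∀ j x, x ∈ D j ↔ x ∈ DD ∧ c x = j := fun j x => by simp [D]
  have cDD : DD.card = (D 0).card + (D 1).card + (D 2).card := by
    rw [Finset.card_eq_sum_card_fiberwise (f := c) (t := Finset.univ) (fun x _ => by simp), Fin.sum_univ_three]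
  refine ⟨(D 0).card, (D 1).card, (D 2).card, ?_, ?_, fun h3 => ⟨hcb h3 0, hcb h3 1, hcb h3 2⟩, ?_⟩
  · rw [← cDD]; exact Finset.card_le_card DDZ
  · have := Finset.le_card_sdiff X Z
    have e : DD.card = (Z \ X).card := rfl
    omega
  intro M hM hMM
  set Q := X ∪ Rall v K ∪ DD with hQ
  set R : Finset (Fin n) := Finset.univ.image (v i) ∪ {v 1 0} with hR
  have Rmem : ∀ z ∈ R, ∃ m, 1 ≤ m ∧ m ≤ i ∧ ∃ j, z = v m j := by
    intro z hz
    simp only [hR, Finset.mem_union, Finset.mem_image, Finset.mem_univ, true_and, Finset.mem_singleton] at hz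
    rcases hz with ⟨j, rfl⟩ | rfl
    · exact ⟨i, by omega, le_rfl, j, rfl⟩
    · exact ⟨1, le_rfl, by omega, 0, rfl⟩
  have RRall : R ⊆ Rall v K := by
    intro z hz
    obtain ⟨m, a, b, j, rfl⟩ := Rmem z hz
    exact (mem_Rall _ _ _).2 ⟨m, a, b.trans hiK, j, rfl⟩
  have vR : ∀ j, v i j ∈ R := fun j => by simp [hR]
  have v1R : v 1 0 ∈ R := by simp [hR]
  have XR : Disjoint X R := by
    rw [Finset.disjoint_right]; intro z hz
    obtain ⟨m, a, b, j, rfl⟩ := Rmem z hz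
    exact hXR m a (by omega) j
  have ZR : ∀ z ∈ Z, z ∉ Rall v K := fun z hz => ((mem_Zs _ _ _ _ _).1 hz).1
  have avail : ∀ j, ∀ x, x ∉ R → M ≤ (sea G (v i j) Q x).card := by
    intro j x hx
    have hn1 : v i j ≠ v 1 0 := S.dis i (by omega) hiK 1 le_rfl (by omega) (by omega) j 0
    have hn2 : x ≠ v i j := fun e => hx (e ▸ vR j)
    have hn3 : x ≠ v 1 0 := fun e => hx (e ▸ v1R)
    set T : Finset (Fin n) := {x, v i j, v 1 0} with hT
    have cT : T.card = 3 := Finset.card_eq_three.2 ⟨x, v i j, v 1 0, hn2, hn3, hn1, rfl⟩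
    have lo := S.U.ge T T (by omega) subset_rfl
    rw [Nat.sub_self, pow_zero, mul_one, cT] at lo
    have up : cnt G T T ≤ (sea G (v i j) Q x).card + (Rall v K ∪ (X \ Zs G v K (i + 1))).card := by
      apply cnt_le_card
      intro z hz ha
      have a1 := (ha x (by simp [hT])).2 (by simp [hT])
      have a2 := (ha (v i j) (by simp [hT])).2 (by simp [hT])
      have a3 := (ha (v 1 0) (by simp [hT])).2 (by simp [hT])
      by_cases hzQ : z ∈ Q
      · right
        simp only [hQ, Finset.mem_union] at hzQ
        rw [Finset.mem_union, Finset.mem_sdiff]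
        rcases hzQ with (h1 | h1) | h1
        · right; refine ⟨h1, fun h2 => ?_⟩
          exact ((mem_Zs _ _ _ _ _).1 h2).2 1 le_rfl (by omega) 0 a3
        · exact Or.inl h1
        · exact absurd a3 (((mem_Zs _ _ _ _ _).1 (DDZ h1)).2 1 le_rfl (by omega) 0)
      · left; rw [mem_sea]; exact ⟨a1, a2, hzQ⟩
    have c1 := Finset.card_union_le (Rall v K) (X \ Zs G v K (i + 1))
    rw [S.card_Rall K le_rfl, Finset.card_sdiff_of_subset hXZ] at c1
    have c2 := Finset.card_le_card hXZ
    have : (cnt G T T : ℝ) ≤ (sea G (v i j) Q x).card + 3 * K + (X.card - (Zs G v K (i + 1)).card) := by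
      rw [← Nat.cast_sub c2]
      exact_mod_cast (by omega : cnt G T T ≤ (sea G (v i j) Q x).card + 3 * K + (X.card - (Zs G v K (i + 1)).card))
    have : (M : ℝ) ≤ (sea G (v i j) Q x).card := by linarith
    exact_mod_cast this
  obtain ⟨S', A', hA', hag, hst, hXS, hDS, hvS, hout, hev, b1, b2⟩ := step G A hA (v i) D X Q R h M S.hole
    (S.tri i (by omega) hiK) vR
    (fun z hz => by simp only [hQ, Finset.mem_union]; tauto)
    (fun z hz => by have := RRall hz; simp only [hQ, Finset.mem_union]; tauto)
    (fun j z hz => by have := Dsub j hz; simp only [hQ, Finset.mem_union]; tauto)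
    (fun j => by
      rw [Finset.disjoint_right]; intro z hz
      exact (Finset.mem_sdiff.1 (Dsub j hz)).2)
    XR
    (fun j => by
      rw [Finset.disjoint_left]; intro z hz hzR
      exact ZR z (DDZ (Dsub j hz)) (RRall hzR))
    (fun j k hjk => by
      rw [Finset.disjoint_left]; intro z hz hz'
      rw [Dmem] at hz hz'
      exact hjk (hz.2.symm.trans hz'.2))
    (fun j d hd => by
      rw [Dmem] at hd
      have := hc d hd.1
      rwa [hd.2] at this)
    avail hMM
  refine ⟨S', A', hA', hag, hst, hXS, ?_, ?_, ?_, hev, b1, b2⟩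
  · intro z hz
    by_cases hzX : z ∈ X
    · exact hXS hzX
    · exact hDS (c z) ((Dmem _ _).2 ⟨Finset.mem_sdiff.2 ⟨hz, hzX⟩, rfl⟩)
  · intro m a b j hm
    have mR : v m j ∈ Rall v K := (mem_Rall _ _ _).2 ⟨m, a, by omega, j, rfl⟩
    rcases hout _ hm with h1 | ⟨j', h1⟩ | ⟨j', h1⟩ | h1
    · exact hXR m a (by omega) j h1
    · have := (S.inj a (by omega) (by omega) hiK h1).1
      omega
    · exact ZR _ (DDZ (Dsub j' h1)) mR
    · exact h1 (by simp only [hQ, Finset.mem_union]; tauto)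
  · intro m a b j
    rcases Nat.lt_or_ge i m with h3 | h3
    · exact hXS (hXR' m (by omega) b j)
    · obtain rfl : m = i := by omega
      exact hvS j

end Setup

lemma backward {α : Type*} (G : SimpleGraph α) (K : ℕ) (LP : ℕ → Finset α → Prop) (base : LP (K + 1) ∅)
    (st : ∀ i, 2 ≤ i → i ≤ K → ∀ (X : Finset α) (A : SimpleGraph α), A ≤ G → LP (i + 1) X →
      ∃ (S : Finset α) (A' : SimpleGraph α), A' ≤ G ∧ (∀ x ∈ X, ∀ y ∈ X, (A.Adj x y ↔ A'.Adj x y)) ∧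
        FStep A' (S : Set α) (X : Set α) ∧ X ⊆ S ∧ LP i S) :
    ∀ m i, i + m = K + 1 → 2 ≤ i → ∃ (A : SimpleGraph α) (V : ℕ → Finset α), A ≤ G ∧ V (K + 1) = ∅ ∧
      (∀ k, i ≤ k → k ≤ K → FStep A (V k : Set α) (V (k + 1) : Set α)) ∧
      (∀ k, i ≤ k → k ≤ K + 1 → V k ⊆ V i ∧ LP k (V k)) := by
  intro m
  induction m with
  | zero =>
    intro i hi h2
    refine ⟨⊥, fun _ => ∅, bot_le, rfl, fun k h1 h2 => by omega, fun k h1 h2 => ⟨subset_rfl, ?_⟩⟩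
    obtain rfl : k = K + 1 := by omega
    exact base
  | succ m ih =>
    intro i hi h2
    obtain ⟨A, V, hA, hV, h3, h4⟩ := ih (i + 1) (by omega) (by omega)
    obtain ⟨S, A', hA', hag, hst, hXS, hLP⟩ := st i h2 (by omega) (V (i + 1)) A hA (h4 (i + 1) le_rfl (by omega)).2
    set V' := Function.update V i S with hV'
    have vs : V' i = S := Function.update_self ..
    have vo : ∀ k, i < k → V' k = V k := fun k hk => Function.update_of_ne (by omega) ..
    refine ⟨A', V', hA', ?_, ?_, ?_⟩
    · rw [vo _ (by omega)]; exact hV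
    · intro k a b
      rcases Nat.lt_or_ge i k with h5 | h5
      · rw [vo k h5, vo (k + 1) (by omega)]
        have sub := (h4 k h5 (by omega)).1
        exact (h3 k h5 b).congr (fun x hx y hy => hag x (sub hx) y (sub hy))
      · obtain rfl : k = i := by omega
        rw [vs, vo _ (by omega)]; exact hst
    · intro k a b
      rw [vs]
      rcases Nat.lt_or_ge i k with h5 | h5
      · rw [vo k h5]
        exact ⟨(h4 k h5 b).1.trans hXS, (h4 k h5 b).2⟩
      · obtain rfl : k = i := by omega
        rw [vs]; exact ⟨subset_rfl, hLP⟩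

/-- per-level invariant -/
def LPr {n : ℕ} (G : SimpleGraph (Fin n)) (v : ℕ → Fin 3 → Fin n) (K L : ℕ) (s ρ lam C1 κ : ℝ) (k : ℕ) (S : Finset (Fin n)) : Prop :=
  Zs G v K k ⊆ S ∧ (∀ m, 1 ≤ m → m < k → ∀ j, v m j ∉ S) ∧ (∀ m, k ≤ m → m ≤ K → ∀ j, v m j ∈ S) ∧
  Even (S.card + (K + 1 - k)) ∧ (L + 1 ≤ k → (S.card : ℝ) ≤ C1 * ρ ^ (k - 1) * n) ∧
  (S.card : ℝ) ≤ (s ^ (k - 1) + κ * lam ^ (k - 1)) * n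

lemma max_aux (x D : ℕ) (d : ℝ) (hD : (D : ℝ) ≤ d) : ((D + (2 * x - D) : ℕ) : ℝ) ≤ max (2 * (x:ℝ)) d := by
  rcases le_total D (2 * x) with h | h
  · rw [Nat.add_sub_cancel' h]; push_cast; exact le_max_left _ _
  · rw [Nat.sub_eq_zero_of_le h, Nat.add_zero]; exact hD.trans (le_max_right _ _)

namespace Setup
variable {n : ℕ} {G : SimpleGraph (Fin n)} {p δ : ℝ} {K k0 h : ℕ} {v : ℕ → Fin 3 → Fin n}

set_option maxHeartbeats 1000000 in
lemma mainStep (S : Setup G p δ K k0 h v) (L : ℕ) (s ρ lam C1 κ : ℝ) (hs : s = (1 - p) ^ 3)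
    (hL : 1 ≤ L) (hk : 3 * L + 3 ≤ k0) (hs0 : 0 < s) (hsρ : s < ρ) (hρl : ρ < lam) (hl7 : 7 * lam < 1)
    (hC1 : 1 ≤ C1) (hC : 2 * ρ ^ 2 + 3 ≤ C1 * (1 - 7 * ρ) * ρ ^ 2) (hκ0 : 0 < κ) (hκp : 32 * κ ≤ p ^ 3)
    (hκL : C1 * ρ ^ L ≤ κ * lam ^ L)
    (hE : 15 * δ * n + 12 * h + 9 * K + 40 ≤ p ^ 3 / 2 * n)
    (hE2 : 12 * δ * n + 12 * h + 18 ≤ (1 - 7 * lam) * κ * lam ^ L * n)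
    (hρK : ρ ^ 2 ≤ ρ ^ (K - 1) * n)
    (hZ : ∀ i, 1 ≤ i → i ≤ K + 1 → ((Zs G v K i).card : ℝ) ≤ ρ ^ (i - 1) * n)
    (i : ℕ) (hi2 : 2 ≤ i) (hiK : i ≤ K) (X : Finset (Fin n)) (A : SimpleGraph (Fin n)) (hA : A ≤ G)
    (hX : LPr G v K L s ρ lam C1 κ (i + 1) X) :
    ∃ (S' : Finset (Fin n)) (A' : SimpleGraph (Fin n)), A' ≤ G ∧ (∀ x ∈ X, ∀ y ∈ X, (A.Adj x y ↔ A'.Adj x y)) ∧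
        FStep A' (S' : Set (Fin n)) (X : Set (Fin n)) ∧ X ⊆ S' ∧ LPr G v K L s ρ lam C1 κ i S' := by
  obtain ⟨x1, x2, x3, x4, x5, x6⟩ := hX
  obtain ⟨D0, D1, D2, d1, d2, d3, d4⟩ := S.levelStep (by omega) i hi2 hiK X A hA x1 x2 x3
  have hn : (0:ℝ) ≤ n := Nat.cast_nonneg n
  have hδ := S.hδ
  have hp0 := S.hp0
  have hρ0 : 0 < ρ := by linarith
  have hl0 : 0 < lam := by linarith
  have h0 : 0 ≤ δ * n := mul_nonneg hδ hn
  obtain ⟨t, rfl⟩ : ∃ t, i = t + 1 := ⟨i - 1, by omega⟩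
  simp only [Nat.add_sub_cancel] at x5 x6 d3 ⊢
  have d1' : (D0 + D1 + D2 : ℝ) ≤ (Zs G v K (t + 1)).card := by exact_mod_cast d1
  have d2' : ((Zs G v K (t + 1)).card : ℝ) ≤ X.card + D0 + D1 + D2 := by exact_mod_cast d2
  have hZi := hZ (t + 1) (by omega) (by omega)
  simp only [Nat.add_sub_cancel] at hZi
  have hKn : (0:ℝ) ≤ K := Nat.cast_nonneg _
  have hhn : (0:ℝ) ≤ h := Nat.cast_nonneg _
  have hlL1 : lam ^ L ≤ 1 := pow_le_one₀ hl0.le (by linarith)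
  rcases Nat.lt_or_ge L (t + 1) with hc | hc
  · -- crude
    have x5' := x5 (by omega)
    have r1 : ρ ^ t ≤ ρ ^ L := pow_le_pow_of_le_one hρ0.le (by linarith) (by omega)
    have r2 : ρ ^ (t + 1) ≤ ρ ^ L := pow_le_pow_of_le_one hρ0.le (by linarith) (by omega)
    have k1 : C1 * ρ ^ L ≤ κ := hκL.trans (by nlinarith)
    have k2 : C1 * ρ ^ (t + 1) ≤ κ := (mul_le_mul_of_nonneg_left r2 (by linarith)).trans k1
    have k3 : ρ ^ t ≤ κ := r1.trans (le_trans (by nlinarith [pow_pos hρ0 L]) k1)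
    have k2n : C1 * ρ ^ (t + 1) * n ≤ κ * n := mul_le_mul_of_nonneg_right k2 hn
    have k3n : ρ ^ t * n ≤ κ * n := mul_le_mul_of_nonneg_right k3 hn
    have k4n : 32 * κ * n ≤ p ^ 3 * n := mul_le_mul_of_nonneg_right hκp hn
    have zn : (0:ℝ) ≤ (Zs G v K (t + 1 + 1)).card := Nat.cast_nonneg _
    have kn : 0 ≤ κ * n := mul_nonneg hκ0.le hn
    obtain ⟨S', A', a1, a2, a3, a4, a5, a6, a7, a8, a9, a10⟩ := d4 (6 * X.card + D0 + D1 + D2) (by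
      push_cast
      nlinarith) (Or.inl le_rfl)
    have b : (S'.card : ℝ) ≤ C1 * ρ ^ t * n := by
      have a9' : (S'.card : ℝ) ≤ 7 * X.card + 3 + 2 * (D0 + D1 + D2) := by exact_mod_cast a9
      have e : ρ ^ (t + 1) = ρ * ρ ^ t := by ring
      rw [e] at x5'
      have r3 : ρ ^ (K - 1) ≤ ρ ^ t := pow_le_pow_of_le_one hρ0.le (by linarith) (by omega)
      have r4 : ρ ^ 2 ≤ ρ ^ t * n := hρK.trans (mul_le_mul_of_nonneg_right r3 hn)
      have r5 : 3 ≤ (C1 * (1 - 7 * ρ) - 2) * (ρ ^ t * n) := by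
        have q0 : 0 < ρ ^ 2 := by positivity
        have q1 : 0 ≤ C1 * (1 - 7 * ρ) - 2 := by
          by_contra hcon
          push Not at hcon
          nlinarith
        calc (3:ℝ) ≤ (C1 * (1 - 7 * ρ) - 2) * ρ ^ 2 := by linarith
          _ ≤ _ := mul_le_mul_of_nonneg_left r4 q1
      nlinarith
    refine ⟨S', A', a1, a2, a3, a4, a5, a6, a7, ?_, fun _ => ?_, ?_⟩
    · rw [Nat.even_iff] at x4 a8 ⊢; omega
    · simpa using b
    · simp only [Nat.add_sub_cancel]
      refine b.trans (mul_le_mul_of_nonneg_right ?_ hn)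
      have : C1 * ρ ^ t ≤ κ * lam ^ t := by
        obtain ⟨u, rfl⟩ : ∃ u, t = L + u := ⟨t - L, by omega⟩
        rw [pow_add, pow_add]
        have w1 : ρ ^ u ≤ lam ^ u := pow_le_pow_left₀ hρ0.le hρl.le u
        have w2 : 0 < lam ^ L := by positivity
        calc C1 * (ρ ^ L * ρ ^ u) = (C1 * ρ ^ L) * ρ ^ u := by ring
          _ ≤ (κ * lam ^ L) * lam ^ u := mul_le_mul hκL w1 (by positivity) (by positivity)
          _ = _ := by ring
      have : 0 < s ^ t := by positivity
      linarith
  · -- refined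
    obtain ⟨e0, e1, e2⟩ := d3 (by omega)
    rw [← hs] at e0 e1 e2
    have zg := S.Zs_ge (t + 1) (by omega) (by omega) (by omega)
    have zg' := S.Zs_ge (t + 1 + 1) (by omega) (by omega) (by omega)
    rw [← hs] at zg zg'
    simp only [Nat.add_sub_cancel] at zg zg'
    set d : ℝ := ((1 - s) / 3 * s ^ t + 4 * δ) * n + 4 with hd
    set B : ℝ := (s ^ t + 7 * κ * lam ^ (t + 1) + 12 * δ) * n + 12 with hB
    have m0 := max_aux X.card D0 d e0
    have m1 := max_aux X.card D1 d e1
    have m2 := max_aux X.card D2 d e2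
    have st0 : 0 < s ^ t := by positivity
    have lt0 : 0 < κ * lam ^ (t + 1) := by positivity
    have stn : 0 ≤ s ^ t * n := by positivity
    have ltn : 0 ≤ κ * lam ^ (t + 1) * n := by positivity
    have x6' : (X.card : ℝ) ≤ s * (s ^ t * n) + κ * lam ^ (t + 1) * n := by
      refine x6.trans (le_of_eq ?_); ring
    have s7 : 7 * (s * (s ^ t * n)) ≤ s ^ t * n := by nlinarith
    have key : (X.card : ℝ) + 3 * max (2 * (X.card : ℝ)) d ≤ B := by
      have : max (2 * (X.card : ℝ)) d ≤ (B - X.card) / 3 := by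
        apply max_le
        · rw [hB]; nlinarith
        · rw [hB, hd]; nlinarith
      linarith
    have lle : κ * lam ^ (t + 1) * n ≤ κ * n := by
      have : lam ^ (t + 1) ≤ 1 := pow_le_one₀ hl0.le (by linarith)
      have := mul_le_mul_of_nonneg_left this hκ0.le
      have := mul_le_mul_of_nonneg_right this hn
      linarith
    have k4n : 32 * κ * n ≤ p ^ 3 * n := mul_le_mul_of_nonneg_right hκp hn
    push_cast at m0 m1 m2
    obtain ⟨S', A', a1, a2, a3, a4, a5, a6, a7, a8, a9, a10⟩ := d4 ((2 * X.card - D0) + (2 * X.card - D1) + (2 * X.card - D2) + 12 * h + 3) (by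
      push_cast
      rw [pow_succ] at zg'
      have kn : 0 ≤ κ * n := mul_nonneg hκ0.le hn
      nlinarith) (Or.inr le_rfl)
    have a10' : (S'.card : ℝ) ≤ B + 12 * h + 6 := by
      have : (S'.card : ℝ) ≤ ((X.card + 3 + (D0 + (2 * X.card - D0)) + (D1 + (2 * X.card - D1))
            + (D2 + (2 * X.card - D2)) + 12 * h + 3 : ℕ) : ℝ) := by exact_mod_cast a10
      push_cast at this
      linarith
    refine ⟨S', A', a1, a2, a3, a4, a5, a6, a7, ?_, fun h3 => by omega, ?_⟩
    · rw [Nat.even_iff] at x4 a8 ⊢; omega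
    · simp only [Nat.add_sub_cancel]
      have l1 : lam ^ L ≤ lam ^ t := pow_le_pow_of_le_one hl0.le (by linarith) (by omega)
      have l2 : (1 - 7 * lam) * κ * lam ^ L * n ≤ (1 - 7 * lam) * κ * lam ^ t * n := by
        have : 0 ≤ (1 - 7 * lam) * κ := mul_nonneg (by linarith) hκ0.le
        exact mul_le_mul_of_nonneg_right (mul_le_mul_of_nonneg_left l1 this) hn
      have e : lam ^ (t + 1) = lam * lam ^ t := by ring
      rw [hB, e] at a10'
      nlinarith

lemma chain (S : Setup G p δ K k0 h v) (L : ℕ) (s ρ lam C1 κ : ℝ) (hs : s = (1 - p) ^ 3)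
    (hL : 1 ≤ L) (hk : 3 * L + 3 ≤ k0) (hs0 : 0 < s) (hsρ : s < ρ) (hρl : ρ < lam) (hl7 : 7 * lam < 1)
    (hC1 : 1 ≤ C1) (hC : 2 * ρ ^ 2 + 3 ≤ C1 * (1 - 7 * ρ) * ρ ^ 2) (hκ0 : 0 < κ) (hκp : 32 * κ ≤ p ^ 3)
    (hκL : C1 * ρ ^ L ≤ κ * lam ^ L)
    (hE : 15 * δ * n + 12 * h + 9 * K + 40 ≤ p ^ 3 / 2 * n)
    (hE2 : 12 * δ * n + 12 * h + 18 ≤ (1 - 7 * lam) * κ * lam ^ L * n)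
    (hρK : ρ ^ 2 ≤ ρ ^ (K - 1) * n)
    (hZ : ∀ i, 1 ≤ i → i ≤ K + 1 → ((Zs G v K i).card : ℝ) ≤ ρ ^ (i - 1) * n)
    (hZ0 : Zs G v K (K + 1) = ∅) (hK : 1 ≤ K) :
    ∃ (A : SimpleGraph (Fin n)) (V : ℕ → Finset (Fin n)), A ≤ G ∧ V (K + 1) = ∅ ∧
      (∀ k, 2 ≤ k → k ≤ K → FStep A (V k : Set (Fin n)) (V (k + 1) : Set (Fin n))) ∧
      (∀ k, 2 ≤ k → k ≤ K + 1 → V k ⊆ V 2 ∧ LPr G v K L s ρ lam C1 κ k (V k)) := by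
  refine backward G K (LPr G v K L s ρ lam C1 κ) ?_ (fun i h2 hi X A hA hX =>
    S.mainStep L s ρ lam C1 κ hs hL hk hs0 hsρ hρl hl7 hC1 hC hκ0 hκp hκL hE hE2 hρK hZ i h2 hi X A hA hX) (K - 1) 2 (by omega) le_rfl
  have hn : (0:ℝ) ≤ n := Nat.cast_nonneg n
  have hρ0 : 0 < ρ := by linarith
  have hl0 : 0 < lam := by linarith
  refine ⟨by rw [hZ0], by simp, fun m a b => by omega, by simp, fun _ => ?_, ?_⟩
  · simp only [Finset.card_empty, Nat.cast_zero]; positivity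
  · simp only [Finset.card_empty, Nat.cast_zero]; positivity

end Setup

lemma parity_fix {α : Type*} [DecidableEq α] (Y : Finset α) (c : α → Fin 3) (a b : α) (ha : a ∈ Y) (hb : b ∈ Y)
    (hab : a ≠ b) (hY : Even Y.card) :
    ∃ c' : α → Fin 3, (∀ y, y ≠ a → y ≠ b → c' y = c y) ∧ (c' a = 0 ∨ c' a = 1) ∧ (c' b = 1 ∨ c' b = 2) ∧
      (∀ j, Even (Y.filter (fun y => c' y = j)).card) ∧
      ∀ j, (Y.filter (fun y => c' y = j)).card ≤ (Y.filter (fun y => c y = j)).card + 2 := by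
  obtain ⟨Y', hYe, haY, hbY⟩ : ∃ Y' : Finset α, Y = insert a (insert b Y') ∧ a ∉ insert b Y' ∧ b ∉ Y' := by
    refine ⟨(Y.erase a).erase b, ?_, ?_, ?_⟩
    · ext z; simp only [Finset.mem_insert, Finset.mem_erase]
      by_cases h1 : z = a
      · simp [h1, ha]
      · by_cases h2 : z = b
        · simp [h2, hb]
        · simp [h1, h2]
    · simp [hab]
    · simp
  have haY' : a ∉ Y' := fun h => haY (Finset.mem_insert_of_mem h)
  let N : Fin 3 → ℕ := fun j => (Y'.filter (fun y => c y = j)).card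
  let x : Fin 3 := if Even (N 0) then 1 else 0
  let y : Fin 3 := if Even (N 2) then 1 else 2
  let c' : α → Fin 3 := fun z => if z = a then x else if z = b then y else c z
  have ca : c' a = x := by simp [c']
  have cb : c' b = y := by simp [c', hab.symm]
  have cc : ∀ z, z ≠ a → z ≠ b → c' z = c z := fun z h1 h2 => by simp [c', h1, h2]
  have key : ∀ j, (Y.filter (fun y => c' y = j)).card = (if x = j then 1 else 0) + (if y = j then 1 else 0) + N j := by
    intro j
    have e : Y'.filter (fun y => c' y = j) = Y'.filter (fun y => c y = j) := by
      apply Finset.filter_congr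
      intro z hz
      rw [cc z (fun h => haY' (h ▸ hz)) (fun h => hbY (h ▸ hz))]
    rw [hYe, Finset.card_filter, Finset.sum_insert haY, Finset.sum_insert hbY, ← Finset.card_filter, e, ca, cb]
    simp only [N]; ring
  have tot : Y.card = (Y.filter (fun y => c' y = 0)).card + (Y.filter (fun y => c' y = 1)).card + (Y.filter (fun y => c' y = 2)).card := by
    rw [Finset.card_eq_sum_card_fiberwise (f := c') (t := Finset.univ) (fun x _ => by simp), Fin.sum_univ_three]
  have e0 : Even (Y.filter (fun y => c' y = 0)).card := by
    rw [key]; simp only [x, y]; split_ifs <;> simp_all [parity_simps]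
  have e2 : Even (Y.filter (fun y => c' y = 2)).card := by
    rw [key]; simp only [x, y]; split_ifs <;> simp_all [parity_simps]
  refine ⟨c', cc, ?_, ?_, ?_, ?_⟩
  · rw [ca]; simp only [x]; split_ifs <;> simp
  · rw [cb]; simp only [y]; split_ifs <;> simp
  · intro j
    fin_cases j
    · exact e0
    · show Even (Y.filter (fun y => c' y = 1)).card
      rw [tot] at hY
      rw [Nat.even_iff] at *; omega
    · exact e2
  · intro j
    rw [key]
    have : N j ≤ (Y.filter (fun y => c y = j)).card := by
      apply Finset.card_le_card
      apply Finset.filter_subset_filter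
      intro z hz; rw [hYe]; simp [hz]
    split_ifs <;> omega

namespace Setup
variable {n : ℕ} {G : SimpleGraph (Fin n)} {p δ : ℝ} {K k0 h : ℕ} {v : ℕ → Fin 3 → Fin n}

set_option maxHeartbeats 1000000 in
lemma level1 (S : Setup G p δ K k0 h v) (hK : 1 ≤ K) (k : ℕ) (hk2 : 2 ≤ k) (hk0 : k + 6 ≤ k0)
    (X : Finset (Fin n)) (A : SimpleGraph (Fin n)) (hA : A ≤ G)
    (hXZ : Zs G v K 2 ⊆ X) (hXR : ∀ j, v 1 j ∉ X) (hXR' : ∀ m, 2 ≤ m → m ≤ K → ∀ j, v m j ∈ X)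
    (hodd : Odd (n + X.card)) (e2 : k + 2 ≤ X.card)
    (e1 : (h:ℝ) + 1 + (X.card - (Zs G v K 2).card) ≤ ((p * (1 - p)) ^ (k + 6) - δ) * n)
    (e3 : 3 * (X.card:ℝ) + h + 3 * ((p ^ k + δ) * n) + 7 + 2 * (((1 - (1 - p) ^ 3) / 3 + 4 * δ) * n + 4) ≤ n) :
    ∃ A' : SimpleGraph (Fin n), A' ≤ G ∧ (∀ x ∈ X, ∀ y ∈ X, (A.Adj x y ↔ A'.Adj x y)) ∧
      FStep A' Set.univ (X : Set (Fin n)) := by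
  classical
  set R1 : Finset (Fin n) := Finset.univ.image (v 1) with hR1
  have vinj : ∀ {j k : Fin 3}, v 1 j = v 1 k → j = k := fun e => (S.inj le_rfl hK le_rfl hK e).2
  have cR1 : R1.card = 3 := by
    rw [hR1, Finset.card_image_of_injective _ (fun a b e => vinj e)]; simp
  have vR : ∀ j, v 1 j ∈ R1 := fun j => by simp [hR1]
  have memR : ∀ z, z ∈ R1 ↔ ∃ j, v 1 j = z := fun z => by simp [hR1]
  have XR : Disjoint X R1 := by
    rw [Finset.disjoint_right]; intro z hz
    obtain ⟨j, rfl⟩ := (memR z).1 hz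
    exact hXR j
  set Y : Finset (Fin n) := Finset.univ \ (X ∪ R1) with hY
  have memY : ∀ z, z ∈ Y ↔ z ∉ X ∧ z ∉ R1 := fun z => by simp [hY]
  have cY : Y.card + X.card + 3 = n := by
    have := Finset.card_sdiff_add_card_eq_card (Finset.subset_univ (X ∪ R1))
    rw [Finset.card_union_of_disjoint XR, cR1, Finset.card_univ, Fintype.card_fin] at this
    omega
  have YR : ∀ y ∈ Y, y ∉ Rall v K := by
    intro y hy hR
    obtain ⟨i, a, b, j, rfl⟩ := (mem_Rall _ _ _).1 hR
    rw [memY] at hy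
    rcases Nat.lt_or_ge i 2 with h2 | h2
    · obtain rfl : i = 1 := by omega
      exact hy.2 (vR j)
    · exact hy.1 (hXR' i h2 b j)
  obtain ⟨c, hc, hcb⟩ := S.split 1 le_rfl hK Y (fun y hy => by
      rw [mem_Zs]; exact ⟨YR y hy, fun i' a b => by omega⟩) (by
    intro y hy
    by_contra hcon
    push Not at hcon
    apply ((memY y).1 hy).1
    apply hXZ
    rw [mem_Zs]
    refine ⟨YR y hy, fun i' a b j => ?_⟩
    obtain rfl : i' = 1 := by omega
    exact hcon j)
  have hcb := hcb (by omega)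
  -- finder
  have find : ∀ (T P F : Finset (Fin n)) (j : Fin 3), T.card ≤ k + 6 → P ⊆ T → R1 ⊆ T → v 1 j ∈ P →
      (∀ z, z ∈ Y → z ∉ T → (∀ t ∈ T, (G.Adj t z ↔ t ∈ P)) → z ∈ F) → h + 1 ≤ F.card := by
    intro T P F j hT hP hRT hj hF
    have lo := S.U.ge' S.hp0 S.hp1 (k + 6) T P (by omega) hT hP
    have up : cnt G T P ≤ F.card + (X \ Zs G v K 2).card := by
      apply cnt_le_card
      intro z hz ha
      by_cases hzX : z ∈ X
      · right
        rw [Finset.mem_sdiff]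
        refine ⟨hzX, fun h2 => ?_⟩
        exact ((mem_Zs _ _ _ _ _).1 h2).2 1 le_rfl (by omega) j ((ha _ (hP hj)).2 hj)
      · left
        exact hF z ((memY z).2 ⟨hzX, fun h => hz (hRT h)⟩) hz ha
    rw [Finset.card_sdiff_of_subset hXZ] at up
    have c2 := Finset.card_le_card hXZ
    have : (cnt G T P : ℝ) ≤ F.card + (X.card - (Zs G v K 2).card) := by
      rw [← Nat.cast_sub c2]; exact_mod_cast up
    have : ((h + 1 : ℕ) : ℝ) ≤ F.card := by push_cast; linarith
    exact_mod_cast this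
  -- a and b
  obtain ⟨a, ha⟩ : ∃ a, a ∈ Y ∧ G.Adj (v 1 0) a ∧ G.Adj (v 1 1) a ∧ ¬ G.Adj (v 1 2) a := by
    have := find R1 {v 1 0, v 1 1} (Y.filter (fun a => G.Adj (v 1 0) a ∧ G.Adj (v 1 1) a ∧ ¬ G.Adj (v 1 2) a)) 0
      (by omega) (by intro z hz; simp at hz; rcases hz with rfl | rfl <;> exact vR _) subset_rfl (by simp) (by
        intro z hz _ ht
        rw [Finset.mem_filter]
        refine ⟨hz, (ht _ (vR 0)).2 (by simp), (ht _ (vR 1)).2 (by simp), fun h2 => ?_⟩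
        have := (ht _ (vR 2)).1 h2
        simp only [Finset.mem_insert, Finset.mem_singleton] at this
        rcases this with h3 | h3 <;> exact absurd (vinj h3) (by decide))
    obtain ⟨a, ha⟩ := Finset.card_pos.1 (lt_of_lt_of_le h.succ_pos this)
    exact ⟨a, Finset.mem_filter.1 ha⟩
  obtain ⟨b, hb⟩ : ∃ b, b ∈ Y ∧ G.Adj (v 1 1) b ∧ G.Adj (v 1 2) b ∧ ¬ G.Adj (v 1 0) b := by
    have := find R1 {v 1 1, v 1 2} (Y.filter (fun a => G.Adj (v 1 1) a ∧ G.Adj (v 1 2) a ∧ ¬ G.Adj (v 1 0) a)) 1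
      (by omega) (by intro z hz; simp at hz; rcases hz with rfl | rfl <;> exact vR _) subset_rfl (by simp) (by
        intro z hz _ ht
        rw [Finset.mem_filter]
        refine ⟨hz, (ht _ (vR 1)).2 (by simp), (ht _ (vR 2)).2 (by simp), fun h2 => ?_⟩
        have := (ht _ (vR 0)).1 h2
        simp only [Finset.mem_insert, Finset.mem_singleton] at this
        rcases this with h3 | h3 <;> exact absurd (vinj h3) (by decide))
    obtain ⟨a, ha⟩ := Finset.card_pos.1 (lt_of_lt_of_le h.succ_pos this)
    exact ⟨a, Finset.mem_filter.1 ha⟩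
  have hab : a ≠ b := by rintro rfl; exact hb.2.2.2 ha.2.1
  obtain ⟨c', h1, h2, h3, h4, h5⟩ := parity_fix Y c a b ha.1 hb.1 hab (by
    rw [Nat.even_iff]; rw [Nat.odd_iff] at hodd; omega)
  have hc' : ∀ y ∈ Y, G.Adj (v 1 (c' y)) y := by
    intro y hy
    by_cases hya : y = a
    · subst hya
      rcases h2 with h | h <;> rw [h]
      · exact ha.2.1
      · exact ha.2.2.1
    · by_cases hyb : y = b
      · subst hyb
        rcases h3 with h | h <;> rw [h]
        · exact hb.2.1
        · exact hb.2.2.1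
      · rw [h1 y hya hyb]; exact hc y hy
  let V : Fin 3 → Finset (Fin n) := fun j => Y.filter (fun y => c' y = j)
  have memV : ∀ j z, z ∈ V j ↔ z ∈ Y ∧ c' z = j := fun j z => by simp [V]
  have Vpat : ∀ j z, z ∈ Y → (∀ i, G.Adj (v 1 i) z → i = j) → z ∈ V j := fun j z hz hp =>
    (memV j z).2 ⟨hz, hp _ (hc' z hz)⟩
  have cV : Y.card = (V 0).card + (V 1).card + (V 2).card := by
    rw [Finset.card_eq_sum_card_fiberwise (f := c') (t := Finset.univ) (fun x _ => by simp), Fin.sum_univ_three]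
  have Vup : ∀ j, ((V j).card : ℝ) ≤ ((1 - (1 - p) ^ 3) / 3 + 4 * δ) * n + 4 + 2 := by
    intro j
    have t1 := hcb j
    have t2 : ((V j).card : ℝ) ≤ (Y.filter (fun y => c y = j)).card + 2 := by exact_mod_cast h5 j
    simp only [Nat.sub_self, pow_zero, mul_one] at t1
    linarith
  have Vlow : ∀ j, 2 * (X.card : ℝ) + h + 3 * ((p ^ k + δ) * n) ≤ (V j).card := by
    intro j
    have t0 := Vup 0
    have t1 := Vup 1
    have t2 := Vup 2
    have t3 : ((V 0).card + (V 1).card + (V 2).card : ℝ) + X.card + 3 = n := by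
      exact_mod_cast (by omega : (V 0).card + (V 1).card + (V 2).card + X.card + 3 = n)
    have : j = 0 ∨ j = 1 ∨ j = 2 := by fin_cases j <;> simp
    rcases this with rfl | rfl | rfl <;> linarith
  -- seeds
  obtain ⟨E, hEX, cE⟩ := Finset.exists_subset_card_eq e2
  obtain ⟨b1, b2, As, hb1, hb2, hbb, hAs, cAs, hAb1, hAb2⟩ : ∃ b1 b2 As, b1 ∈ X ∧ b2 ∈ X ∧ b1 ≠ b2 ∧ As ⊆ X ∧ As.card = k
      ∧ b1 ∉ As ∧ b2 ∉ As := by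
    obtain ⟨b1, hb1⟩ := Finset.card_pos.1 (by omega : 0 < E.card)
    have c1 := Finset.card_erase_of_mem hb1
    obtain ⟨b2, hb2⟩ := Finset.card_pos.1 (by omega : 0 < (E.erase b1).card)
    have c2 := Finset.card_erase_of_mem hb2
    refine ⟨b1, b2, (E.erase b1).erase b2, hEX hb1, hEX (Finset.mem_of_mem_erase hb2), (Finset.ne_of_mem_erase hb2).symm,
      fun z hz => hEX (Finset.mem_of_mem_erase (Finset.mem_of_mem_erase hz)), by omega, by simp, by simp⟩
  let F : Fin 3 → Bool → Bool → Finset (Fin n) := fun j β1 β2 =>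
    (V j).filter (fun z => (∀ i, G.Adj (v 1 i) z → i = j) ∧ (∀ a ∈ As, G.Adj a z) ∧ (G.Adj b1 z ↔ β1 = true) ∧ (G.Adj b2 z ↔ β2 = true))
  have memF : ∀ j β1 β2 z, z ∈ F j β1 β2 ↔ z ∈ V j ∧ (∀ i, G.Adj (v 1 i) z → i = j) ∧ (∀ a ∈ As, G.Adj a z) ∧ (G.Adj b1 z ↔ β1 = true) ∧ (G.Adj b2 z ↔ β2 = true) :=
    fun j β1 β2 z => by simp only [F, Finset.mem_filter]
  have Fsub : ∀ j β1 β2, F j β1 β2 ⊆ V j := fun j β1 β2 => Finset.filter_subset _ _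
  have Fcard : ∀ j β1 β2, ((F j β1 β2).card : ℝ) ≤ (p ^ k + δ) * n := by
    intro j β1 β2
    have up := S.U.le As As (by omega) subset_rfl
    rw [Nat.sub_self, pow_zero, mul_one, cAs] at up
    have : (F j β1 β2).card ≤ cnt G As As := by
      apply card_le_cnt
      intro z hz
      rw [memF] at hz
      refine ⟨fun h => ?_, fun t ht => by simp [ht, hz.2.2.1 t ht]⟩
      exact (G.irrefl (hz.2.2.1 z h))
    have : ((F j β1 β2).card : ℝ) ≤ cnt G As As := by exact_mod_cast this
    linarith
  have Fdeg : ∀ j β1 β2, ∀ x ∈ V j, h ≤ (nbr G (F j β1 β2) x).card := by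
    intro j β1 β2 x hx
    have hxY := (memY x).1 ((memV j x).1 hx).1
    set T := R1 ∪ As ∪ {b1, b2, x} with hT
    set P := T.filter (fun t => t = v 1 j ∨ t ∈ As ∨ (t = b1 ∧ β1 = true) ∨ (t = b2 ∧ β2 = true) ∨ t = x) with hP
    have memT : ∀ t, t ∈ T ↔ t ∈ R1 ∨ t ∈ As ∨ t = b1 ∨ t = b2 ∨ t = x := fun t => by
      simp only [hT, Finset.mem_union, Finset.mem_insert, Finset.mem_singleton, or_assoc]
    have memP : ∀ t, t ∈ P ↔ t ∈ T ∧ (t = v 1 j ∨ t ∈ As ∨ (t = b1 ∧ β1 = true) ∨ (t = b2 ∧ β2 = true) ∨ t = x) := fun t => by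
      simp only [hP, Finset.mem_filter]
    have cT : T.card ≤ k + 6 := by
      have q1 := Finset.card_union_le (R1 ∪ As) {b1, b2, x}
      have q2 := Finset.card_union_le R1 As
      have q3 : ({b1, b2, x} : Finset (Fin n)).card ≤ 3 := Finset.card_le_three
      have q4 : T.card = (R1 ∪ As ∪ {b1, b2, x}).card := rfl
      omega
    have := find T P (nbr G (F j β1 β2) x) j cT (Finset.filter_subset _ _) (fun z hz => (memT z).2 (Or.inl hz))
      ((memP _).2 ⟨(memT _).2 (Or.inl (vR j)), Or.inl rfl⟩) (by
      intro z hz hzT ht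
      have pat : ∀ i, G.Adj (v 1 i) z → i = j := by
        intro i hi
        have h7 := ((memP _).1 ((ht (v 1 i) ((memT _).2 (Or.inl (vR i)))).1 hi)).2
        rcases h7 with h7 | h7 | h7 | h7 | h7
        · exact vinj h7
        · exact absurd (hAs h7) (hXR i)
        · exact absurd (h7.1 ▸ hb1) (hXR i)
        · exact absurd (h7.1 ▸ hb2) (hXR i)
        · exact absurd (h7 ▸ vR i) hxY.2
      rw [mem_nbr, memF]
      have hxT : x ∈ T := (memT _).2 (by simp)
      have hb1T : b1 ∈ T := (memT _).2 (by simp)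
      have hb2T : b2 ∈ T := (memT _).2 (by simp)
      have b1v : b1 ≠ v 1 j := fun e => hXR j (e ▸ hb1)
      have b2v : b2 ≠ v 1 j := fun e => hXR j (e ▸ hb2)
      have b1x : b1 ≠ x := fun e => hxY.1 (e ▸ hb1)
      have b2x : b2 ≠ x := fun e => hxY.1 (e ▸ hb2)
      refine ⟨⟨Vpat j z hz pat, pat, fun a haA => ?_, ?_, ?_⟩, ?_⟩
      · have haT : a ∈ T := (memT _).2 (Or.inr (Or.inl haA))
        exact (ht a haT).2 ((memP _).2 ⟨haT, Or.inr (Or.inl haA)⟩)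
      · rw [ht b1 hb1T, memP]; simp [hb1T, b1v, hAb1, hbb, b1x]
      · rw [ht b2 hb2T, memP]; simp [hb2T, b2v, hAb2, hbb.symm, b2x]
      · exact (ht x hxT).2 ((memP _).2 ⟨hxT, by simp⟩))
    omega
  have Xdeg : ∀ j, ∀ x ∈ X, h ≤ (nbr G (V j \ (F j true true ∪ F j true false ∪ F j false true)) x).card := by
    intro j x hx
    obtain ⟨a0, ha0, hax⟩ : ∃ a0 ∈ As, a0 ≠ x := by
      by_contra hcon
      push Not at hcon
      have := Finset.card_le_card (fun z hz => Finset.mem_singleton.2 (hcon z hz) : As ⊆ {x})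
      simp at this; omega
    set T := R1 ∪ {a0, x} with hT
    have memT : ∀ t, t ∈ T ↔ t ∈ R1 ∨ t = a0 ∨ t = x := fun t => by
      simp only [hT, Finset.mem_union, Finset.mem_insert, Finset.mem_singleton]
    have cT : T.card ≤ k + 6 := by
      have q2 := Finset.card_union_le R1 {a0, x}
      have q3 : ({a0, x} : Finset (Fin n)).card ≤ 2 := Finset.card_le_two
      have q4 : T.card = (R1 ∪ {a0, x}).card := rfl
      omega
    have := find T {v 1 j, x} (nbr G (V j \ (F j true true ∪ F j true false ∪ F j false true)) x) j cT (by
        intro z hz; simp at hz; rw [memT]; rcases hz with rfl | rfl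
        · exact Or.inl (vR j)
        · simp) (fun z hz => (memT z).2 (Or.inl hz)) (by simp) (by
      intro z hz hzT ht
      have pat : ∀ i, G.Adj (v 1 i) z → i = j := by
        intro i hi
        have h7 := (ht (v 1 i) ((memT _).2 (Or.inl (vR i)))).1 hi
        simp only [Finset.mem_insert, Finset.mem_singleton] at h7
        rcases h7 with h7 | h7
        · exact vinj h7
        · exact absurd (h7 ▸ hx) (hXR i)
      have na : ¬ G.Adj a0 z := by
        intro h7
        have := (ht a0 ((memT _).2 (by simp))).1 h7
        simp only [Finset.mem_insert, Finset.mem_singleton] at this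
        rcases this with h8 | h8
        · exact hXR j (h8 ▸ hAs ha0)
        · exact hax h8
      rw [mem_nbr, Finset.mem_sdiff]
      refine ⟨⟨Vpat j z hz pat, ?_⟩, ?_⟩
      · simp only [Finset.mem_union, memF]
        rintro ((h9 | h9) | h9) <;> exact na (h9.2.2.1 a0 ha0)
      · exact (ht x ((memT _).2 (by simp))).2 (by simp))
    omega
  have XV : ∀ j, Disjoint X (V j) := by
    intro j
    rw [Finset.disjoint_right]; intro z hz
    exact ((memY z).1 ((memV j z).1 hz).1).1
  have petal : ∀ j, Petal G (X : Set (Fin n)) (V j : Set (Fin n)) (v 1 j) := by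
    intro j
    have f1 := Fcard j true true
    have f2 := Fcard j true false
    have f3 := Fcard j false true
    have lo := Vlow j
    have hX0 : (0:ℝ) ≤ X.card := Nat.cast_nonneg _
    have hh0 : (0:ℝ) ≤ h := Nat.cast_nonneg _
    have g1 : (0:ℝ) ≤ (F j true true).card := Nat.cast_nonneg _
    refine exactPetal G (v 1 j) X (V j) (F j true true) (F j true false) (F j false true) h S.hole (XV j) ?_ (h4 j)
      (Fsub _ _ _) (Fsub _ _ _) (Fsub _ _ _) ?_ ?_ ?_ (Xdeg j) (Fdeg _ _ _) (Fdeg _ _ _) (Fdeg _ _ _) ?_ ?_ ?_ ?_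
    · intro z hz
      have := (memV j z).1 hz
      rw [← this.2]; exact hc' z this.1
    · rw [Finset.disjoint_left]; intro z hz hz'; rw [memF] at hz hz'
      exact Bool.false_ne_true (hz'.2.2.2.2.1 (hz.2.2.2.2.2 rfl))
    · rw [Finset.disjoint_left]; intro z hz hz'; rw [memF] at hz hz'
      exact Bool.false_ne_true (hz'.2.2.2.1.1 (hz.2.2.2.1.2 rfl))
    · rw [Finset.disjoint_left]; intro z hz hz'; rw [memF] at hz hz'
      exact Bool.false_ne_true (hz'.2.2.2.1.1 (hz.2.2.2.1.2 rfl))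
    · have : ((X.card + h + (F j true true).card + (F j true false).card + (F j false true).card : ℕ) : ℝ) ≤ (V j).card := by
        push_cast; linarith
      exact_mod_cast this
    · have : ((2 * X.card + h + (F j true false).card + (F j false true).card : ℕ) : ℝ) ≤ (V j).card := by
        push_cast; linarith
      exact_mod_cast this
    · have : ((2 * X.card + 2 * (F j true false).card : ℕ) : ℝ) ≤ (V j).card := by
        push_cast; linarith
      exact_mod_cast this
    · have : ((2 * X.card + 2 * (F j false true).card : ℕ) : ℝ) ≤ (V j).card := by
        push_cast; linarith
      exact_mod_cast this
  refine assemble G A hA Set.univ (X : Set (Fin n)) (v 1) (fun j => (V j : Set (Fin n))) ?_ (S.tri 1 le_rfl hK) ?_ ?_ ?_ ?_ petal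
  · symm; rw [Set.eq_univ_iff_forall]
    intro z
    simp only [Set.mem_union, Finset.mem_coe, Set.mem_insert_iff, Set.mem_singleton_iff]
    by_cases hzX : z ∈ X
    · simp [hzX]
    · by_cases hzR : z ∈ R1
      · obtain ⟨j, rfl⟩ := (memR z).1 hzR
        fin_cases j <;> simp
      · have hzY := (memY z).2 ⟨hzX, hzR⟩
        have : z ∈ V (c' z) := (memV _ _).2 ⟨hzY, rfl⟩
        have h8 : c' z = 0 ∨ c' z = 1 ∨ c' z = 2 := by generalize c' z = t; fin_cases t <;> simp
        rcases h8 with h8 | h8 | h8 <;> rw [h8] at this <;> simp [this]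
  · intro j hj; exact hXR j hj
  · intro j k hj
    exact ((memY _).1 ((memV _ _).1 hj).1).2 (vR j)
  · intro j; exact_mod_cast (Finset.disjoint_coe.2 (XV j))
  · intro j k hjk
    refine Finset.disjoint_coe.2 ?_
    rw [Finset.disjoint_left]; intro z hz hz'
    rw [memV] at hz hz'
    exact hjk (hz.2.symm.trans hz'.2)

end Setup

namespace Setup
variable {n : ℕ} {G : SimpleGraph (Fin n)} {p δ : ℝ} {K k0 h : ℕ} {v : ℕ → Fin 3 → Fin n}

lemma full (S : Setup G p δ K k0 h v) (L : ℕ) (s ρ lam C1 κ : ℝ) (hs : s = (1 - p) ^ 3)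
    (hL : 1 ≤ L) (hk : 3 * L + 3 ≤ k0) (hs0 : 0 < s) (hsρ : s < ρ) (hρl : ρ < lam) (hl7 : 7 * lam < 1)
    (hC1 : 1 ≤ C1) (hC : 2 * ρ ^ 2 + 3 ≤ C1 * (1 - 7 * ρ) * ρ ^ 2) (hκ0 : 0 < κ) (hκp : 32 * κ ≤ p ^ 3)
    (hκL : C1 * ρ ^ L ≤ κ * lam ^ L)
    (hE : 15 * δ * n + 12 * h + 9 * K + 40 ≤ p ^ 3 / 2 * n)
    (hE2 : 12 * δ * n + 12 * h + 18 ≤ (1 - 7 * lam) * κ * lam ^ L * n)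
    (hρK : ρ ^ 2 ≤ ρ ^ (K - 1) * n)
    (hZ : ∀ i, 1 ≤ i → i ≤ K + 1 → ((Zs G v K i).card : ℝ) ≤ ρ ^ (i - 1) * n)
    (hZ0 : Zs G v K (K + 1) = ∅) (hK : 1 ≤ K) (k : ℕ) (hk2 : 2 ≤ k) (hk0 : k + 6 ≤ k0)
    (hpar : Even (n + K))
    (g2 : (k : ℝ) + 2 + 3 * K ≤ (s - δ) * n)
    (g1 : (h:ℝ) + 1 + 3 * K + (κ + δ) * n ≤ ((p * (1 - p)) ^ (k + 6) - δ) * n)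
    (g3 : 3 * ((s + κ) * n) + h + 3 * ((p ^ k + δ) * n) + 7 + 2 * (((1 - s) / 3 + 4 * δ) * n + 4) ≤ n) :
    ∃ (A : SimpleGraph (Fin n)) (V : ℕ → Finset (Fin n)), A ≤ G ∧ V 1 = Finset.univ ∧ V (K + 1) = ∅ ∧
      (∀ k, 1 ≤ k → k ≤ K → FStep A (V k : Set (Fin n)) (V (k + 1) : Set (Fin n))) ∧
      (∀ k, 2 ≤ k → k ≤ K + 1 → Zs G v K k ⊆ V k ∧ ((V k).card : ℝ) ≤ (s ^ (k - 1) + κ * lam ^ (k - 1)) * n) := by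
  obtain ⟨A, V, hA, hVK, hF, hV⟩ := S.chain L s ρ lam C1 κ hs hL hk hs0 hsρ hρl hl7 hC1 hC hκ0 hκp hκL hE hE2 hρK hZ hZ0 hK
  obtain ⟨-, x1, x2, x3, x4, -, x6⟩ := hV 2 le_rfl (by omega)
  have hn : (0:ℝ) ≤ n := Nat.cast_nonneg n
  have zge := S.Zs_ge 2 (by omega) (by omega) (by omega)
  have c2 : ((Zs G v K 2).card : ℝ) ≤ (V 2).card := by exact_mod_cast Finset.card_le_card x1
  norm_num at zge x6
  rw [← hs] at zge
  have hκ : κ * lam * n ≤ κ * n := by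
    have : κ * lam ≤ κ := by nlinarith
    exact mul_le_mul_of_nonneg_right this hn
  obtain ⟨A', hA', hag, hst⟩ := S.level1 hK k hk2 hk0 (V 2) A hA x1 (fun j => x2 1 le_rfl (by omega) j) x3
    (by rw [Nat.even_iff] at *; rw [Nat.odd_iff]; omega)
    (by
      have : ((k + 2 : ℕ) : ℝ) ≤ (V 2).card := by push_cast; linarith
      exact_mod_cast this)
    (by linarith)
    (by rw [← hs]; linarith)
  refine ⟨A', fun k => if k = 1 then Finset.univ else V k, hA', by simp, ?_, ?_, ?_⟩
  · dsimp only; rw [if_neg (by omega)]; exact hVK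
  · intro k h1 h2
    rcases Nat.lt_or_ge k 2 with h3 | h3
    · obtain rfl : k = 1 := by omega
      simpa using hst
    · simp only []
      rw [if_neg (by omega), if_neg (by omega)]
      refine (hF k h3 h2).congr ?_
      intro x hx y hy
      exact hag x ((hV k h3 (by omega)).1 hx) y ((hV k h3 (by omega)).1 hy)
  · intro k h1 h2
    simp only []
    rw [if_neg (by omega)]
    obtain ⟨-, x1, x2, x3, x4, -, x6⟩ := hV k h1 h2
    exact ⟨x1, x6⟩

end Setup

lemma log_small (η : ℝ) (hη : 0 < η) : ∀ᶠ n : ℕ in atTop, Real.log n ≤ η * n := by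
  have h := (Real.isLittleO_log_id_atTop.comp_tendsto tendsto_natCast_atTop_atTop).bound hη
  filter_upwards [h, eventually_ge_atTop 1] with n hn h1
  simp only [Function.comp, id, Real.norm_eq_abs] at hn
  rw [abs_of_nonneg (Nat.cast_nonneg n : (0:ℝ) ≤ n)] at hn
  exact (le_abs_self _).trans hn

lemma nat_large (M : ℝ) (η : ℝ) (hη : 0 < η) : ∀ᶠ n : ℕ in atTop, M ≤ η * n :=
  (tendsto_natCast_atTop_atTop.const_mul_atTop hη).eventually_ge_atTop M

lemma pickK (q ρ η : ℝ) (hq0 : 0 < q) (hq1 : q < 1) (hρ : q ^ 3 < ρ) (hρ1 : ρ < 1) (hη : 0 < η) :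
    ∀ᶠ n : ℕ in atTop, ∃ K : ℕ, Even (n + K) ∧ 1 ≤ K ∧ ρ ^ K * n < 1 ∧ ρ ^ 2 ≤ ρ ^ (K - 1) * n ∧ (K : ℝ) ≤ η * n ∧
      ⌈(5 / 24) * Real.logb (1 / q) n⌉₊ ≤ K := by
  have hρ0 : 0 < ρ := lt_trans (pow_pos hq0 3) hρ
  have hlρ : 0 < Real.log (1 / ρ) := Real.log_pos (by rw [lt_div_iff₀ hρ0]; linarith)
  have hlq : 0 < Real.log (1 / q) := Real.log_pos (by rw [lt_div_iff₀ hq0]; linarith)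
  have hl3 : Real.log (1 / ρ) ≤ 3 * Real.log (1 / q) := by
    have := Real.log_le_log (pow_pos hq0 3) hρ.le
    rw [Real.log_pow] at this
    rw [one_div, one_div, Real.log_inv, Real.log_inv]; push_cast at this; linarith
  filter_upwards [eventually_ge_atTop 1, log_small (η / 2 * Real.log (1 / ρ)) (by positivity), nat_large 2 (η / 2) (by positivity)]
    with n hn h1 h2
  have hn0 : (0:ℝ) < n := by exact_mod_cast hn
  have ex : ∃ K : ℕ, ρ ^ K * n < 1 := by
    obtain ⟨K, hK⟩ := exists_pow_lt_of_lt_one (by positivity : (0:ℝ) < 1 / n) hρ1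
    exact ⟨K, by rwa [lt_div_iff₀ hn0] at hK⟩
  obtain ⟨K0, a1, a2⟩ : ∃ K0 : ℕ, ρ ^ (K0 + 1) * n < 1 ∧ 1 ≤ ρ ^ K0 * n := by
    classical
    have hf := Nat.find_spec ex
    have hm := fun m => Nat.find_min ex (m := m)
    rcases Nat.eq_zero_or_pos (Nat.find ex) with h0 | h0
    · rw [h0, pow_zero, one_mul] at hf
      have : (1:ℝ) ≤ n := by exact_mod_cast hn
      linarith
    · refine ⟨Nat.find ex - 1, ?_, ?_⟩
      · rwa [Nat.sub_add_cancel h0]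
      · exact not_lt.1 (hm _ (by omega))
  have b1 : (K0 : ℝ) ≤ η / 2 * n := by
    have := Real.log_le_log one_pos a2
    rw [Real.log_one, Real.log_mul (by positivity) (by positivity), Real.log_pow] at this
    have e : Real.log ρ = - Real.log (1 / ρ) := by rw [one_div, Real.log_inv]; ring
    rw [e] at this
    have : K0 * Real.log (1 / ρ) ≤ (η / 2 * n) * Real.log (1 / ρ) := by linarith
    exact le_of_mul_le_mul_right this hlρ
  have b2 : ⌈(5 / 24) * Real.logb (1 / q) n⌉₊ ≤ K0 + 1 := by
    rw [Nat.ceil_le]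
    have := Real.log_lt_log (by positivity) a1
    rw [Real.log_one, Real.log_mul (by positivity) (by positivity), Real.log_pow] at this
    have e : Real.log ρ = - Real.log (1 / ρ) := by rw [one_div, Real.log_inv]; ring
    rw [e] at this
    have h5 : Real.log n ≤ ((K0 + 1 : ℕ) : ℝ) * (3 * Real.log (1 / q)) := by
      have : ((K0 + 1 : ℕ) : ℝ) * Real.log (1 / ρ) ≤ ((K0 + 1 : ℕ) : ℝ) * (3 * Real.log (1 / q)) :=
        mul_le_mul_of_nonneg_left hl3 (Nat.cast_nonneg _)
      linarith
    have h6 : Real.logb (1 / q) n ≤ 3 * ((K0 + 1 : ℕ) : ℝ) := by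
      rw [Real.logb, div_le_iff₀ hlq]; linarith
    have : (0:ℝ) ≤ ((K0 + 1 : ℕ) : ℝ) := Nat.cast_nonneg _
    linarith
  have b3 : ρ ^ (K0 + 1 + 1) * n < 1 := by
    rw [pow_succ]; nlinarith [pow_pos hρ0 (K0 + 1)]
  rcases Nat.even_or_odd (n + (K0 + 1)) with he | ho
  · refine ⟨K0 + 1, he, by omega, a1, ?_, by push_cast; linarith, b2⟩
    simp only [Nat.add_sub_cancel]; nlinarith
  · refine ⟨K0 + 2, ?_, by omega, b3, ?_, by push_cast; linarith, by omega⟩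
    · rw [Nat.even_iff]; rw [Nat.odd_iff] at ho; omega
    · show ρ ^ 2 ≤ ρ ^ (K0 + 1) * n
      have e3 : ρ ^ (K0 + 1) * n = ρ * (ρ ^ K0 * n) := by ring
      rw [e3]; nlinarith

lemma tailBound (q lam ε : ℝ) (hq0 : 0 < q) (hq1 : q < 1) (hl0 : 0 < lam) (hl : lam < q ^ ((12:ℝ) / 5)) (hε : 0 < ε) :
    ∀ᶠ n : ℕ in atTop, lam ^ ⌈(5 / 24) * Real.logb (1 / q) n⌉₊ * n ≤ ε * Real.sqrt n := by
  have hlq : 0 < Real.log (1 / q) := Real.log_pos (by rw [lt_div_iff₀ hq0]; linarith)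
  have elq : Real.log q = - Real.log (1 / q) := by rw [one_div, Real.log_inv]; ring
  have hll : Real.log lam < -(12 / 5 * Real.log (1 / q)) := by
    have := Real.log_lt_log hl0 hl
    rw [Real.log_rpow hq0, elq] at this; linarith
  set b : ℝ := - Real.log lam / Real.log (1 / q) with hb
  have hb1 : 12 / 5 < b := by rw [hb, lt_div_iff₀ hlq]; linarith
  have hlam : Real.log lam = - b * Real.log (1 / q) := by rw [hb]; field_simp
  have hlam1 : lam ≤ 1 := by
    apply le_of_lt; rw [← Real.log_neg_iff hl0]; nlinarith
  have t := (tendsto_rpow_neg_atTop (y := 5 * b / 24 - 1 / 2) (by linarith)).comp tendsto_natCast_atTop_atTop (α := ℕ)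
  filter_upwards [t.eventually_le_const hε, eventually_ge_atTop 1] with n h1 hn
  have hn0 : (0:ℝ) < n := by exact_mod_cast hn
  simp only [Function.comp] at h1
  have c1 : lam ^ ⌈(5 / 24) * Real.logb (1 / q) n⌉₊ ≤ (n:ℝ) ^ (-(5 * b / 24)) := by
    rw [← Real.rpow_natCast]
    refine (Real.rpow_le_rpow_of_exponent_ge hl0 hlam1 (Nat.le_ceil _)).trans (le_of_eq ?_)
    rw [Real.rpow_def_of_pos hl0, Real.rpow_def_of_pos hn0, hlam, Real.logb]
    congr 1; field_simp
  have c2 : (n:ℝ) ^ (-(5 * b / 24)) * n = (n:ℝ) ^ (-(5 * b / 24 - 1 / 2)) * Real.sqrt n := by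
    rw [Real.sqrt_eq_rpow, ← Real.rpow_add hn0]
    nth_rewrite 2 [← Real.rpow_one (n:ℝ)]
    rw [← Real.rpow_add hn0]; congr 1; ring
  calc _ ≤ (n:ℝ) ^ (-(5 * b / 24)) * n := mul_le_mul_of_nonneg_right c1 hn0.le
    _ = _ := c2
    _ ≤ _ := mul_le_mul_of_nonneg_right h1 (Real.sqrt_nonneg _)

lemma r_large (q : ℝ) (hq0 : 0 < q) (hq1 : q < 1) (L : ℕ) :
    ∀ᶠ n : ℕ in atTop, L ≤ ⌈(5 / 24) * Real.logb (1 / q) n⌉₊ := by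
  have t : Tendsto (fun n : ℕ => (5 / 24) * Real.logb (1 / q) n) atTop atTop :=
    ((Real.tendsto_logb_atTop (by rw [lt_div_iff₀ hq0]; linarith)).comp tendsto_natCast_atTop_atTop).const_mul_atTop (by norm_num)
  filter_upwards [t.eventually_ge_atTop (L:ℝ)] with n hn
  exact_mod_cast hn.trans (Nat.le_ceil _)

lemma sumBound (c : ℕ → ℝ) (n s lam κ δ ε K : ℝ) (r L : ℕ) (hn : 0 ≤ n) (hs0 : 0 < s) (hsl : s < lam) (hl : 7 * lam < 1)
    (hκ0 : 0 ≤ κ) (hκ : κ ≤ ε) (hLr : L ≤ r) (hsL : s ^ L ≤ ε / 2) (hδ : L * (δ * n + 3 * K) ≤ ε / 2 * n)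
    (c0 : ∀ i, 0 ≤ c i)
    (cu : ∀ i, 2 ≤ i → i ≤ r + 1 → c i ≤ (s ^ (i - 1) + κ * lam ^ (i - 1)) * n)
    (cl : ∀ i, 2 ≤ i → i ≤ L + 1 → (s ^ (i - 1) - δ) * n - 3 * K ≤ c i) :
    |(∑ i ∈ Finset.Icc 2 (r + 1), c i) - n * s / (1 - s)| ≤ ε * n := by
  have e : ∑ i ∈ Finset.Icc 2 (r + 1), c i = ∑ j ∈ Finset.range r, c (2 + j) := by
    rw [show Finset.Icc 2 (r + 1) = Finset.Ico 2 (r + 2) by ext; simp [Finset.mem_Icc, Finset.mem_Ico]; omega,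
      Finset.sum_Ico_eq_sum_range]
    simp
  have g : ∀ (x : ℝ) (m : ℕ), x < 1 → ∑ j ∈ Finset.range m, x ^ (2 + j - 1) = x / (1 - x) - x ^ m * (x / (1 - x)) := by
    intro x m hx
    have h1 : ∑ j ∈ Finset.range m, x ^ (2 + j - 1) = x * ∑ j ∈ Finset.range m, x ^ j := by
      rw [Finset.mul_sum]; apply Finset.sum_congr rfl; intro j _
      rw [show 2 + j - 1 = j + 1 by omega, pow_succ]; ring
    have h2 := mul_neg_geom_sum x m
    have h3 : (1 - x) ≠ 0 := by linarith
    rw [h1]; field_simp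
    linear_combination x * h2
  have fs : 0 ≤ s / (1 - s) ∧ s / (1 - s) ≤ 1 := ⟨div_nonneg hs0.le (by linarith), by rw [div_le_one (by linarith)]; linarith⟩
  have fl : 0 ≤ lam / (1 - lam) ∧ lam / (1 - lam) ≤ 1 := ⟨div_nonneg (by linarith) (by linarith), by rw [div_le_one (by linarith)]; linarith⟩
  have up : ∑ j ∈ Finset.range r, c (2 + j) ≤ (s / (1 - s) + κ) * n := by
    calc _ ≤ ∑ j ∈ Finset.range r, (s ^ (2 + j - 1) + κ * lam ^ (2 + j - 1)) * n := by
          apply Finset.sum_le_sum; intro j hj; rw [Finset.mem_range] at hj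
          exact cu _ (by omega) (by omega)
      _ = (∑ j ∈ Finset.range r, s ^ (2 + j - 1) + κ * ∑ j ∈ Finset.range r, lam ^ (2 + j - 1)) * n := by
          rw [← Finset.sum_mul, Finset.sum_add_distrib, Finset.mul_sum]
      _ ≤ _ := by
          apply mul_le_mul_of_nonneg_right _ hn
          rw [g s r (by linarith), g lam r (by linarith)]
          have p1 : 0 ≤ s ^ r * (s / (1 - s)) := mul_nonneg (pow_nonneg hs0.le _) fs.1
          have p2 : 0 ≤ lam ^ r * (lam / (1 - lam)) := mul_nonneg (pow_nonneg (by linarith) _) fl.1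
          nlinarith
  have lo : (s / (1 - s) - s ^ L) * n - L * (δ * n + 3 * K) ≤ ∑ j ∈ Finset.range r, c (2 + j) := by
    calc _ ≤ ∑ j ∈ Finset.range L, ((s ^ (2 + j - 1) - δ) * n - 3 * K) := by
          have : ∑ j ∈ Finset.range L, ((s ^ (2 + j - 1) - δ) * n - 3 * K) =
              (∑ j ∈ Finset.range L, s ^ (2 + j - 1)) * n - L * (δ * n + 3 * K) := by
            rw [Finset.sum_mul, ← nsmul_eq_mul, ← Finset.card_range L, ← Finset.sum_const, Finset.card_range,
              ← Finset.sum_sub_distrib]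
            apply Finset.sum_congr rfl; intro j _; ring
          rw [this, g s L (by linarith)]
          have : (s / (1 - s) - s ^ L) * n ≤ (s / (1 - s) - s ^ L * (s / (1 - s))) * n := by
            apply mul_le_mul_of_nonneg_right _ hn
            nlinarith [pow_pos hs0 L]
          linarith
      _ ≤ ∑ j ∈ Finset.range L, c (2 + j) := by
          apply Finset.sum_le_sum; intro j hj; rw [Finset.mem_range] at hj
          exact cl _ (by omega) (by omega)
      _ ≤ _ := Finset.sum_le_sum_of_subset_of_nonneg (by simpa using hLr) (fun i _ _ => c0 _)
  rw [e, abs_le, mul_div_assoc]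
  have k1 : κ * n ≤ ε * n := mul_le_mul_of_nonneg_right hκ hn
  have k2 : s ^ L * n ≤ ε / 2 * n := mul_le_mul_of_nonneg_right hsL hn
  constructor <;> linarith

lemma q_cube (p : ℝ) (hp1 : p < 1) (hp : 1 - 1 / (7 : ℝ) ^ ((1 : ℝ) / 3) < p) : 7 * (1 - p) ^ 3 < 1 := by
  set t : ℝ := (7 : ℝ) ^ ((1 : ℝ) / 3) with ht
  have t0 : 0 < t := by positivity
  have t3 : t ^ 3 = 7 := by
    rw [ht, ← Real.rpow_natCast, ← Real.rpow_mul (by norm_num)]; norm_num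
  have h1 : (1 - p) * t < 1 := by
    have : 1 - p < 1 / t := by linarith
    rwa [lt_div_iff₀ t0] at this
  have h2 : ((1 - p) * t) ^ 3 < 1 := pow_lt_one₀ (mul_nonneg (by linarith) t0.le) h1 (by norm_num)
  rw [mul_pow, t3] at h2; linarith

/-- the deterministic conclusion for one graph -/
def Concl (p ε : ℝ) (n : ℕ) (G : SimpleGraph (Fin n)) : Prop :=
  ∃ (A : SimpleGraph (Fin n)) (V : ℕ → Set (Fin n)),
          A ≤ G ∧
          IsRFlower A ⌈(5 / 24) * Real.logb (1 / (1 - p)) n⌉₊ V ∧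
          |(∑ i ∈ Finset.Icc 2 (⌈(5 / 24) * Real.logb (1 / (1 - p)) n⌉₊ + 1),
              ((V i).ncard : ℝ))
            - (n : ℝ) * (1 - p) ^ 3 / (1 - (1 - p) ^ 3)| ≤ ε * n ∧
          ((V (⌈(5 / 24) * Real.logb (1 / (1 - p)) n⌉₊ + 1)).ncard : ℝ)
            ≤ ε * Real.sqrt n

set_option maxHeartbeats 1000000 in
lemma det_main (p ε : ℝ) (hp0 : 0 < p) (hp1 : p < 1) (hε : 0 < ε)
    (s ρ lam τ C1 κ δ : ℝ) (k L k0 : ℕ) (hs : s = (1 - p) ^ 3) (hs0 : 0 < s) (hsρ : s < ρ) (hρl : ρ < lam) (hl7 : 7 * lam < 1)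
    (hlq : lam < (1 - p) ^ ((12:ℝ) / 5)) (hτ : τ ^ 3 = ρ) (hτ1 : τ ≤ 1) (hqτ : 1 - p < τ)
    (hC1 : 1 ≤ C1) (hC : 2 * ρ ^ 2 + 3 ≤ C1 * (1 - 7 * ρ) * ρ ^ 2)
    (hk2 : 2 ≤ k) (hpk : p ^ k ≤ (1 - 7 * s) / 3 / 12) (hκ0 : 0 < κ) (hκ1 : κ ≤ 1) (hκp : 32 * κ ≤ p ^ 3)
    (hκσ : κ ≤ (1 - 7 * s) / 3 / 12) (hκc : κ ≤ (p * (1 - p)) ^ (k + 6) / 8) (hκε : κ ≤ ε)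
    (hL : 1 ≤ L) (hκL : C1 * ρ ^ L ≤ κ * lam ^ L) (hsL : s ^ L ≤ ε / 2)
    (hδ0 : 0 < δ) (d1 : 100 * δ ≤ p ^ 3) (d2 : 100 * δ ≤ (1 - 7 * lam) * κ * lam ^ L) (d3 : 100 * δ ≤ s)
    (d4 : 100 * δ ≤ (p * (1 - p)) ^ (k + 6)) (d5 : 100 * δ ≤ (1 - 7 * s) / 3) (d6 : 100 * δ ≤ (τ - (1 - p)) * p ^ 2)
    (d7 : L * (100 * δ) ≤ ε) (hk0 : k0 = 3 * L + 3 + (k + 6)) :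
    ∀ᶠ n : ℕ in atTop, ∀ G : SimpleGraph (Fin n), UProp G p k0 δ → HProp G δ → Concl p ε n G := by
  have hq0 : 0 < 1 - p := by linarith
  have hq1 : 1 - p < 1 := by linarith
  filter_upwards [pickK (1 - p) ρ δ hq0 hq1 (by rw [← hs]; exact hsρ) (by linarith) hδ0,
    tailBound (1 - p) lam (ε / 2) hq0 hq1 (by linarith) hlq (by linarith), r_large (1 - p) hq0 hq1 L,
    eventually_ge_atTop 1, nat_large (k + 60) δ hδ0] with n ⟨K, hpar, hK1, hKn, hKρ, hKδ, hKr⟩ htail hLr hn hnl G hU hH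
  have hnR : (1:ℝ) ≤ n := by exact_mod_cast hn
  have hn0 : (0:ℝ) < n := by linarith
  have hU3 : UProp G p 3 δ := fun T P hT hP => hU T P (by omega) hP
  set r := ⌈(5 / 24) * Real.logb (1 / (1 - p)) n⌉₊ with hr
  have m1 := mul_le_mul_of_nonneg_right d1 hn0.le
  have m2 := mul_le_mul_of_nonneg_right d2 hn0.le
  have m3 := mul_le_mul_of_nonneg_right d3 hn0.le
  have m4 := mul_le_mul_of_nonneg_right d4 hn0.le
  have m5 := mul_le_mul_of_nonneg_right d5 hn0.le
  have m6 := mul_le_mul_of_nonneg_right d6 hn0.le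
  have m7 := mul_le_mul_of_nonneg_right d7 hn0.le
  have m8 := mul_le_mul_of_nonneg_right hκc hn0.le
  have m9 := mul_le_mul_of_nonneg_right hκσ hn0.le
  have m10 := mul_le_mul_of_nonneg_right hpk hn0.le
  have hk0R : (0:ℝ) ≤ k := Nat.cast_nonneg k
  obtain ⟨v, htri, hdis, hdom⟩ := dom_seq hU3 hp0 hp1 hτ1 hqτ hn K (by linarith) K le_rfl
  set h := ⌈δ * n⌉₊ with hh
  have hhle : (h:ℝ) ≤ δ * n + 1 := (Nat.ceil_lt_add_one (by positivity)).le
  have S : Setup G p δ K k0 h v := {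
    hp0 := hp0, hp1 := hp1, hδ := hδ0.le, tri := htri, dis := hdis, U := hU,
    hole := fun A B hAB hA hB => hH A B hAB (Nat.ceil_le.1 hA) (Nat.ceil_le.1 hB) }
  have hZ : ∀ i, 1 ≤ i → i ≤ K + 1 → ((Zs G v K i).card : ℝ) ≤ ρ ^ (i - 1) * n := by
    intro i h1 h2
    have := hdom (i - 1) (by omega)
    rw [hτ] at this
    refine le_trans ?_ this
    refine Nat.cast_le.2 (Finset.card_le_card ?_)
    intro z hz
    rw [mem_Zs] at hz
    simp only [Finset.mem_filter, Finset.mem_univ, true_and]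
    exact fun i2 a b => hz.2 i2 a (by omega)
  have hZ0 : Zs G v K (K + 1) = ∅ := by
    rw [← Finset.card_eq_zero]
    have := lt_of_le_of_lt (hZ (K + 1) (by omega) le_rfl) hKn
    have : (Zs G v K (K + 1)).card < 1 := by exact_mod_cast this
    omega
  obtain ⟨A, V, hA, hV1, hVK, hF, hV⟩ := S.full L s ρ lam C1 κ hs hL (by omega) hs0 hsρ hρl hl7 hC1 hC hκ0 hκp hκL
    (by linarith) (by linarith) hKρ hZ hZ0 hK1 k hk2 (by omega) hpar (by linarith) (by linarith) (by linarith)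
  have : Nonempty (Fin n) := ⟨⟨0, hn⟩⟩
  refine ⟨A, fun i => (V i : Set (Fin n)), hA, ?_, ?_, ?_⟩
  · refine isRFlower_of A r _ (by simp [hV1]) (fun i h1 h2 => hF i h1 (by omega)) ?_
    refine Good.maxC4 (good_chain A K (fun i => (V i : Set (Fin n))) (by simp [hVK]) (r + 1)
      (fun i h1 h2 => hF i (by omega) h2) (K - r) (r + 1) (by omega) le_rfl)
  · rw [← hs]
    refine sumBound _ n s lam κ δ ε K r L hn0.le hs0 (by linarith) hl7 hκ0.le hκε hLr hsL ?_ (fun i => Nat.cast_nonneg _) ?_ ?_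
    · have h1 : (L:ℝ) * (3 * K) ≤ L * (3 * (δ * n)) :=
        mul_le_mul_of_nonneg_left (by linarith) (Nat.cast_nonneg _)
      have h2 : 0 ≤ (L:ℝ) * (δ * n) := by positivity
      linarith
    · intro i h1 h2
      rw [Set.ncard_coe_finset]
      exact (hV i h1 (by omega)).2
    · intro i h1 h2
      rw [Set.ncard_coe_finset]
      have a := S.Zs_ge i (by omega) (by omega) (by omega)
      rw [← hs] at a
      have : ((Zs G v K i).card : ℝ) ≤ (V i).card := by exact_mod_cast Finset.card_le_card (hV i h1 (by omega)).1
      linarith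
  · rw [Set.ncard_coe_finset]
    have a := (hV (r + 1) (by omega) (by omega)).2
    rw [Nat.add_sub_cancel] at a
    have b1 : s ^ r ≤ lam ^ r := pow_le_pow_left₀ hs0.le (by linarith) r
    have b2 : κ * lam ^ r ≤ lam ^ r := mul_le_of_le_one_left (pow_nonneg (by linarith) _) hκ1
    have b3 : (s ^ r + κ * lam ^ r) * n ≤ (2 * lam ^ r) * n := mul_le_mul_of_nonneg_right (by linarith) hn0.le
    linarith

lemma all_main (p ε : ℝ) (hp0 : 0 < p) (hp1 : p < 1) (hp : 1 - 1 / (7 : ℝ) ^ ((1 : ℝ) / 3) < p) (hε : 0 < ε) :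
    Tendsto (fun n : ℕ => erMeasure n p {ω | Concl p ε n (graphOf ω)}) atTop (nhds 1) := by
  have h7 := q_cube p hp1 hp
  have hq0 : 0 < 1 - p := by linarith
  obtain ⟨s, hs⟩ : ∃ s, s = (1 - p) ^ 3 := ⟨_, rfl⟩
  have hs0 : 0 < s := by rw [hs]; positivity
  rw [← hs] at h7
  have hsq : s < (1 - p) ^ ((12:ℝ) / 5) := by
    rw [hs, ← Real.rpow_natCast]
    exact Real.rpow_lt_rpow_of_exponent_gt hq0 (by linarith) (by norm_num)
  obtain ⟨lam, hsl, hl'⟩ := exists_between (lt_min (by linarith : s < 1 / 7) hsq)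
  have hl7 : 7 * lam < 1 := by have := hl'.trans_le (min_le_left _ _); linarith
  have hlq := hl'.trans_le (min_le_right _ _)
  obtain ⟨ρ, hsρ, hρl⟩ := exists_between hsl
  have hρ0 : 0 < ρ := by linarith
  have hl0 : 0 < lam := by linarith
  obtain ⟨τ, hτ0, hτ⟩ : ∃ τ : ℝ, 0 ≤ τ ∧ τ ^ 3 = ρ := by
    refine ⟨ρ ^ ((1:ℝ) / 3), by positivity, ?_⟩
    rw [← Real.rpow_natCast, ← Real.rpow_mul hρ0.le]; norm_num
  have hτ1 : τ ≤ 1 := by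
    by_contra hc
    have := one_lt_pow₀ (not_le.1 hc) (by norm_num : 3 ≠ 0)
    linarith
  have hqτ : 1 - p < τ := by
    by_contra hc
    have := pow_le_pow_left₀ hτ0 (not_lt.1 hc) 3
    linarith
  obtain ⟨C1, hC1, hC⟩ : ∃ C1 : ℝ, 1 ≤ C1 ∧ 2 * ρ ^ 2 + 3 ≤ C1 * (1 - 7 * ρ) * ρ ^ 2 := by
    have h1 : 0 < 1 - 7 * ρ := by linarith
    refine ⟨(2 + 3 / ρ ^ 2) / (1 - 7 * ρ), ?_, le_of_eq ?_⟩
    · rw [le_div_iff₀ h1]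
      have : 0 < 3 / ρ ^ 2 := by positivity
      linarith
    · rw [div_mul_cancel₀ _ h1.ne']; field_simp
  have hσ : 0 < (1 - 7 * s) / 3 := by linarith
  obtain ⟨k, hk2, hpk⟩ : ∃ k : ℕ, 2 ≤ k ∧ p ^ k ≤ (1 - 7 * s) / 3 / 12 := by
    obtain ⟨k, hk⟩ := exists_pow_lt_of_lt_one (by positivity : 0 < (1 - 7 * s) / 3 / 12) hp1
    exact ⟨k + 2, by omega, (pow_le_pow_of_le_one hp0.le hp1.le (by omega)).trans hk.le⟩
  have hc : 0 < (p * (1 - p)) ^ (k + 6) := by positivity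
  obtain ⟨κ, hκ0, hκ⟩ : ∃ κ : ℝ, 0 < κ ∧ (κ ≤ 1 ∧ κ ≤ p ^ 3 / 32 ∧ κ ≤ (1 - 7 * s) / 3 / 12 ∧ κ ≤ (p * (1 - p)) ^ (k + 6) / 8 ∧ κ ≤ ε) := by
    refine ⟨min 1 (min (p ^ 3 / 32) (min ((1 - 7 * s) / 3 / 12) (min ((p * (1 - p)) ^ (k + 6) / 8) ε))), by positivity, ?_⟩
    simp only [← le_min_iff]; exact le_rfl
  obtain ⟨L, hL, hκL, hsL⟩ : ∃ L : ℕ, 1 ≤ L ∧ C1 * ρ ^ L ≤ κ * lam ^ L ∧ s ^ L ≤ ε / 2 := by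
    have hr1 : ρ / lam < 1 := by rwa [div_lt_one hl0]
    have hr0 : 0 ≤ ρ / lam := by positivity
    obtain ⟨L1, h1⟩ := exists_pow_lt_of_lt_one (by positivity : 0 < κ / C1) hr1
    obtain ⟨L2, h2⟩ := exists_pow_lt_of_lt_one (by positivity : 0 < ε / 2) (by linarith : s < 1)
    refine ⟨L1 + L2 + 1, by omega, ?_, (pow_le_pow_of_le_one hs0.le (by linarith) (by omega)).trans h2.le⟩
    have h3 := (pow_le_pow_of_le_one hr0 hr1.le (by omega : L1 ≤ L1 + L2 + 1)).trans h1.le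
    rw [div_pow, div_le_div_iff₀ (by positivity) (by positivity)] at h3
    linarith
  have hθ : 0 < (1 - 7 * lam) * κ * lam ^ L := by
    have : 0 < 1 - 7 * lam := by linarith
    positivity
  have hτp : 0 < (τ - (1 - p)) * p ^ 2 := mul_pos (by linarith) (by positivity)
  have hLpos : (0:ℝ) < L := by exact_mod_cast hL
  obtain ⟨m, hm0, hm⟩ : ∃ m : ℝ, 0 < m ∧ (m ≤ p ^ 3 ∧ m ≤ (1 - 7 * lam) * κ * lam ^ L ∧ m ≤ s ∧ m ≤ (p * (1 - p)) ^ (k + 6) ∧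
      m ≤ (1 - 7 * s) / 3 ∧ m ≤ (τ - (1 - p)) * p ^ 2 ∧ m ≤ ε / L) := by
    refine ⟨min (p ^ 3) (min ((1 - 7 * lam) * κ * lam ^ L) (min s (min ((p * (1 - p)) ^ (k + 6)) (min ((1 - 7 * s) / 3)
      (min ((τ - (1 - p)) * p ^ 2) (ε / L)))))), ?_, ?_⟩
    · simp only [lt_min_iff]
      exact ⟨by positivity, hθ, hs0, hc, hσ, hτp, by positivity⟩
    · simp only [← le_min_iff]; exact le_rfl
  obtain ⟨m1, m2, m3, m4, m5, m6, m7⟩ := hm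
  obtain ⟨k1, k2, k3, k4, k5⟩ := hκ
  have e : 100 * (m / 100) = m := by ring
  refine whp_of_det p hp0 hp1 (3 * L + 3 + (k + 6)) (m / 100) (m / 100) (by positivity) (by positivity) (Concl p ε)
    (det_main p ε hp0 hp1 hε s ρ lam τ C1 κ (m / 100) k L _ hs hs0 hsρ hρl hl7 hlq hτ hτ1 hqτ hC1 hC hk2 hpk hκ0 k1
      (by linarith) k3 k4 k5 hL hκL hsL (by positivity) (by rwa [e]) (by rwa [e]) (by rwa [e]) (by rwa [e]) (by rwa [e])
      (by rwa [e]) ?_ rfl)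
  rw [e]
  rw [le_div_iff₀ hLpos] at m7
  linarith

/-- For fixed `p ∈ (0,1)` with `p > 1 − 1/∛7`, whp `G(n,p)`
contains a spanning `r`-flower with `r = ⌈(5/24)·log_{1/(1−p)} n⌉`,
`|V²| + … + |V^{r+1}| = n((1−p)³ + o(1))/(1 − (1−p)³)` and `|V^{r+1}| = o(√n)`
(the `o(·)` terms are rendered by an arbitrary `ε > 0`). -/
theorem rflower_exists (p : ℝ) (hp0 : 0 < p) (hp1 : p < 1)
    (hp : 1 - 1 / (7 : ℝ) ^ ((1 : ℝ) / 3) < p) (ε : ℝ) (hε : 0 < ε) :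
    Tendsto (fun n : ℕ =>
      erMeasure n p {ω |
        ∃ (A : SimpleGraph (Fin n)) (V : ℕ → Set (Fin n)),
          A ≤ graphOf ω ∧
          IsRFlower A ⌈(5 / 24) * Real.logb (1 / (1 - p)) n⌉₊ V ∧
          |(∑ i ∈ Finset.Icc 2 (⌈(5 / 24) * Real.logb (1 / (1 - p)) n⌉₊ + 1),
              ((V i).ncard : ℝ))
            - (n : ℝ) * (1 - p) ^ 3 / (1 - (1 - p) ^ 3)| ≤ ε * n ∧
          ((V (⌈(5 / 24) * Real.logb (1 / (1 - p)) n⌉₊ + 1)).ncard : ℝ)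
            ≤ ε * Real.sqrt n})
      atTop (nhds 1) := by
  exact all_main p ε hp0 hp1 hp hε
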